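/- arXiv:1112.1716 — 2 statements merged into one kernel-verified Lean document; each statement's English description precedes it below -/
import Mathlib

section
/- Let d ≥ 1. There exists a constant m > 0, depending only on d, with the following property. Let Λ = Λ_L(x_c) be the open box of side L > 0 centered at x_c ∈ ℝ^d, let V : Λ → ℝ be measurable with ‖V‖_∞ ≤ K < ∞, and let ψ : closure(Λ) → ℝ be continuous on closure(Λ), twice continuously differentiable on Λ, vanishing on the boundary of Λ, with ψ square integrable on Λ and ζ := −Δψ + Vψ square integrable on Λ. Let Θ ⊆ Λ be a bounded measurable set with ‖ψ_Θ‖₂ > 0, and let x₀ ∈ Λ ∖ closure(Θ) be such that Q := sup_{y∈Θ} |y−x₀| ≥ 1. Then for every δ with 0 < δ ≤ min{dist(x₀, Θ), 1/24} such that B(x₀, δ) ⊆ Λ: (δ/Q)^{m(1+K^{2/3})(Q^{4/3} + log(‖ψ‖_{L²(Λ)}/‖ψ_Θ‖₂))} · ‖ψ_Θ‖₂² ≤ ‖ψ_{B(x₀,δ)}‖₂² + δ² ‖ζ‖_{L²(Λ)}². -/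
open MeasureTheory

/-- The Laplacian `Δf = ∑ j ∂²f/∂x_j²` of a function on `ℝ^d`. -/
noncomputable def lap {d : ℕ} (f : EuclideanSpace ℝ (Fin d) → ℝ)
    (x : EuclideanSpace ℝ (Fin d)) : ℝ :=
  ∑ i, fderiv ℝ (fun y => fderiv ℝ f y (EuclideanSpace.single i 1)) x
    (EuclideanSpace.single i 1)

/-- The open box `Λ_L(x_c) = x_c + (-L/2, L/2)^d` in `ℝ^d`. -/
def openBox {d : ℕ} (xc : EuclideanSpace ℝ (Fin d)) (L : ℝ) :
    Set (EuclideanSpace ℝ (Fin d)) :=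
  {y | ∀ i, |y i - xc i| < L / 2}

open Set Filter Topology

/-! ### Partial derivatives and the Laplacian -/

section PartialDerivatives

variable {d : ℕ}

/-- The partial derivative `∂f/∂x_i`. -/
noncomputable def pd (i : Fin d) (f : EuclideanSpace ℝ (Fin d) → ℝ)
    (x : EuclideanSpace ℝ (Fin d)) : ℝ :=
  fderiv ℝ f x (EuclideanSpace.single i 1)

variable {f g : EuclideanSpace ℝ (Fin d) → ℝ} {x : EuclideanSpace ℝ (Fin d)} {i j : Fin d}

lemma lap_eq_sum_pd (f : EuclideanSpace ℝ (Fin d) → ℝ) (x : EuclideanSpace ℝ (Fin d)) :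
    lap f x = ∑ i, pd i (pd i f) x := rfl

lemma pd_add (hf : DifferentiableAt ℝ f x) (hg : DifferentiableAt ℝ g x) :
    pd i (fun y => f y + g y) x = pd i f x + pd i g x := by
  simp only [pd]; rw [fderiv_fun_add hf hg]; rfl

lemma pd_sub (hf : DifferentiableAt ℝ f x) (hg : DifferentiableAt ℝ g x) :
    pd i (fun y => f y - g y) x = pd i f x - pd i g x := by
  simp only [pd]; rw [fderiv_fun_sub hf hg]; rfl

lemma pd_const (c : ℝ) : pd i (fun _ : EuclideanSpace ℝ (Fin d) => c) x = 0 := by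
  simp [pd]

lemma pd_mul (hf : DifferentiableAt ℝ f x) (hg : DifferentiableAt ℝ g x) :
    pd i (fun y => f y * g y) x = f x * pd i g x + g x * pd i f x := by
  simp only [pd]; rw [fderiv_fun_mul hf hg]; simp

lemma pd_const_mul (c : ℝ) (hf : DifferentiableAt ℝ f x) :
    pd i (fun y => c * f y) x = c * pd i f x := by
  simp only [pd]; rw [fderiv_const_mul hf]; simp

lemma pd_sum {ι : Type*} {s : Finset ι} {F : ι → EuclideanSpace ℝ (Fin d) → ℝ}
    (hF : ∀ k ∈ s, DifferentiableAt ℝ (F k) x) :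
    pd i (fun y => ∑ k ∈ s, F k y) x = ∑ k ∈ s, pd i (F k) x := by
  simp only [pd]; rw [fderiv_fun_sum hF]; simp

lemma pd_comp {h : ℝ → ℝ} {h' : ℝ} (hh : HasDerivAt h h' (f x)) (hf : DifferentiableAt ℝ f x) :
    pd i (fun y => h (f y)) x = h' * pd i f x := by
  have := (hh.comp_hasFDerivAt x hf.hasFDerivAt).fderiv
  simp only [Function.comp_def] at this
  simp [pd, this]

lemma Filter.EventuallyEq.pd (h : f =ᶠ[𝓝 x] g) : pd i f =ᶠ[𝓝 x] pd i g := by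
  filter_upwards [h.fderiv (𝕜 := ℝ)] with y hy
  simp only [_root_.pd, hy]

lemma Filter.EventuallyEq.lap_eq (h : f =ᶠ[𝓝 x] g) : lap f x = lap g x := by
  simp only [lap_eq_sum_pd]
  exact Finset.sum_congr rfl fun i _ => (h.pd.pd).self_of_nhds

lemma ContDiffAt.pd {m n : ℕ∞} (hf : ContDiffAt ℝ n f x) (hmn : m + 1 ≤ n) :
    ContDiffAt ℝ m (pd i f) x := by
  have := (hf.fderiv_right (m := m) (by exact_mod_cast hmn))
  exact this.clm_apply contDiffAt_const

lemma ContDiff.pd {m n : ℕ∞} (hf : ContDiff ℝ n f) (hmn : m + 1 ≤ n) :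
    ContDiff ℝ m (pd i f) :=
  contDiff_iff_contDiffAt.2 fun _ => hf.contDiffAt.pd hmn

lemma ContDiffAt.pd_one (hf : ContDiffAt ℝ 2 f x) : ContDiffAt ℝ 1 (_root_.pd i f) x :=
  ContDiffAt.pd (m := 1) (n := 2) hf (by norm_num)

lemma ContDiffAt.differentiableAt_pd (hf : ContDiffAt ℝ 2 f x) :
    DifferentiableAt ℝ (_root_.pd i f) x :=
  hf.pd_one.differentiableAt (by norm_num)

lemma ContDiffAt.differentiableAt_of_two (hf : ContDiffAt ℝ 2 f x) : DifferentiableAt ℝ f x :=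
  hf.differentiableAt (by norm_num)

lemma ContDiffAt.eventually_differentiableAt (hf : ContDiffAt ℝ 2 f x) :
    ∀ᶠ y in 𝓝 x, DifferentiableAt ℝ f y := by
  filter_upwards [hf.eventually (by simp)] with y hy
  exact hy.differentiableAt_of_two

lemma ContDiffAt.continuousAt_pd (hf : ContDiffAt ℝ 1 f x) : ContinuousAt (_root_.pd i f) x :=
  (ContDiffAt.pd (m := 0) (n := 1) hf (by norm_num)).continuousAt

lemma ContDiffAt.continuousAt_lap (hf : ContDiffAt ℝ 2 f x) : ContinuousAt (lap f) x := by
  simp only [funext (lap_eq_sum_pd f)]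
  exact tendsto_finsetSum _ fun i _ => hf.pd_one.continuousAt_pd

lemma ContDiff.continuous_pd (hf : ContDiff ℝ 1 f) : Continuous (_root_.pd i f) :=
  continuous_iff_continuousAt.2 fun _ => hf.contDiffAt.continuousAt_pd

lemma ContDiff.continuous_lap (hf : ContDiff ℝ 2 f) : Continuous (lap f) :=
  continuous_iff_continuousAt.2 fun _ => hf.contDiffAt.continuousAt_lap

lemma pd_comm (hf : ContDiffAt ℝ 2 f x) : pd i (pd j f) x = pd j (pd i f) x := by
  have hd : DifferentiableAt ℝ (fderiv ℝ f) x :=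
    (hf.fderiv_right (m := 1) (by norm_num)).differentiableAt (by norm_num)
  have key : ∀ a b : Fin d, pd a (pd b f) x =
      fderiv ℝ (fderiv ℝ f) x (EuclideanSpace.single a 1) (EuclideanSpace.single b 1) := by
    intro a b
    unfold pd
    rw [fderiv_clm_apply hd (differentiableAt_const _)]
    simp
  rw [key, key]
  exact (hf.isSymmSndFDerivAt (by simp)).eq _ _

lemma contDiff_coord (j : Fin d) {n : WithTop ℕ∞} :
    ContDiff ℝ n (fun y : EuclideanSpace ℝ (Fin d) => y j) :=
  (EuclideanSpace.proj (𝕜 := ℝ) j).contDiff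

lemma pd_coord (i j : Fin d) (x : EuclideanSpace ℝ (Fin d)) :
    pd i (fun y => y j) x = if i = j then 1 else 0 := by
  have : fderiv ℝ (fun y : EuclideanSpace ℝ (Fin d) => y j) x = EuclideanSpace.proj (𝕜 := ℝ) j :=
    (EuclideanSpace.proj (𝕜 := ℝ) j).fderiv
  simp only [pd, this]
  by_cases h : i = j <;> simp [h, eq_comm]

lemma pd_norm_sq (i : Fin d) (x : EuclideanSpace ℝ (Fin d)) :
    pd i (fun y => ‖y‖ ^ 2) x = 2 * x i := by
  have h : ∀ y : EuclideanSpace ℝ (Fin d), ‖y‖ ^ 2 = ∑ j, y j * y j := fun y => by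
    rw [EuclideanSpace.real_norm_sq_eq]; exact Finset.sum_congr rfl fun _ _ => sq _
  have hd : ∀ j : Fin d, DifferentiableAt ℝ (fun y : EuclideanSpace ℝ (Fin d) => y j) x :=
    fun j => (contDiff_coord (n := 1) j).contDiffAt.differentiableAt (by norm_num)
  simp only [h]
  rw [pd_sum (F := fun j y => y j * y j) fun j _ => (hd j).mul (hd j)]
  simp_rw [pd_mul (hd _) (hd _), pd_coord]
  simp [Finset.sum_add_distrib, two_mul]

lemma lap_mul (hf : ContDiffAt ℝ 2 f x) (hg : ContDiffAt ℝ 2 g x) :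
    lap (fun y => f y * g y) x =
      f x * lap g x + 2 * ∑ i, pd i f x * pd i g x + g x * lap f x := by
  simp only [lap_eq_sum_pd, Finset.mul_sum, ← Finset.sum_add_distrib]
  refine Finset.sum_congr rfl fun i _ => ?_
  have h1 : pd i (fun y => f y * g y) =ᶠ[𝓝 x] fun y => f y * pd i g y + g y * pd i f y := by
    filter_upwards [hf.eventually_differentiableAt, hg.eventually_differentiableAt] with y h1 h2
    exact pd_mul h1 h2
  have hf1 := hf.differentiableAt_of_two
  have hg1 := hg.differentiableAt_of_two
  have hf2 := hf.differentiableAt_pd (i := i)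
  have hg2 := hg.differentiableAt_pd (i := i)
  rw [h1.pd.self_of_nhds, pd_add (hf1.fun_mul hg2) (hg1.fun_mul hf2), pd_mul hf1 hg2,
    pd_mul hg1 hf2]
  ring

lemma lap_comp {h h' : ℝ → ℝ} {h'' : ℝ} (hh : ∀ᶠ s in 𝓝 (f x), HasDerivAt h (h' s) s)
    (hh' : HasDerivAt h' h'' (f x)) (hf : ContDiffAt ℝ 2 f x) :
    lap (fun y => h (f y)) x = h'' * ∑ i, pd i f x ^ 2 + h' (f x) * lap f x := by
  simp only [lap_eq_sum_pd, Finset.mul_sum, ← Finset.sum_add_distrib]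
  refine Finset.sum_congr rfl fun i _ => ?_
  have h1 : pd i (fun y => h (f y)) =ᶠ[𝓝 x] fun y => h' (f y) * pd i f y := by
    filter_upwards [hf.eventually_differentiableAt, hf.continuousAt.eventually hh] with y h1 h2
    exact pd_comp h2 h1
  have hf1 := hf.differentiableAt_of_two
  rw [h1.pd.self_of_nhds, pd_mul (f := fun y => h' (f y)) (hh'.differentiableAt.comp x hf1)
    hf.differentiableAt_pd, pd_comp hh' hf1]
  ring

lemma lap_const_mul (c : ℝ) (hf : ContDiffAt ℝ 2 f x) :
    lap (fun y => c * f y) x = c * lap f x := by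
  have := lap_mul (f := fun _ => c) contDiffAt_const hf
  simpa [lap_eq_sum_pd, pd_const, show pd _ (fun _ : EuclideanSpace ℝ (Fin d) => c) = fun _ => 0
    from funext fun _ => pd_const c] using this

lemma lap_sub (hf : ContDiffAt ℝ 2 f x) (hg : ContDiffAt ℝ 2 g x) :
    lap (fun y => f y - g y) x = lap f x - lap g x := by
  simp only [lap_eq_sum_pd, ← Finset.sum_sub_distrib]
  refine Finset.sum_congr rfl fun i _ => ?_
  have h1 : pd i (fun y => f y - g y) =ᶠ[𝓝 x] fun y => pd i f y - pd i g y := by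
    filter_upwards [hf.eventually_differentiableAt, hg.eventually_differentiableAt] with y h1 h2
    exact pd_sub h1 h2
  rw [h1.pd.self_of_nhds, pd_sub hf.differentiableAt_pd hg.differentiableAt_pd]

lemma lap_sum {ι : Type*} {s : Finset ι} {F : ι → EuclideanSpace ℝ (Fin d) → ℝ}
    (hF : ∀ k, ContDiff ℝ 2 (F k)) :
    lap (fun y => ∑ k ∈ s, F k y) x = ∑ k ∈ s, lap (F k) x := by
  simp only [lap_eq_sum_pd]
  rw [Finset.sum_comm]
  refine Finset.sum_congr rfl fun i _ => ?_
  have h1 : pd i (fun y => ∑ k ∈ s, F k y) = fun y => ∑ k ∈ s, pd i (F k) y :=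
    funext fun y => pd_sum fun k _ => (hF k).contDiffAt.differentiableAt_of_two
  rw [h1, pd_sum fun k _ => (hF k).contDiffAt.differentiableAt_pd]

/-! ### Integration by parts -/

lemma integral_pd_eq_zero {F : EuclideanSpace ℝ (Fin d) → ℝ} (hF : ContDiff ℝ 1 F)
    (hc : HasCompactSupport F) (i : Fin d) : ∫ x, pd i F x = 0 := by
  have hc' : HasCompactSupport (pd i F) := hc.fderiv_apply (𝕜 := ℝ) _
  have hi : Integrable (pd i F) := hF.continuous_pd.integrable_of_hasCompactSupport hc'
  have := integral_mul_fderiv_eq_neg_fderiv_mul_of_integrable (μ := volume)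
    (f := fun _ : EuclideanSpace ℝ (Fin d) => (1 : ℝ)) (g := F)
    (v := EuclideanSpace.single i (1 : ℝ)) (by simp) (by simp only [one_mul]; exact hi)
    (by simpa using hF.continuous.integrable_of_hasCompactSupport hc)
    (fun _ _ => differentiableAt_const _)
    (fun x _ => hF.contDiffAt.differentiableAt (by norm_num))
  simpa [pd] using this

lemma integral_sum_pd_eq_zero {F : Fin d → EuclideanSpace ℝ (Fin d) → ℝ}
    (hF : ∀ i, ContDiff ℝ 1 (F i)) (hc : ∀ i, HasCompactSupport (F i)) :
    ∫ x, ∑ i, pd i (F i) x = 0 := by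
  rw [integral_finsetSum]
  · exact Finset.sum_eq_zero fun i _ => integral_pd_eq_zero (hF i) (hc i) i
  · intro i _
    exact (hF i).continuous_pd.integrable_of_hasCompactSupport ((hc i).fderiv_apply (𝕜 := ℝ) _)

/-- Green's second identity on an open set, for a function vanishing off a compact subset. -/
lemma integral_mul_lap_comm {O A : Set (EuclideanSpace ℝ (Fin d))} (hO : IsOpen O)
    (hA : IsCompact A) (hAO : A ⊆ O) (hf : ContDiffOn ℝ 2 f O) (hg : ContDiffOn ℝ 2 g O)
    (h0 : ∀ x ∉ A, g x = 0) :
    ∫ x in O, f x * lap g x = ∫ x in O, lap f x * g x := by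
  have hg0 : ∀ x ∉ A, g =ᶠ[𝓝 x] fun _ => 0 := fun x hx => by
    filter_upwards [hA.isClosed.isOpen_compl.mem_nhds hx] with y hy using h0 y hy
  have hgx : ∀ x ∉ A, ∀ i, pd i g x = 0 := fun x hx i => by
    rw [(hg0 x hx).pd.self_of_nhds, pd_const]
  have hlx : ∀ x ∉ A, lap g x = 0 := fun x hx => by
    rw [(hg0 x hx).lap_eq]
    simp [lap_eq_sum_pd, show ∀ i : Fin d, pd i (fun _ : EuclideanSpace ℝ (Fin d) => (0 : ℝ)) =
      fun _ => 0 from fun i => funext fun _ => pd_const 0, pd_const]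
  have hfO : ∀ x ∈ O, ContDiffAt ℝ 2 f x := fun x hx => hf.contDiffAt (hO.mem_nhds hx)
  have hgO : ∀ x ∈ O, ContDiffAt ℝ 2 g x := fun x hx => hg.contDiffAt (hO.mem_nhds hx)
  let F : Fin d → EuclideanSpace ℝ (Fin d) → ℝ := fun i x => f x * pd i g x - pd i f x * g x
  have hF0 : ∀ i, ∀ x ∉ A, F i x = 0 := fun i x hx => by simp [F, hgx x hx, h0 x hx]
  have hF : ∀ i, ContDiff ℝ 1 (F i) := fun i => contDiff_iff_contDiffAt.2 fun x => by
    by_cases hx : x ∈ A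
    · have h1 := hfO x (hAO hx)
      have h2 := hgO x (hAO hx)
      exact ((h1.of_le (by norm_num)).mul h2.pd_one).sub
        (h1.pd_one.mul (h2.of_le (by norm_num)))
    · refine (contDiffAt_const (c := (0 : ℝ))).congr_of_eventuallyEq ?_
      filter_upwards [hA.isClosed.isOpen_compl.mem_nhds hx] with y hy using hF0 i y hy
  have hFc : ∀ i, HasCompactSupport (F i) := fun i => HasCompactSupport.intro hA (hF0 i)
  have hdiv : ∀ x ∈ O, ∑ i, pd i (F i) x = f x * lap g x - lap f x * g x := fun x hx => by
    have h1 := hfO x hx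
    have h2 := hgO x hx
    simp only [lap_eq_sum_pd, Finset.mul_sum, Finset.sum_mul, ← Finset.sum_sub_distrib]
    refine Finset.sum_congr rfl fun i _ => ?_
    rw [pd_sub (h1.differentiableAt_of_two.fun_mul h2.differentiableAt_pd)
      (h1.differentiableAt_pd.fun_mul h2.differentiableAt_of_two),
      pd_mul h1.differentiableAt_of_two h2.differentiableAt_pd,
      pd_mul h1.differentiableAt_pd h2.differentiableAt_of_two]
    ring
  have hint := integral_sum_pd_eq_zero hF hFc
  have hz : ∀ x ∉ A, ∑ i, pd i (F i) x = 0 := fun x hx => Finset.sum_eq_zero fun i _ => by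
    have : F i =ᶠ[𝓝 x] fun _ => 0 := by
      filter_upwards [hA.isClosed.isOpen_compl.mem_nhds hx] with y hy using hF0 i y hy
    rw [this.pd.self_of_nhds, pd_const]
  rw [← setIntegral_eq_integral_of_forall_compl_eq_zero (s := O)
    (fun x hx => hz x fun h => hx (hAO h)), setIntegral_congr_fun hO.measurableSet hdiv,
    integral_sub] at hint
  · linarith
  · have : IntegrableOn (fun x => f x * lap g x) A := by
      refine ContinuousOn.integrableOn_compact hA (fun x hx => ?_)
      exact ((hfO x (hAO hx)).continuousAt.mul (hgO x (hAO hx)).continuousAt_lap).continuousWithinAt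
    exact (this.of_forall_sdiff_eq_zero hO.measurableSet fun x hx => by simp [hlx x hx.2])
  · have : IntegrableOn (fun x => lap f x * g x) A := by
      refine ContinuousOn.integrableOn_compact hA (fun x hx => ?_)
      exact ((hfO x (hAO hx)).continuousAt_lap.mul (hgO x (hAO hx)).continuousAt).continuousWithinAt
    exact (this.of_forall_sdiff_eq_zero hO.measurableSet fun x hx => by simp [h0 x hx.2])

end PartialDerivatives

/-! ### A Carleman estimate with a radial weight -/

section Carleman

variable {d : ℕ}

lemma contDiff_of_vanish_near_zero {n : WithTop ℕ∞} {f : EuclideanSpace ℝ (Fin d) → ℝ} {η : ℝ}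
    (hη : 0 < η) (h0 : ∀ x, ‖x‖ < η → f x = 0) (hf : ∀ x, x ≠ 0 → ContDiffAt ℝ n f x) :
    ContDiff ℝ n f := contDiff_iff_contDiffAt.2 fun x => by
  by_cases hx : x = 0
  · refine (contDiffAt_const (c := (0 : ℝ))).congr_of_eventuallyEq ?_
    filter_upwards [Metric.ball_mem_nhds x hη] with y hy
    exact h0 y (by simpa [hx] using hy)
  · exact hf x hx

lemma lap_norm_sq (x : EuclideanSpace ℝ (Fin d)) : lap (fun y => ‖y‖ ^ 2) x = 2 * d := by
  have h : ∀ i : Fin d, pd i (fun y : EuclideanSpace ℝ (Fin d) => ‖y‖ ^ 2) =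
      fun y => 2 * y i := fun i => funext fun y => pd_norm_sq i y
  simp only [lap_eq_sum_pd, h]
  have hd : ∀ j : Fin d, DifferentiableAt ℝ (fun y : EuclideanSpace ℝ (Fin d) => y j) x :=
    fun j => (contDiff_coord (n := 1) j).contDiffAt.differentiableAt (by norm_num)
  simp_rw [pd_const_mul 2 (hd _), pd_coord]
  simp [mul_comm]

/-- The Pohozaev identity for the conformally invariant multiplier. -/
lemma integral_lap_mul_dilation_eq_zero {v : EuclideanSpace ℝ (Fin d) → ℝ} (hv : ContDiff ℝ 2 v)
    (hc : HasCompactSupport v) :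
    ∫ x, lap v x * (2 * ∑ j, x j * pd j v x + ((d : ℝ) - 2) * v x) = 0 := by
  let X : EuclideanSpace ℝ (Fin d) → ℝ := fun x => ∑ j, x j * pd j v x
  let N : EuclideanSpace ℝ (Fin d) → ℝ := fun x => ∑ j, pd j v x * pd j v x
  let F : Fin d → EuclideanSpace ℝ (Fin d) → ℝ := fun i x =>
    (2 * (X x * pd i v x) - x i * N x) + ((d : ℝ) - 2) * (v x * pd i v x)
  have hpd : ∀ i, ContDiff ℝ 1 (pd i v) := fun i => hv.pd (m := 1) (n := 2) (by norm_num)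
  have hX : ContDiff ℝ 1 X := ContDiff.sum fun j _ => (contDiff_coord j).mul (hpd j)
  have hN : ContDiff ℝ 1 N := ContDiff.sum fun j _ => (hpd j).mul (hpd j)
  have hv1 : ContDiff ℝ 1 v := hv.of_le (by norm_num)
  have hF : ∀ i, ContDiff ℝ 1 (F i) := fun i =>
    ((contDiff_const.mul (hX.mul (hpd i))).sub ((contDiff_coord i).mul hN)).add
      (contDiff_const.mul (hv1.mul (hpd i)))
  have hpc : ∀ i x, x ∉ tsupport v → pd i v x = 0 := fun i x hx => by
    have : v =ᶠ[𝓝 x] fun _ => 0 := notMem_tsupport_iff_eventuallyEq.1 hx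
    rw [this.pd.self_of_nhds, pd_const]
  have hFc : ∀ i, HasCompactSupport (F i) := fun i => HasCompactSupport.intro hc fun x hx => by
    simp [F, N, hpc _ x hx]
  rw [← integral_sum_pd_eq_zero hF hFc]
  congr 1
  ext x
  have dC : ∀ i, DifferentiableAt ℝ (fun y : EuclideanSpace ℝ (Fin d) => y i) x :=
    fun i => (contDiff_coord (n := 1) i).contDiffAt.differentiableAt (by norm_num)
  have dP : ∀ i, DifferentiableAt ℝ (pd i v) x :=
    fun i => (hpd i).contDiffAt.differentiableAt (by norm_num)
  have dX : DifferentiableAt ℝ X x := hX.contDiffAt.differentiableAt (by norm_num)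
  have dN : DifferentiableAt ℝ N x := hN.contDiffAt.differentiableAt (by norm_num)
  have dv : DifferentiableAt ℝ v x := hv1.contDiffAt.differentiableAt (by norm_num)
  have pX : ∀ i, pd i X x = pd i v x + ∑ j, x j * pd i (pd j v) x := fun i => by
    simp only [X]
    rw [pd_sum (F := fun j y => y j * pd j v y) fun j _ => (dC j).fun_mul (dP j)]
    simp_rw [pd_mul (dC _) (dP _), pd_coord]
    simp [Finset.sum_add_distrib, add_comm]
  have pN : ∀ i, pd i N x = 2 * ∑ j, pd j v x * pd i (pd j v) x := fun i => by
    simp only [N]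
    rw [pd_sum (F := fun j y => pd j v y * pd j v y) fun j _ => (dP j).fun_mul (dP j)]
    simp_rw [pd_mul (dP _) (dP _), ← two_mul, Finset.mul_sum]
  have pF : ∀ i, pd i (F i) x = 2 * (X x * pd i (pd i v) x + pd i v x * pd i X x)
      - (x i * pd i N x + N x) + ((d : ℝ) - 2) * (v x * pd i (pd i v) x + pd i v x * pd i v x) :=
    fun i => by
    simp only [F]
    rw [pd_add (((dX.fun_mul (dP i)).const_mul 2).fun_sub ((dC i).fun_mul dN))
      ((dv.fun_mul (dP i)).const_mul _), pd_sub ((dX.fun_mul (dP i)).const_mul 2)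
      ((dC i).fun_mul dN), pd_const_mul _ (dX.fun_mul (dP i)),
      pd_const_mul _ (dv.fun_mul (dP i)), pd_mul dX (dP i), pd_mul dv (dP i), pd_mul (dC i) dN,
      pd_coord]
    simp
  have hsw : ∑ i, pd i v x * ∑ j, x j * pd i (pd j v) x =
      ∑ i, x i * ∑ j, pd j v x * pd i (pd j v) x := by
    simp only [Finset.mul_sum]
    rw [Finset.sum_comm]
    refine Finset.sum_congr rfl fun i _ => Finset.sum_congr rfl fun j _ => ?_
    rw [pd_comm hv.contDiffAt]; ring
  have e1 : ∑ i, pd i (F i) x = 2 * X x * lap v x + 2 * (N x +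
      ∑ i, pd i v x * ∑ j, x j * pd i (pd j v) x) -
      (2 * ∑ i, x i * ∑ j, pd j v x * pd i (pd j v) x + d * N x) +
      ((d : ℝ) - 2) * (v x * lap v x + N x) := by
    simp_rw [pF, pX, pN]
    simp only [lap_eq_sum_pd, Finset.sum_add_distrib, Finset.sum_sub_distrib, ← Finset.mul_sum,
      mul_add, Finset.sum_const, Finset.card_univ, Fintype.card_fin, nsmul_eq_mul]
    have : ∑ i, x i * (2 * ∑ j, pd j v x * pd i (pd j v) x) =
        2 * ∑ i, x i * ∑ j, pd j v x * pd i (pd j v) x := by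
      rw [Finset.mul_sum]; exact Finset.sum_congr rfl fun _ _ => by ring
    rw [this]
    simp only [N]
    ring
  rw [e1, hsw]
  simp only [X]
  ring

/-- The potential of the conjugated operator. -/
noncomputable def conjPotential (α κ : ℝ) (x : EuclideanSpace ℝ (Fin d)) : ℝ :=
  α ^ 2 * (‖x‖ ^ 2)⁻¹ + α ^ 2 * κ ^ 2 * ‖x‖ ^ 2 - 2 * κ * α ^ 2 - 2 * α * κ

lemma contDiffAt_conjPotential {n : WithTop ℕ∞} (α κ : ℝ) {x : EuclideanSpace ℝ (Fin d)}
    (hx : x ≠ 0) : ContDiffAt ℝ n (conjPotential α κ) x := by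
  have h1 : ContDiffAt ℝ n (fun y : EuclideanSpace ℝ (Fin d) => (‖y‖ ^ 2)⁻¹) x :=
    (contDiff_norm_sq ℝ).contDiffAt.inv (by simpa using hx)
  exact (((contDiffAt_const.mul h1).add (contDiffAt_const.mul (contDiff_norm_sq ℝ).contDiffAt)).sub
    contDiffAt_const).sub contDiffAt_const

lemma pd_conjPotential (α κ : ℝ) {x : EuclideanSpace ℝ (Fin d)} (hx : x ≠ 0) (i : Fin d) :
    pd i (conjPotential α κ) x =
      (-α ^ 2 * (‖x‖ ^ 2)⁻¹ ^ 2 + α ^ 2 * κ ^ 2) * (2 * x i) := by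
  have hr : ‖x‖ ^ 2 ≠ 0 := by simpa using hx
  have h1 : HasDerivAt (fun s : ℝ => α ^ 2 * s⁻¹ + α ^ 2 * κ ^ 2 * s - 2 * κ * α ^ 2 - 2 * α * κ)
      (-α ^ 2 * (‖x‖ ^ 2)⁻¹ ^ 2 + α ^ 2 * κ ^ 2) (‖x‖ ^ 2) := by
    have := ((((hasDerivAt_inv hr).const_mul (α ^ 2)).add
      ((hasDerivAt_id (‖x‖ ^ 2)).const_mul (α ^ 2 * κ ^ 2))).sub_const (2 * κ * α ^ 2)).sub_const
      (2 * α * κ)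
    refine this.congr_deriv ?_
    field_simp
  have := pd_comp (i := i) h1
    ((contDiff_norm_sq ℝ (n := 1)).contDiffAt.differentiableAt (by norm_num))
  rw [pd_norm_sq] at this
  exact this

lemma integral_conjPotential_mul_dilation {v : EuclideanSpace ℝ (Fin d) → ℝ}
    (hv : ContDiff ℝ 2 v) (hc : HasCompactSupport v) {η : ℝ} (hη : 0 < η)
    (h0 : ∀ x, ‖x‖ < η → v x = 0) (α κ : ℝ) :
    ∫ x, conjPotential α κ x * v x * (2 * ∑ j, x j * pd j v x + ((d : ℝ) - 2) * v x) =
      ∫ x, (4 * κ * α ^ 2 * (1 - κ * ‖x‖ ^ 2) + 4 * α * κ) * v x ^ 2 := by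
  have hv1 : ContDiff ℝ 1 v := hv.of_le (by norm_num)
  let q : EuclideanSpace ℝ (Fin d) → ℝ := fun x => conjPotential α κ x * (v x * v x)
  have hq : ContDiff ℝ 1 q := contDiff_of_vanish_near_zero hη (fun x hx => by simp [q, h0 x hx])
    fun x hx => (contDiffAt_conjPotential α κ hx).mul (hv1.mul hv1).contDiffAt
  have hEv : ContDiff ℝ 1 (fun x => conjPotential α κ x * v x) :=
    contDiff_of_vanish_near_zero hη (fun x hx => by simp [h0 x hx])
    fun x hx => (contDiffAt_conjPotential α κ hx).mul hv1.contDiffAt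
  have hF : ∀ i : Fin d, ContDiff ℝ 1 (fun x => x i * q x) := fun i => (contDiff_coord i).mul hq
  have hFc : ∀ i : Fin d, HasCompactSupport (fun x => x i * q x) :=
    fun i => HasCompactSupport.intro hc fun x hx => by
      simp [q, image_eq_zero_of_notMem_tsupport hx]
  have hI := integral_sum_pd_eq_zero hF hFc
  have hdiv : ∀ x, ∑ i, pd i (fun x => x i * q x) x =
      conjPotential α κ x * v x * (2 * ∑ j, x j * pd j v x + ((d : ℝ) - 2) * v x) -
      (4 * κ * α ^ 2 * (1 - κ * ‖x‖ ^ 2) + 4 * α * κ) * v x ^ 2 := by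
    intro x
    have dC : ∀ i, DifferentiableAt ℝ (fun y : EuclideanSpace ℝ (Fin d) => y i) x :=
      fun i => (contDiff_coord (n := 1) i).contDiffAt.differentiableAt (by norm_num)
    have dq : DifferentiableAt ℝ q x := hq.contDiffAt.differentiableAt (by norm_num)
    have dv : DifferentiableAt ℝ v x := hv1.contDiffAt.differentiableAt (by norm_num)
    simp_rw [pd_mul (dC _) dq, pd_coord, if_true, mul_one]
    by_cases hx : x = 0
    · subst hx
      simp [q, h0 0 (by simpa using hη)]
    · have dE : DifferentiableAt ℝ (conjPotential α κ) x :=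
        (contDiffAt_conjPotential (n := 1) α κ hx).differentiableAt (by norm_num)
      have pq : ∀ i, pd i q x = conjPotential α κ x * (2 * v x * pd i v x) + (v x * v x) *
          ((-α ^ 2 * (‖x‖ ^ 2)⁻¹ ^ 2 + α ^ 2 * κ ^ 2) * (2 * x i)) := fun i => by
        simp only [q]
        rw [pd_mul dE (dv.fun_mul dv), pd_mul dv dv, pd_conjPotential α κ hx]
        ring
      have hr : ‖x‖ ^ 2 ≠ 0 := by simpa using hx
      have hs : ∑ i, x i * x i = ‖x‖ ^ 2 := by
        rw [EuclideanSpace.real_norm_sq_eq]; exact Finset.sum_congr rfl fun _ _ => (sq _).symm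
      have e : ∑ i, (x i * pd i q x + q x) =
          2 * v x * conjPotential α κ x * ∑ i, x i * pd i v x + 2 * (v x * v x) *
          (-α ^ 2 * (‖x‖ ^ 2)⁻¹ ^ 2 + α ^ 2 * κ ^ 2) * ∑ i, x i * x i + d * q x := by
        rw [Finset.mul_sum, Finset.mul_sum, ← Finset.sum_add_distrib, Finset.sum_add_distrib]
        refine congrArg₂ (· + ·) (Finset.sum_congr rfl fun i _ => ?_) (by simp)
        rw [pq]
        ring
      rw [e, hs]
      simp only [q, conjPotential]
      field_simp
      ring
  simp_rw [hdiv] at hI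
  rw [integral_sub] at hI
  · linarith
  · refine Continuous.integrable_of_hasCompactSupport ?_ ?_
    · refine hEv.continuous.mul ((continuous_const.mul (continuous_finsetSum _ fun j _ => ?_)).add
        (continuous_const.mul hv.continuous))
      exact (contDiff_coord (n := 0) j).continuous.mul hv1.continuous_pd
    · exact HasCompactSupport.intro hc fun x hx => by simp [image_eq_zero_of_notMem_tsupport hx]
  · refine Continuous.integrable_of_hasCompactSupport ?_ ?_
    · have := hv.continuous
      fun_prop
    · exact HasCompactSupport.intro hc fun x hx => by simp [image_eq_zero_of_notMem_tsupport hx]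

/-- The radial Carleman weight `|x|^{-α} e^{ακ|x|²/2}`, smooth away from the origin. -/
noncomputable def carlemanWeight (α κ : ℝ) (x : EuclideanSpace ℝ (Fin d)) : ℝ :=
  Real.exp (-(α / 2 * Real.log (‖x‖ ^ 2) - α * κ / 2 * ‖x‖ ^ 2))

lemma carlemanWeight_pos (α κ : ℝ) (x : EuclideanSpace ℝ (Fin d)) : 0 < carlemanWeight α κ x :=
  Real.exp_pos _

lemma contDiffAt_carlemanWeight {n : WithTop ℕ∞} (α κ : ℝ) {x : EuclideanSpace ℝ (Fin d)}
    (hx : x ≠ 0) : ContDiffAt ℝ n (carlemanWeight α κ) x := by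
  have h2 : ContDiffAt ℝ n (fun y : EuclideanSpace ℝ (Fin d) => ‖y‖ ^ 2) x :=
    (contDiff_norm_sq ℝ).contDiffAt
  have h1 : ContDiffAt ℝ n (fun y : EuclideanSpace ℝ (Fin d) => Real.log (‖y‖ ^ 2)) x :=
    h2.log (by simpa using hx)
  exact (((contDiffAt_const.mul h1).sub (contDiffAt_const.mul h2)).neg).exp

/-- Conjugation of the Laplacian by the Carleman weight. -/
lemma carlemanWeight_mul_lap {u : EuclideanSpace ℝ (Fin d) → ℝ} (hu : ContDiff ℝ 2 u) (α κ : ℝ)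
    {x : EuclideanSpace ℝ (Fin d)} (hx : x ≠ 0) {v : EuclideanSpace ℝ (Fin d) → ℝ}
    (hv : v = fun y => carlemanWeight α κ y * u y) :
    carlemanWeight α κ x * lap u x = lap v x + conjPotential α κ x * v x +
      α * ((‖x‖ ^ 2)⁻¹ - κ) * (2 * ∑ j, x j * pd j v x + ((d : ℝ) - 2) * v x) := by
  have hr : 0 < ‖x‖ ^ 2 := by positivity
  let H : ℝ → ℝ := fun s => Real.exp (α / 2 * Real.log s - α * κ / 2 * s)
  let H' : ℝ → ℝ := fun s => H s * (α / 2 * s⁻¹ - α * κ / 2)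
  have hH : ∀ s, 0 < s → HasDerivAt H (H' s) s := fun s hs =>
    (((Real.hasDerivAt_log hs.ne').const_mul (α / 2)).sub
      ((hasDerivAt_id s).const_mul (α * κ / 2))).exp.congr_deriv (by simp [H', H])
  have hH' : HasDerivAt H' (H (‖x‖ ^ 2) * ((α / 2 * (‖x‖ ^ 2)⁻¹ - α * κ / 2) ^ 2 -
      α / 2 * (‖x‖ ^ 2)⁻¹ ^ 2)) (‖x‖ ^ 2) := by
    refine ((hH _ hr).mul (((hasDerivAt_inv hr.ne').const_mul (α / 2)).sub_const
      (α * κ / 2))).congr_deriv ?_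
    simp only [H']
    field_simp
    ring
  let h : EuclideanSpace ℝ (Fin d) → ℝ := fun y => H (‖y‖ ^ 2)
  have hN : ContDiffAt ℝ 2 (fun y : EuclideanSpace ℝ (Fin d) => ‖y‖ ^ 2) x :=
    (contDiff_norm_sq ℝ).contDiffAt
  have hh2 : ContDiffAt ℝ 2 h x := by
    have h1 : ContDiffAt ℝ 2 (fun y : EuclideanSpace ℝ (Fin d) => Real.log (‖y‖ ^ 2)) x :=
      hN.log hr.ne'
    exact ((contDiffAt_const.mul h1).sub (contDiffAt_const.mul hN)).exp
  have hgh : ∀ y, carlemanWeight α κ y * h y = 1 := fun y => by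
    simp only [carlemanWeight, h, H]
    rw [← Real.exp_add]; simp
  have huv : u = fun y => h y * v y := funext fun y => by
    rw [hv]; simp only
    rw [← mul_assoc, mul_comm (h y), hgh, one_mul]
  have hv2 : ContDiffAt ℝ 2 v x := by
    rw [hv]; exact (contDiffAt_carlemanWeight α κ hx).mul hu.contDiffAt
  have hev : ∀ᶠ s in 𝓝 (‖x‖ ^ 2), HasDerivAt H (H' s) s := by
    filter_upwards [lt_mem_nhds hr] with s hs using hH s hs
  have plap := lap_comp hev hH' hN
  have ph : ∀ i, pd i h x = H' (‖x‖ ^ 2) * (2 * x i) := fun i => by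
    have := pd_comp (i := i) (hH _ hr) hN.differentiableAt_of_two
    rw [pd_norm_sq] at this
    exact this
  have hs : ∑ i, x i ^ 2 = ‖x‖ ^ 2 := (EuclideanSpace.real_norm_sq_eq x).symm
  simp_rw [pd_norm_sq, lap_norm_sq, mul_pow, ← Finset.mul_sum, hs] at plap
  have hlap : lap h x = h x * (4 * ‖x‖ ^ 2 * ((α / 2 * (‖x‖ ^ 2)⁻¹ - α * κ / 2) ^ 2 -
      α / 2 * (‖x‖ ^ 2)⁻¹ ^ 2) + 2 * d * (α / 2 * (‖x‖ ^ 2)⁻¹ - α * κ / 2)) := by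
    refine plap.trans ?_
    simp only [H', h]
    ring
  have hsum : ∑ i, pd i h x * pd i v x =
      h x * (α * ((‖x‖ ^ 2)⁻¹ - κ)) * ∑ i, x i * pd i v x := by
    rw [Finset.mul_sum]
    refine Finset.sum_congr rfl fun i _ => ?_
    rw [ph]
    simp only [H', h]
    ring
  have hlu : lap u x = h x * lap v x + 2 * ∑ i, pd i h x * pd i v x + v x * lap h x := by
    conv_lhs => rw [huv]
    exact lap_mul hh2 hv2
  rw [hlu, hsum, hlap]
  have key : ∀ T : ℝ, carlemanWeight α κ x * (h x * T) = T := fun T => by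
    rw [← mul_assoc, hgh, one_mul]
  have : carlemanWeight α κ x * (h x * lap v x + 2 * (h x * (α * ((‖x‖ ^ 2)⁻¹ - κ)) *
      ∑ i, x i * pd i v x) + v x * (h x * (4 * ‖x‖ ^ 2 * ((α / 2 * (‖x‖ ^ 2)⁻¹ - α * κ / 2) ^ 2 -
      α / 2 * (‖x‖ ^ 2)⁻¹ ^ 2) + 2 * d * (α / 2 * (‖x‖ ^ 2)⁻¹ - α * κ / 2)))) =
      carlemanWeight α κ x * (h x * (lap v x + 2 * ((α * ((‖x‖ ^ 2)⁻¹ - κ)) *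
      ∑ i, x i * pd i v x) + v x * ((4 * ‖x‖ ^ 2 * ((α / 2 * (‖x‖ ^ 2)⁻¹ - α * κ / 2) ^ 2 -
      α / 2 * (‖x‖ ^ 2)⁻¹ ^ 2) + 2 * d * (α / 2 * (‖x‖ ^ 2)⁻¹ - α * κ / 2))))) := by ring
  rw [this, key]
  simp only [conjPotential]
  field_simp
  ring

/-- The Carleman estimate for the weight `carlemanWeight α κ`. -/
theorem carleman_estimate {u : EuclideanSpace ℝ (Fin d) → ℝ} (hu : ContDiff ℝ 2 u)
    (hc : HasCompactSupport u) {η α κ : ℝ} (hη : 0 < η) (hα : 0 < α) (hκ : 0 < κ)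
    (h0 : ∀ x, ‖x‖ < η → u x = 0) (h1 : ∀ x, 1 < 2 * κ * ‖x‖ ^ 2 → u x = 0) :
    4 * κ * α ^ 3 * ∫ x, carlemanWeight α κ x ^ 2 * u x ^ 2 ≤
      ∫ x, ‖x‖ ^ 2 * (carlemanWeight α κ x * lap u x) ^ 2 := by
  obtain ⟨v, hv⟩ : ∃ v : EuclideanSpace ℝ (Fin d) → ℝ, v = fun y => carlemanWeight α κ y * u y :=
    ⟨_, rfl⟩
  have hvx : ∀ x, v x = carlemanWeight α κ x * u x := fun x => congrFun hv x
  have hv2 : ContDiff ℝ 2 v := contDiff_of_vanish_near_zero hη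
    (fun x hx => by simp [hvx, h0 x hx])
    (fun x hx => by rw [hv]; exact (contDiffAt_carlemanWeight α κ hx).mul hu.contDiffAt)
  have hvc : HasCompactSupport v := HasCompactSupport.intro hc fun x hx => by
    simp [hvx, image_eq_zero_of_notMem_tsupport hx]
  have hv0 : ∀ x, ‖x‖ < η → v x = 0 := fun x hx => by simp [hvx, h0 x hx]
  have hz : ∀ {f : EuclideanSpace ℝ (Fin d) → ℝ} {x}, f =ᶠ[𝓝 x] (fun _ => 0) → lap f x = 0 :=
    fun {f x} hf => by
    rw [hf.lap_eq]
    simp [lap_eq_sum_pd, show ∀ i : Fin d, pd i (fun _ : EuclideanSpace ℝ (Fin d) => (0 : ℝ)) =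
      fun _ => 0 from fun i => funext fun _ => pd_const 0, pd_const]
  have hu0 : ∀ x, ‖x‖ < η → u =ᶠ[𝓝 x] fun _ => 0 := fun x hx => by
    filter_upwards [(isOpen_lt continuous_norm continuous_const).mem_nhds hx] with y hy
      using h0 y hy
  have hu1 : ∀ x, 1 < 2 * κ * ‖x‖ ^ 2 → v =ᶠ[𝓝 x] fun _ => 0 := fun x hx => by
    filter_upwards [(isOpen_lt (f := fun _ => (1 : ℝ))
      (g := fun x : EuclideanSpace ℝ (Fin d) => 2 * κ * ‖x‖ ^ 2) continuous_const
      (by fun_prop)).mem_nhds hx] with y hy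
    simp [hvx, h1 y hy]
  let X : EuclideanSpace ℝ (Fin d) → ℝ := fun x => 2 * ∑ j, x j * pd j v x + ((d : ℝ) - 2) * v x
  have hXc : Continuous X := by
    refine (continuous_const.mul (continuous_finsetSum _ fun j _ => ?_)).add
      (continuous_const.mul hv2.continuous)
    exact (contDiff_coord (n := 0) j).continuous.mul (hv2.of_le (by norm_num)).continuous_pd
  have hEv : Continuous (fun x => conjPotential α κ x * v x) :=
    (contDiff_of_vanish_near_zero (n := 0) hη (fun x hx => by simp [hv0 x hx])
    fun x hx => (contDiffAt_conjPotential α κ hx).mul (hv2.of_le (by norm_num)).contDiffAt).continuous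
  have hlc : ∀ x ∉ tsupport v, lap v x = 0 := fun x hx => hz (notMem_tsupport_iff_eventuallyEq.1 hx)
  have hi1 : Integrable (fun x => lap v x * X x) :=
    (hv2.continuous_lap.mul hXc).integrable_of_hasCompactSupport
      (HasCompactSupport.intro hvc fun x hx => by simp [hlc x hx])
  have hi2 : Integrable (fun x => conjPotential α κ x * v x * X x) :=
    (hEv.mul hXc).integrable_of_hasCompactSupport
      (HasCompactSupport.intro hvc fun x hx => by simp [image_eq_zero_of_notMem_tsupport hx])
  have hi3 : Integrable (fun x => v x ^ 2) :=
    (hv2.continuous.pow 2).integrable_of_hasCompactSupport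
      (HasCompactSupport.intro hvc fun x hx => by simp [image_eq_zero_of_notMem_tsupport hx])
  have hi4 : Integrable (fun x => ‖x‖ ^ 2 * v x ^ 2) :=
    Continuous.integrable_of_hasCompactSupport (by have := hv2.continuous; fun_prop)
      (HasCompactSupport.intro hvc fun x hx => by simp [image_eq_zero_of_notMem_tsupport hx])
  have hgl : Continuous (fun x => carlemanWeight α κ x * lap u x) :=
    continuous_iff_continuousAt.2 fun x => by
      by_cases hx : x = 0
      · refine (continuousAt_const (y := (0 : ℝ))).congr ?_
        filter_upwards [Metric.ball_mem_nhds x hη] with y hy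
        rw [hz (hu0 y (by simpa [hx] using hy)), mul_zero]
      · exact (contDiffAt_carlemanWeight (n := 0) α κ hx).continuousAt.mul
          hu.continuous_lap.continuousAt
  have hi5 : Integrable (fun x => ‖x‖ ^ 2 * (carlemanWeight α κ x * lap u x) ^ 2) :=
    Continuous.integrable_of_hasCompactSupport (by fun_prop)
      (HasCompactSupport.intro hc fun x hx => by
        simp [hz (notMem_tsupport_iff_eventuallyEq.1 hx)])
  have hpt : ∀ x, 2 * α * (lap v x * X x + conjPotential α κ x * v x * X x) ≤
      ‖x‖ ^ 2 * (carlemanWeight α κ x * lap u x) ^ 2 := by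
    intro x
    by_cases hx1 : 1 < 2 * κ * ‖x‖ ^ 2
    · have e1 := hu1 x hx1
      have e2 : v x = 0 := e1.self_of_nhds
      rw [hz e1, e2]
      simp only [zero_mul, mul_zero, add_zero]
      positivity
    by_cases hx0 : x = 0
    · have hh : ‖x‖ < η := by simpa [hx0] using hη
      have e1 : v =ᶠ[𝓝 x] fun _ => 0 := by
        filter_upwards [hu0 x hh] with y hy
        rw [hvx, hy, mul_zero]
      have e2 : v x = 0 := e1.self_of_nhds
      rw [hz e1, e2]
      simp only [zero_mul, mul_zero, add_zero]
      positivity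
    rw [carlemanWeight_mul_lap hu α κ hx0 hv]
    push Not at hx1
    have hr : 0 < ‖x‖ ^ 2 := by positivity
    change _ ≤ ‖x‖ ^ 2 * (lap v x + conjPotential α κ x * v x + α * ((‖x‖ ^ 2)⁻¹ - κ) * X x) ^ 2
    rw [← add_mul]
    generalize lap v x + conjPotential α κ x * v x = A
    generalize X x = B
    generalize ‖x‖ ^ 2 = r at *
    have hid : r * (A + α * (r⁻¹ - κ) * B) ^ 2 =
        (r * A - α * (1 - κ * r) * B) ^ 2 / r + 4 * α * (1 - κ * r) * (A * B) := by
      field_simp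
      ring
    rcases le_total 0 (A * B) with hAB | hAB
    · have h2 : 0 ≤ (1 - 2 * κ * r) * (2 * α * (A * B)) :=
        mul_nonneg (by linarith) (by positivity)
      have h3 : 0 ≤ (r * A - α * (1 - κ * r) * B) ^ 2 / r := by positivity
      rw [hid]
      linarith
    · have h2 : 0 ≤ r * (A + α * (r⁻¹ - κ) * B) ^ 2 := by positivity
      have h3 : α * (A * B) ≤ 0 := mul_nonpos_of_nonneg_of_nonpos hα.le hAB
      linarith
  have hle := integral_mono ((hi1.add hi2).const_mul (2 * α)) hi5 hpt
  rw [integral_const_mul, integral_add' hi1 hi2, integral_lap_mul_dilation_eq_zero hv2 hvc,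
    integral_conjPotential_mul_dilation hv2 hvc hη hv0, zero_add] at hle
  refine le_trans ?_ hle
  have hsq : ∀ x, carlemanWeight α κ x ^ 2 * u x ^ 2 = v x ^ 2 := fun x => by rw [hvx, mul_pow]
  simp_rw [hsq]
  have hlow : ∫ x, 2 * κ * α ^ 2 * v x ^ 2 ≤
      ∫ x, (4 * κ * α ^ 2 * (1 - κ * ‖x‖ ^ 2) + 4 * α * κ) * v x ^ 2 := by
    refine integral_mono (hi3.const_mul _) ?_ fun x => ?_
    · have := ((hi3.const_mul (4 * κ * α ^ 2 + 4 * α * κ)).sub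
        (hi4.const_mul (4 * κ * α ^ 2 * κ)))
      refine this.congr (Eventually.of_forall fun x => ?_)
      simp only [Pi.sub_apply]
      ring
    · by_cases hx1 : 1 < 2 * κ * ‖x‖ ^ 2
      · simp [(hu1 x hx1).self_of_nhds]
      · push Not at hx1
        refine mul_le_mul_of_nonneg_right ?_ (sq_nonneg _)
        have : 0 ≤ 2 * κ * α ^ 2 * (1 - 2 * κ * ‖x‖ ^ 2) := by
          have := sub_nonneg.2 hx1
          positivity
        have : 0 < α * κ := by positivity
        nlinarith
  rw [integral_const_mul] at hlow
  nlinarith [mul_le_mul_of_nonneg_left hlow hα.le]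

end Carleman

/-! ### Cutoff functions and the Caccioppoli inequality -/

section Cutoff

variable {d : ℕ}

lemma pd_comp_smul (c : ℝ) (f : EuclideanSpace ℝ (Fin d) → ℝ) (i : Fin d)
    (x : EuclideanSpace ℝ (Fin d)) : pd i (fun y => f (c • y)) x = c * pd i f (c • x) := by
  simp only [pd]
  rw [fderiv_comp_smul]
  simp

lemma lap_comp_smul (c : ℝ) {f : EuclideanSpace ℝ (Fin d) → ℝ} (hf : ContDiff ℝ 2 f)
    (x : EuclideanSpace ℝ (Fin d)) : lap (fun y => f (c • y)) x = c ^ 2 * lap f (c • x) := by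
  simp only [lap_eq_sum_pd, Finset.mul_sum]
  refine Finset.sum_congr rfl fun i _ => ?_
  have hd : DifferentiableAt ℝ (fun y => pd i f (c • y)) x :=
    DifferentiableAt.comp x (g := pd i f) (f := fun y => c • y)
      hf.contDiffAt.differentiableAt_pd (by fun_prop)
  rw [show pd i (fun y => f (c • y)) = fun y => c * pd i f (c • y) from
    funext fun y => pd_comp_smul c f i y, pd_const_mul c hd, pd_comp_smul]
  ring

/-- A smooth cutoff between the balls of radius `a` and `2a`, with bounds `B/a` and `B/a²` on its
gradient and Laplacian. -/
structure IsCutoff (B a : ℝ) (η : EuclideanSpace ℝ (Fin d) → ℝ) : Prop where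
  contDiff : ContDiff ℝ 2 η
  nonneg : ∀ x, 0 ≤ η x
  le_one : ∀ x, η x ≤ 1
  eq_one : ∀ x, ‖x‖ ≤ a → η x = 1
  eq_zero : ∀ x, 2 * a ≤ ‖x‖ → η x = 0
  pd_eq_zero : ∀ x, ‖x‖ < a ∨ 2 * a ≤ ‖x‖ → ∀ i, pd i η x = 0
  lap_eq_zero : ∀ x, ‖x‖ < a ∨ 2 * a ≤ ‖x‖ → lap η x = 0
  sum_pd_sq_le : ∀ x, ∑ i, pd i η x ^ 2 ≤ (B / a) ^ 2
  abs_lap_le : ∀ x, |lap η x| ≤ B / a ^ 2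

lemma exists_isCutoff (d : ℕ) : ∃ B : ℝ, 1 ≤ B ∧ ∀ a : ℝ, 0 < a →
    ∃ η : EuclideanSpace ℝ (Fin d) → ℝ, IsCutoff B a η := by
  let β : ContDiffBump (0 : EuclideanSpace ℝ (Fin d)) := ⟨1, 3 / 2, by norm_num, by norm_num⟩
  have hβ : ContDiff ℝ 2 β := β.contDiff
  have hc : HasCompactSupport β := β.hasCompactSupport
  have hz : ∀ x ∉ tsupport β, β =ᶠ[𝓝 x] (fun _ => (0 : ℝ)) :=
    fun x hx => notMem_tsupport_iff_eventuallyEq.1 hx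
  have hlz : ∀ (c : ℝ) x, β =ᶠ[𝓝 x] (fun _ => c) → lap β x = 0 := fun c x hx => by
    rw [hx.lap_eq]
    simp [lap_eq_sum_pd, show ∀ i : Fin d, pd i (fun _ : EuclideanSpace ℝ (Fin d) => c) =
      fun _ => 0 from fun i => funext fun _ => pd_const _, pd_const]
  have hpz : ∀ (c : ℝ) x, β =ᶠ[𝓝 x] (fun _ => c) → ∀ i, pd i β x = 0 := fun c x hx i => by
    rw [hx.pd.self_of_nhds, pd_const]
  obtain ⟨B1, hB1⟩ := (Continuous.bounded_above_of_compact_support (f := lap β) hβ.continuous_lap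
    (HasCompactSupport.intro hc fun x hx => hlz 0 x (hz x hx)))
  obtain ⟨B2, hB2⟩ := (Continuous.bounded_above_of_compact_support
    (f := fun x => ∑ i, pd i β x ^ 2)
    (continuous_finsetSum _ fun i _ => ((hβ.of_le (by norm_num)).continuous_pd).pow 2)
    (HasCompactSupport.intro hc fun x hx => by simp [hpz 0 x (hz x hx)]))
  refine ⟨max 1 (max B1 B2), le_max_left _ _, fun a ha => ⟨fun x => β (a⁻¹ • x), ?_⟩⟩
  have hn : ∀ x : EuclideanSpace ℝ (Fin d), ‖a⁻¹ • x‖ = ‖x‖ / a := fun x => by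
    rw [norm_smul, norm_inv, Real.norm_of_nonneg ha.le]; ring
  have hin : ∀ x : EuclideanSpace ℝ (Fin d), ‖x‖ < 1 → β =ᶠ[𝓝 x] (fun _ => (1 : ℝ)) :=
    fun x hx => β.eventuallyEq_one_of_mem_ball (by simpa [β] using hx)
  have hout : ∀ x : EuclideanSpace ℝ (Fin d), 2 ≤ ‖x‖ → β =ᶠ[𝓝 x] (fun _ => (0 : ℝ)) :=
    fun x hx => hz x (by rw [β.tsupport_eq]; simp [β]; linarith)
  have hcase : ∀ x : EuclideanSpace ℝ (Fin d), ‖x‖ < a ∨ 2 * a ≤ ‖x‖ →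
      ∃ c : ℝ, β =ᶠ[𝓝 (a⁻¹ • x)] fun _ => c := by
    rintro x (h | h)
    · exact ⟨1, hin _ (by rw [hn, div_lt_one ha]; exact h)⟩
    · exact ⟨0, hout _ (by rw [hn, le_div_iff₀ ha]; exact h)⟩
  refine ⟨hβ.comp (by fun_prop), fun x => β.nonneg, fun x => β.le_one, fun x hx => ?_,
    fun x hx => ?_, fun x hx i => ?_, fun x hx => ?_, fun x => ?_, fun x => ?_⟩
  · exact β.one_of_mem_closedBall (by simpa [β, hn, div_le_one ha] using hx)
  · exact (hout _ (by rw [hn, le_div_iff₀ ha]; exact hx)).self_of_nhds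
  · obtain ⟨c, hc⟩ := hcase x hx
    rw [pd_comp_smul, hpz c _ hc, mul_zero]
  · obtain ⟨c, hc⟩ := hcase x hx
    rw [lap_comp_smul _ hβ, hlz c _ hc, mul_zero]
  · simp_rw [pd_comp_smul, mul_pow]
    rw [← Finset.mul_sum, div_eq_inv_mul, mul_pow]
    refine mul_le_mul_of_nonneg_left ?_ (by positivity)
    have h1 := (le_abs_self _).trans (hB2 (a⁻¹ • x))
    have h2 : B2 ≤ max 1 (max B1 B2) := (le_max_right _ _).trans (le_max_right _ _)
    have h3 : 1 ≤ max 1 (max B1 B2) := le_max_left _ _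
    nlinarith
  · rw [lap_comp_smul _ hβ, abs_mul, abs_of_nonneg (by positivity), div_eq_inv_mul, inv_pow]
    refine mul_le_mul_of_nonneg_left ?_ (by positivity)
    exact (hB1 _).trans ((le_max_left _ _).trans (le_max_right _ _))

lemma Continuous.integrableOn_ball {f : EuclideanSpace ℝ (Fin d) → ℝ} (hf : Continuous f)
    (x : EuclideanSpace ℝ (Fin d)) (r : ℝ) : IntegrableOn f (Metric.ball x r) :=
  (hf.continuousOn.integrableOn_compact (isCompact_closedBall x r)).mono_set
    Metric.ball_subset_closedBall

lemma caccioppoli {B a K : ℝ} (ha : 0 < a) {η u G : EuclideanSpace ℝ (Fin d) → ℝ}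
    (hη : IsCutoff B a η) (hu : ContDiff ℝ 2 u) (hG : Continuous G) (hK : 0 ≤ K)
    (hlap : ∀ x, |lap u x| ≤ K * |u x| + G x) :
    2 * ∫ x in Metric.ball 0 a, ∑ i, pd i u x ^ 2 ≤
      (B / a ^ 2 + 2 * K + 1) * (∫ x in Metric.ball 0 (2 * a), u x ^ 2) +
        ∫ x in Metric.ball 0 (2 * a), G x ^ 2 := by
  have hu1 : Continuous fun x => ∑ i, pd i u x ^ 2 :=
    continuous_finsetSum _ fun i _ => ((hu.of_le (by norm_num)).continuous_pd).pow 2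
  have hu2 : ContDiff ℝ 2 fun x => u x * u x := hu.mul hu
  have hA : IsCompact (Metric.closedBall (0 : EuclideanSpace ℝ (Fin d)) (2 * a)) :=
    isCompact_closedBall _ _
  have h0 : ∀ x ∉ Metric.closedBall (0 : EuclideanSpace ℝ (Fin d)) (2 * a), η x = 0 :=
    fun x hx => hη.eq_zero x (by simp at hx; exact hx.le)
  have hl0 : ∀ x ∉ Metric.closedBall (0 : EuclideanSpace ℝ (Fin d)) (2 * a), lap η x = 0 :=
    fun x hx => hη.lap_eq_zero x (by simp at hx; exact Or.inr hx.le)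
  have green := integral_mul_lap_comm isOpen_univ hA (subset_univ _) hu2.contDiffOn
    hη.contDiff.contDiffOn h0
  rw [setIntegral_univ, setIntegral_univ] at green
  have i1 : Integrable fun x => u x * u x * lap η x :=
    (hu2.continuous.mul hη.contDiff.continuous_lap).integrable_of_hasCompactSupport
      (HasCompactSupport.intro hA fun x hx => by simp [hl0 x hx])
  have i2 : Integrable fun x => lap (fun x => u x * u x) x * η x :=
    (hu2.continuous_lap.mul hη.contDiff.continuous).integrable_of_hasCompactSupport
      (HasCompactSupport.intro hA fun x hx => by simp [h0 x hx])
  have i3 := (hu.continuous.pow 2).integrableOn_ball 0 (2 * a)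
  have i4 := (hG.pow 2).integrableOn_ball 0 (2 * a)
  have i5 := hu1.integrableOn_ball 0 a
  have hmb : ∀ r : ℝ, MeasurableSet (Metric.ball (0 : EuclideanSpace ℝ (Fin d)) r) :=
    fun r => measurableSet_ball
  have hpt : ∀ x, (Metric.ball 0 a).indicator (fun x => 2 * ∑ i, pd i u x ^ 2) x ≤
      (lap (fun x => u x * u x) x * η x - u x * u x * lap η x) +
      (Metric.ball 0 (2 * a)).indicator
        (fun x => (B / a ^ 2 + 2 * K + 1) * u x ^ 2 + G x ^ 2) x := by
    intro x
    have hP : 0 ≤ ∑ i, pd i u x ^ 2 := Finset.sum_nonneg fun _ _ => sq_nonneg _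
    have hpd : ∑ i, pd i u x * pd i u x = ∑ i, pd i u x ^ 2 :=
      Finset.sum_congr rfl fun _ _ => (sq _).symm
    rw [lap_mul hu.contDiffAt hu.contDiffAt, hpd]
    obtain ⟨P, hPx⟩ : ∃ P, ∑ i, pd i u x ^ 2 = P := ⟨_, rfl⟩
    rw [hPx] at hP ⊢
    have hl := hlap x
    by_cases hx2 : 2 * a ≤ ‖x‖
    · rw [indicator_of_notMem (by simp; linarith), indicator_of_notMem (by simpa using hx2),
        hη.eq_zero x hx2, hη.lap_eq_zero x (Or.inr hx2)]
      simp
    · rw [indicator_of_mem (s := Metric.ball 0 (2 * a)) (by simpa using hx2)]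
      have h1 := hη.nonneg x
      have h2 := hη.le_one x
      have h3 := hη.abs_lap_le x
      have hind : (Metric.ball 0 a).indicator (fun x => 2 * ∑ i, pd i u x ^ 2) x ≤
          2 * P * η x := by
        by_cases hx1 : ‖x‖ < a
        · rw [indicator_of_mem (by simpa using hx1), hη.eq_one x hx1.le]
          rw [hPx, mul_one]
        · rw [indicator_of_notMem (by simpa using hx1)]
          positivity
      have h4 : u x ^ 2 * lap η x ≤ u x ^ 2 * (B / a ^ 2) :=
        mul_le_mul_of_nonneg_left ((le_abs_self _).trans h3) (sq_nonneg _)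
      have h5 : -(2 * (u x * lap u x)) * η x ≤ (2 * K + 1) * u x ^ 2 + G x ^ 2 := by
        have h6 : |u x * lap u x| ≤ K * u x ^ 2 + |u x| * G x := by
          rw [abs_mul, ← sq_abs (u x)]
          nlinarith [mul_le_mul_of_nonneg_left hl (abs_nonneg (u x))]
        have h7 : 2 * (|u x| * G x) ≤ u x ^ 2 + G x ^ 2 := by
          rw [← sq_abs (u x)]; nlinarith [sq_nonneg (|u x| - G x)]
        have h8 : -(2 * (u x * lap u x)) ≤ (2 * K + 1) * u x ^ 2 + G x ^ 2 := by
          have := neg_abs_le (u x * lap u x)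
          nlinarith
        have h9 : 0 ≤ (2 * K + 1) * u x ^ 2 + G x ^ 2 := by positivity
        nlinarith
      nlinarith
  have := integral_mono (f := (Metric.ball 0 a).indicator (fun x => 2 * ∑ i, pd i u x ^ 2))
    ((integrable_indicator_iff (hmb _)).2 (i5.const_mul 2)) ((i2.sub i1).add
      ((integrable_indicator_iff (hmb _)).2 ((i3.const_mul _).add i4))) hpt
  rw [integral_indicator (hmb _), integral_const_mul, integral_add' (i2.sub i1)
    ((integrable_indicator_iff (hmb _)).2 ((i3.const_mul _).add i4)),
    integral_sub' i2 i1, green, sub_self, zero_add, integral_indicator (hmb _),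
    integral_add' (i3.const_mul _) i4, integral_const_mul] at this
  exact this

end Cutoff

/-! ### The three-region inequality -/

section ThreeRegion

variable {d : ℕ}

lemma carlemanWeight_sq (α κ : ℝ) {x : EuclideanSpace ℝ (Fin d)} :
    carlemanWeight α κ x ^ 2 = Real.exp (α * (κ * ‖x‖ ^ 2 - 2 * Real.log ‖x‖)) := by
  rw [carlemanWeight, ← Real.exp_nat_mul, Real.log_pow]
  congr 1
  push_cast
  ring

lemma carlemanWeight_sq_le {α κ ρ : ℝ} (hα : 0 ≤ α) (hρ : 0 < ρ)
    {x : EuclideanSpace ℝ (Fin d)} (hx : ρ ≤ ‖x‖) (hκ : 2 * κ * ‖x‖ ^ 2 ≤ 1) :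
    carlemanWeight α κ x ^ 2 ≤ Real.exp (α * (1 / 2 - 2 * Real.log ρ)) := by
  rw [carlemanWeight_sq, Real.exp_le_exp]
  have := Real.log_le_log hρ hx
  exact mul_le_mul_of_nonneg_left (by linarith) hα

lemma le_carlemanWeight_sq {α κ ρ : ℝ} (hα : 0 ≤ α) (hκ : 0 ≤ κ)
    {x : EuclideanSpace ℝ (Fin d)} (hx0 : 0 < ‖x‖) (hx : ‖x‖ ≤ ρ) :
    Real.exp (-(2 * α * Real.log ρ)) ≤ carlemanWeight α κ x ^ 2 := by
  rw [carlemanWeight_sq, Real.exp_le_exp]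
  have h1 := Real.log_le_log hx0 hx
  have h2 : 0 ≤ κ * ‖x‖ ^ 2 := by positivity
  nlinarith

lemma sq_add_add_le {l S Λ u K G χ D P : ℝ} (hl : |l| ≤ K * |u| + G)
    (hχ : 0 ≤ χ) (hS : S ^ 2 ≤ D * P) :
    (χ * l + 2 * S + u * Λ) ^ 2 ≤
      4 * (K ^ 2 * (χ * u) ^ 2 + χ ^ 2 * G ^ 2 + 4 * (D * P) + Λ ^ 2 * u ^ 2) := by
  have h1 : |χ * l| ≤ K * (χ * |u|) + χ * G := by
    rw [abs_mul, abs_of_nonneg hχ]; nlinarith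
  have h2 : (χ * l + 2 * S + u * Λ) ^ 2 ≤ (K * (χ * |u|) + χ * G + |2 * S| + |u * Λ|) ^ 2 := by
    refine sq_le_sq' ?_ ?_
    · have := neg_abs_le (χ * l); have := neg_abs_le (2 * S); have := neg_abs_le (u * Λ)
      linarith
    · have := le_abs_self (χ * l); have := le_abs_self (2 * S); have := le_abs_self (u * Λ)
      linarith
  have h3 : ∀ a b c e : ℝ, (a + b + c + e) ^ 2 ≤ 4 * (a ^ 2 + b ^ 2 + c ^ 2 + e ^ 2) :=
    fun a b c e => by
      nlinarith [sq_nonneg (a - b), sq_nonneg (a - c), sq_nonneg (a - e), sq_nonneg (b - c),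
        sq_nonneg (b - e), sq_nonneg (c - e)]
  have h4 := h3 (K * (χ * |u|)) (χ * G) |2 * S| |u * Λ|
  rw [sq_abs, sq_abs, mul_pow K, mul_pow χ |u|, sq_abs u, mul_pow 2 S] at h4
  nlinarith

set_option maxHeartbeats 1000000 in
/-- Pointwise form of the Carleman commutator bound: the cutoffs only contribute on the
transition regions. -/
lemma weighted_lap_cutoff_le {B Q δ α K : ℝ} (hB : 1 ≤ B) (hQ : 1 ≤ Q) (hδ : 0 < δ)
    (hδQ : δ ≤ 1) (hα : 0 ≤ α) {η₁ η₂ u G : EuclideanSpace ℝ (Fin d) → ℝ}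
    (h₁ : IsCutoff B (2 * Q) η₁) (h₂ : IsCutoff B (δ / 4) η₂) (hu : ContDiff ℝ 2 u)
    (hlap : ∀ x, |lap u x| ≤ K * |u x| + G x) (x : EuclideanSpace ℝ (Fin d)) :
    ‖x‖ ^ 2 * (carlemanWeight α (1 / (32 * Q ^ 2)) x *
        lap (fun y => (η₁ y - η₂ y) * u y) x) ^ 2 ≤
      64 * Q ^ 2 * K ^ 2 *
        (carlemanWeight α (1 / (32 * Q ^ 2)) x ^ 2 * ((η₁ x - η₂ x) * u x) ^ 2) +
      Real.exp (α * (1 / 2 - 2 * Real.log (δ / 4))) * (64 * Q ^ 2) *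
        (Metric.ball 0 (4 * Q)).indicator (fun x => G x ^ 2) x +
      Real.exp (α * (1 / 2 - 2 * Real.log (δ / 4))) * (16384 * B ^ 2 * Q ^ 2 / δ ^ 4) *
        (Metric.ball 0 (δ / 2)).indicator
          (fun x => δ ^ 2 * (∑ i, pd i u x ^ 2) + u x ^ 2) x +
      Real.exp (α * (1 / 2 - 2 * Real.log (2 * Q))) * (256 * B ^ 2 * Q ^ 2) *
        (Metric.ball 0 (4 * Q)).indicator (fun x => (∑ i, pd i u x ^ 2) + u x ^ 2) x := by
  have hP : 0 ≤ ∑ i, pd i u x ^ 2 := Finset.sum_nonneg fun _ _ => sq_nonneg _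
  have hi1 : 0 ≤ (Metric.ball 0 (4 * Q)).indicator (fun x => G x ^ 2) x :=
    indicator_nonneg (fun _ _ => sq_nonneg _) _
  have hi2 : 0 ≤ (Metric.ball 0 (δ / 2)).indicator
      (fun x => δ ^ 2 * (∑ i, pd i u x ^ 2) + u x ^ 2) x :=
    indicator_nonneg (fun _ _ => add_nonneg (mul_nonneg (sq_nonneg _)
      (Finset.sum_nonneg fun _ _ => sq_nonneg _)) (sq_nonneg _)) _
  have hi3 : 0 ≤ (Metric.ball 0 (4 * Q)).indicator
      (fun x => (∑ i, pd i u x ^ 2) + u x ^ 2) x :=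
    indicator_nonneg (fun _ _ => add_nonneg (Finset.sum_nonneg fun _ _ => sq_nonneg _)
      (sq_nonneg _)) _
  have hE : lap (fun y => (η₁ y - η₂ y) * u y) x = (η₁ x - η₂ x) * lap u x +
      2 * ∑ i, (pd i η₁ x - pd i η₂ x) * pd i u x + u x * (lap η₁ x - lap η₂ x) := by
    rw [lap_mul (h₁.contDiff.sub h₂.contDiff).contDiffAt hu.contDiffAt,
      lap_sub h₁.contDiff.contDiffAt h₂.contDiff.contDiffAt]
    simp_rw [pd_sub h₁.contDiff.contDiffAt.differentiableAt_of_two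
      h₂.contDiff.contDiffAt.differentiableAt_of_two]
  have hS : (∑ i, (pd i η₁ x - pd i η₂ x) * pd i u x) ^ 2 ≤
      (∑ i, (pd i η₁ x - pd i η₂ x) ^ 2) * ∑ i, pd i u x ^ 2 :=
    Finset.sum_mul_sq_le_sq_mul_sq _ _ _
  rw [hE]
  set M₁ := Real.exp (α * (1 / 2 - 2 * Real.log (δ / 4)))
  set M₂ := Real.exp (α * (1 / 2 - 2 * Real.log (2 * Q)))
  have hM₁ : 0 < M₁ := Real.exp_pos _
  have hM₂ : 0 < M₂ := Real.exp_pos _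
  by_cases hr : ‖x‖ < δ / 4
  · have e1 := h₁.eq_one x (by linarith)
    have e2 := h₂.eq_one x hr.le
    simp only [e1, e2, h₁.pd_eq_zero x (Or.inl (by linarith)), h₂.pd_eq_zero x (Or.inl hr),
      h₁.lap_eq_zero x (Or.inl (by linarith)), h₂.lap_eq_zero x (Or.inl hr)]
    simp only [sub_self, zero_mul, Finset.sum_const_zero, mul_zero, add_zero, ne_eq,
      OfNat.ofNat_ne_zero, not_false_eq_true, zero_pow]
    positivity
  by_cases hr' : 4 * Q ≤ ‖x‖
  · have e1 := h₁.eq_zero x (by linarith)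
    have e2 := h₂.eq_zero x (by linarith)
    simp only [e1, e2, h₁.pd_eq_zero x (Or.inr (by linarith)),
      h₂.pd_eq_zero x (Or.inr (by linarith)),
      h₁.lap_eq_zero x (Or.inr (by linarith)), h₂.lap_eq_zero x (Or.inr (by linarith))]
    simp only [sub_self, zero_mul, Finset.sum_const_zero, mul_zero, add_zero, ne_eq,
      OfNat.ofNat_ne_zero, not_false_eq_true, zero_pow]
    positivity
  push Not at hr hr'
  have hx0 : 0 < ‖x‖ := by linarith
  have hr2 : ‖x‖ ^ 2 ≤ 16 * Q ^ 2 := by nlinarith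
  have hκ : 2 * (1 / (32 * Q ^ 2)) * ‖x‖ ^ 2 ≤ 1 := by
    rw [mul_one_div, div_mul_eq_mul_div, div_le_one (by positivity)]
    linarith
  have hw1 := carlemanWeight_sq_le hα (by positivity : 0 < δ / 4) hr hκ
  change _ ≤ M₁ at hw1
  set w := carlemanWeight α (1 / (32 * Q ^ 2)) x
  have hw0 : 0 < w := carlemanWeight_pos _ _ _
  have hχ0 : 0 ≤ η₁ x - η₂ x := by
    by_cases h : ‖x‖ ≤ 2 * Q
    · rw [h₁.eq_one x h]; linarith [h₂.le_one x]
    · rw [h₂.eq_zero x (by linarith)]; linarith [h₁.nonneg x]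
  have hχ1 : η₁ x - η₂ x ≤ 1 := by linarith [h₁.le_one x, h₂.nonneg x]
  have hmain := sq_add_add_le (hlap x) hχ0 hS (Λ := lap η₁ x - lap η₂ x)
  set χ := η₁ x - η₂ x
  set Dg := ∑ i, (pd i η₁ x - pd i η₂ x) ^ 2
  set L := lap η₁ x - lap η₂ x
  set P := ∑ i, pd i u x ^ 2
  have hG : χ ^ 2 * G x ^ 2 ≤ (Metric.ball 0 (4 * Q)).indicator (fun x => G x ^ 2) x := by
    rw [indicator_of_mem (by simpa using hr')]
    have : χ ^ 2 ≤ 1 := by nlinarith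
    nlinarith [sq_nonneg (G x)]
  have hrest : w ^ 2 * (4 * (Dg * P) + L ^ 2 * u x ^ 2) ≤
      M₁ * (256 * B ^ 2 / δ ^ 4) * (Metric.ball 0 (δ / 2)).indicator
          (fun x => δ ^ 2 * (∑ i, pd i u x ^ 2) + u x ^ 2) x +
      M₂ * (4 * B ^ 2) * (Metric.ball 0 (4 * Q)).indicator
          (fun x => (∑ i, pd i u x ^ 2) + u x ^ 2) x := by
    by_cases hc : ‖x‖ < δ / 2
    · have hD : Dg ≤ (B / (δ / 4)) ^ 2 := by
        refine le_trans (le_of_eq ?_) (h₂.sum_pd_sq_le x)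
        simp only [Dg, h₁.pd_eq_zero x (Or.inl (by linarith)), zero_sub, neg_sq]
      have hL : L ^ 2 ≤ (B / (δ / 4) ^ 2) ^ 2 := by
        simp only [L, h₁.lap_eq_zero x (Or.inl (by linarith)), zero_sub, neg_sq]
        exact sq_le_sq' (neg_le_of_abs_le (h₂.abs_lap_le x))
            ((le_abs_self _).trans (h₂.abs_lap_le x))
      have hb : 4 * (Dg * P) + L ^ 2 * u x ^ 2 ≤ 256 * B ^ 2 / δ ^ 4 * (δ ^ 2 * P + u x ^ 2) := by
        have e1 : (B / (δ / 4)) ^ 2 = 16 * B ^ 2 / δ ^ 4 * δ ^ 2 := by field_simp; ring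
        have e2 : (B / (δ / 4) ^ 2) ^ 2 = 256 * B ^ 2 / δ ^ 4 := by field_simp; ring
        rw [e1] at hD
        rw [e2] at hL
        have h3 : 0 ≤ B ^ 2 / δ ^ 4 * δ ^ 2 * P := by positivity
        have := mul_le_mul_of_nonneg_right hD hP
        have := mul_le_mul_of_nonneg_right hL (sq_nonneg (u x))
        have e3 : 16 * B ^ 2 / δ ^ 4 * δ ^ 2 * P = 16 * (B ^ 2 / δ ^ 4 * δ ^ 2 * P) := by ring
        have e4 : 256 * B ^ 2 / δ ^ 4 * (δ ^ 2 * P + u x ^ 2) =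
          256 * (B ^ 2 / δ ^ 4 * δ ^ 2 * P) + 256 * B ^ 2 / δ ^ 4 * u x ^ 2 := by ring
        rw [e4]
        linarith
      rw [indicator_of_mem (s := Metric.ball 0 (δ / 2)) (by simpa using hc)]
      change _ ≤ M₁ * (256 * B ^ 2 / δ ^ 4) * (δ ^ 2 * P + u x ^ 2) + _
      have h5 : 0 ≤ 4 * (Dg * P) + L ^ 2 * u x ^ 2 := by
        have : 0 ≤ Dg := Finset.sum_nonneg fun _ _ => sq_nonneg _
        positivity
      have h6 := mul_le_mul hw1 hb h5 hM₁.le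
      have h7 : 0 ≤ M₂ * (4 * B ^ 2) * (Metric.ball 0 (4 * Q)).indicator
          (fun x => (∑ i, pd i u x ^ 2) + u x ^ 2) x := by positivity
      linarith
    push Not at hc
    have hsum2 : 0 ≤ M₁ * (256 * B ^ 2 / δ ^ 4) * (Metric.ball 0 (δ / 2)).indicator
          (fun x => δ ^ 2 * (∑ i, pd i u x ^ 2) + u x ^ 2) x := by positivity
    by_cases hc2 : ‖x‖ < 2 * Q
    · have e1 : Dg = 0 := by
        simp [Dg, h₁.pd_eq_zero x (Or.inl hc2), h₂.pd_eq_zero x (Or.inr (by linarith))]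
      have e2 : L = 0 := by
        simp [L, h₁.lap_eq_zero x (Or.inl hc2), h₂.lap_eq_zero x (Or.inr (by linarith))]
      rw [e1, e2]
      simp only [zero_mul, mul_zero, add_zero, ne_eq, OfNat.ofNat_ne_zero, not_false_eq_true,
        zero_pow]
      positivity
    push Not at hc2
    have hw2 := carlemanWeight_sq_le hα (by positivity : 0 < 2 * Q) hc2 hκ
    change w ^ 2 ≤ M₂ at hw2
    have hD : Dg ≤ (B / (2 * Q)) ^ 2 := by
      refine le_trans (le_of_eq ?_) (h₁.sum_pd_sq_le x)
      simp only [Dg, h₂.pd_eq_zero x (Or.inr (by linarith)), sub_zero]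
    have hL : L ^ 2 ≤ (B / (2 * Q) ^ 2) ^ 2 := by
      simp only [L, h₂.lap_eq_zero x (Or.inr (by linarith)), sub_zero]
      exact sq_le_sq' (neg_le_of_abs_le (h₁.abs_lap_le x)) ((le_abs_self _).trans (h₁.abs_lap_le x))
    have e1 : (B / (2 * Q)) ^ 2 ≤ B ^ 2 :=
      pow_le_pow_left₀ (by positivity) (div_le_self (by positivity) (by linarith)) _
    have e2 : (B / (2 * Q) ^ 2) ^ 2 ≤ B ^ 2 :=
      pow_le_pow_left₀ (by positivity) (div_le_self (by positivity) (by nlinarith)) _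
    have hb : 4 * (Dg * P) + L ^ 2 * u x ^ 2 ≤ 4 * B ^ 2 * (P + u x ^ 2) := by
      have := mul_le_mul_of_nonneg_right (hD.trans e1) hP
      have := mul_le_mul_of_nonneg_right (hL.trans e2) (sq_nonneg (u x))
      nlinarith [mul_nonneg (sq_nonneg B) (sq_nonneg (u x))]
    rw [indicator_of_mem (s := Metric.ball 0 (4 * Q)) (by simpa using hr')]
    change _ ≤ _ + M₂ * (4 * B ^ 2) * (P + u x ^ 2)
    have h5 : 0 ≤ 4 * (Dg * P) + L ^ 2 * u x ^ 2 := by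
      have : 0 ≤ Dg := Finset.sum_nonneg fun _ _ => sq_nonneg _
      positivity
    have h6 := mul_le_mul hw2 hb h5 hM₂.le
    linarith
  have hGw : w ^ 2 * (χ ^ 2 * G x ^ 2) ≤
      M₁ * (Metric.ball 0 (4 * Q)).indicator (fun x => G x ^ 2) x :=
    mul_le_mul hw1 hG (by positivity) hM₁.le
  have hA : (w * (χ * lap u x + 2 * ∑ i, (pd i η₁ x - pd i η₂ x) * pd i u x + u x * L)) ^ 2 ≤
      4 * (K ^ 2 * (w ^ 2 * (χ * u x) ^ 2) + w ^ 2 * (χ ^ 2 * G x ^ 2) +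
        w ^ 2 * (4 * (Dg * P) + L ^ 2 * u x ^ 2)) := by
    rw [mul_pow]
    have := mul_le_mul_of_nonneg_left hmain (sq_nonneg w)
    linarith
  have hfin := mul_le_mul hr2 (hA.trans (mul_le_mul_of_nonneg_left
    (add_le_add (add_le_add le_rfl hGw) hrest) (by norm_num))) (sq_nonneg _)
    (by positivity : (0 : ℝ) ≤ 16 * Q ^ 2)
  refine hfin.trans (le_of_eq ?_)
  ring

set_option maxHeartbeats 600000 in
/-- The absorption step turning the Carleman and Caccioppoli inequalities into the three-region
inequality. -/
lemma three_region_absorb {B Q δ α K I J M₁ M₂ g P₁ P₂ U₁ U₂ Ud Gd UQ GQ : ℝ} (hB : 1 ≤ B)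
    (hQ : 1 ≤ Q) (hδ : 0 < δ) (hδ1 : δ ≤ 1) (hα : 1 ≤ α) (hK : 0 ≤ K)
    (hαK : 1024 * K ^ 2 * Q ^ 4 ≤ α ^ 3) (hM₁ : 0 < M₁) (hM₂ : 0 < M₂) (hI : 0 ≤ I)
    (hUd : 0 ≤ Ud) (hUQ : 0 ≤ UQ) (hGQ : 0 ≤ GQ)
    (carl : 4 * (1 / (32 * Q ^ 2)) * α ^ 3 * I ≤ J)
    (hJ : J ≤ 64 * Q ^ 2 * K ^ 2 * I + M₁ * (64 * Q ^ 2) * g +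
      M₁ * (16384 * B ^ 2 * Q ^ 2 / δ ^ 4) * (δ ^ 2 * P₁ + U₁) +
      M₂ * (256 * B ^ 2 * Q ^ 2) * (P₂ + U₂))
    (h₁ : 2 * P₁ ≤ (B / (δ / 2) ^ 2 + 2 * K + 1) * Ud + Gd)
    (h₂ : 2 * P₂ ≤ (B / (4 * Q) ^ 2 + 2 * K + 1) * UQ + GQ)
    (hGd : Gd ≤ GQ) (hg : g ≤ GQ) (hU₁ : U₁ ≤ Ud) (hU₂ : U₂ ≤ UQ) :
    I ≤ 1312000 * B ^ 3 * Q ^ 4 * (M₁ / δ ^ 4 * (Ud + GQ) + M₂ * (UQ + GQ)) := by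
  have hQ0 : 0 < Q := by linarith
  have hα3 : 1 ≤ α ^ 3 := one_le_pow₀ hα
  have hQ4 : 1 ≤ Q ^ 4 := one_le_pow₀ hQ
  have hKα : K ≤ α ^ 3 := by
    by_contra h
    push Not at h
    have : K ^ 2 ≤ 1024 * K ^ 2 * Q ^ 4 := by nlinarith [sq_nonneg K]
    nlinarith
  have hδ2 : δ ^ 2 ≤ 1 := pow_le_one₀ hδ.le hδ1
  have hBα : B ≤ B * α ^ 3 := le_mul_of_one_le_right (by linarith) hα3
  have hαB : α ^ 3 ≤ B * α ^ 3 := le_mul_of_one_le_left (by linarith) hB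
  have hUd' : Ud ≤ B * α ^ 3 * Ud := le_mul_of_one_le_left hUd (by linarith)
  have hUQ' : UQ ≤ B * α ^ 3 * UQ := le_mul_of_one_le_left hUQ (by linarith)
  have hGQ' : GQ ≤ B * α ^ 3 * GQ := le_mul_of_one_le_left hGQ (by linarith)
  have hδ0 : 0 < δ ^ 2 := by positivity
  have e₁ : δ ^ 2 * P₁ + U₁ ≤ 5 * B * α ^ 3 * (Ud + GQ) := by
    have a1 : δ ^ 2 * (2 * P₁) ≤ (4 * B + δ ^ 2 * (2 * K + 1)) * Ud + δ ^ 2 * GQ := by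
      have := mul_le_mul_of_nonneg_left (h₁.trans (by linarith : _ ≤
        (B / (δ / 2) ^ 2 + 2 * K + 1) * Ud + GQ)) hδ0.le
      refine this.trans (le_of_eq ?_)
      field_simp
      ring
    have a2 : (4 * B + δ ^ 2 * (2 * K + 1)) * Ud ≤ (7 * (B * α ^ 3)) * Ud := by
      refine mul_le_mul_of_nonneg_right ?_ hUd
      have : δ ^ 2 * (2 * K + 1) ≤ 2 * K + 1 := mul_le_of_le_one_left (by linarith) hδ2
      linarith
    have a3 : δ ^ 2 * GQ ≤ GQ := mul_le_of_le_one_left hGQ hδ2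
    linarith
  have e₂ : P₂ + U₂ ≤ 4 * B * α ^ 3 * (UQ + GQ) := by
    have a1 : B / (4 * Q) ^ 2 ≤ B := div_le_self (by linarith) (by nlinarith)
    have a2 : (B / (4 * Q) ^ 2 + 2 * K + 1) * UQ ≤ (4 * (B * α ^ 3)) * UQ := by
      refine mul_le_mul_of_nonneg_right ?_ hUQ
      linarith
    linarith
  have habs : α ^ 3 * I ≤ 16 * Q ^ 2 * (M₁ * (64 * Q ^ 2) * g +
      M₁ * (16384 * B ^ 2 * Q ^ 2 / δ ^ 4) * (δ ^ 2 * P₁ + U₁) +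
      M₂ * (256 * B ^ 2 * Q ^ 2) * (P₂ + U₂)) := by
    have b1 : α ^ 3 * I ≤ 8 * Q ^ 2 * J := by
      have := mul_le_mul_of_nonneg_left carl (by positivity : 0 ≤ 8 * Q ^ 2)
      refine le_trans (le_of_eq ?_) this
      field_simp
      ring
    have b2 := mul_le_mul_of_nonneg_left hJ (by positivity : 0 ≤ 8 * Q ^ 2)
    have b3 : 1024 * K ^ 2 * Q ^ 4 * I ≤ α ^ 3 * I := mul_le_mul_of_nonneg_right hαK hI
    linarith
  have c1 : M₁ * (64 * Q ^ 2) * g ≤ α ^ 3 * (64 * B ^ 3 * Q ^ 2 * (M₁ / δ ^ 4 * (Ud + GQ))) := by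
    have d1 : M₁ ≤ M₁ / δ ^ 4 := by
      rw [le_div_iff₀ (by positivity)]
      exact mul_le_of_le_one_right hM₁.le (pow_le_one₀ hδ.le hδ1)
    have d2 : M₁ * g ≤ M₁ / δ ^ 4 * (Ud + GQ) :=
      (mul_le_mul_of_nonneg_left (by linarith : g ≤ Ud + GQ) hM₁.le).trans
        (mul_le_mul_of_nonneg_right d1 (by positivity))
    have d3 : 1 ≤ α ^ 3 * B ^ 3 := one_le_mul_of_one_le_of_one_le hα3 (one_le_pow₀ hB)
    have d4 : 0 ≤ M₁ / δ ^ 4 * (Ud + GQ) := by positivity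
    have d5 := d2.trans (le_mul_of_one_le_left d4 d3)
    have := mul_le_mul_of_nonneg_left d5 (by positivity : 0 ≤ 64 * Q ^ 2)
    linarith
  have c2 := mul_le_mul_of_nonneg_left e₁
    (by positivity : 0 ≤ M₁ * (16384 * B ^ 2 * Q ^ 2 / δ ^ 4))
  have c3 := mul_le_mul_of_nonneg_left e₂ (by positivity : 0 ≤ M₂ * (256 * B ^ 2 * Q ^ 2))
  have hfin : α ^ 3 * I ≤ α ^ 3 * (16 * Q ^ 2 * (64 * B ^ 3 * Q ^ 2 * (M₁ / δ ^ 4 * (Ud + GQ)) +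
      81920 * B ^ 3 * Q ^ 2 * (M₁ / δ ^ 4 * (Ud + GQ)) +
      1024 * B ^ 3 * Q ^ 2 * (M₂ * (UQ + GQ)))) := by
    refine habs.trans ?_
    rw [show ∀ a b c : ℝ, α ^ 3 * (16 * Q ^ 2 * (a + b + c)) =
      16 * Q ^ 2 * (α ^ 3 * a + α ^ 3 * b + α ^ 3 * c) from fun a b c => by ring]
    refine mul_le_mul_of_nonneg_left (add_le_add (add_le_add c1 (c2.trans (le_of_eq ?_)))
      (c3.trans (le_of_eq ?_))) (by positivity)
    · ring
    · ring
  refine (le_of_mul_le_mul_left hfin (by positivity)).trans ?_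
  have p1 : 0 ≤ B ^ 3 * Q ^ 4 * (M₁ / δ ^ 4 * (Ud + GQ)) := by positivity
  have p2 : 0 ≤ B ^ 3 * Q ^ 4 * (M₂ * (UQ + GQ)) := by positivity
  linarith

/-- Three-region inequality for functions with `|Δu| ≤ K|u| + G`, at the origin. -/
theorem three_region_inequality (d : ℕ) : ∃ C : ℝ, 1 ≤ C ∧
    ∀ (u G : EuclideanSpace ℝ (Fin d) → ℝ) (K Q δ α : ℝ) (Θ : Set (EuclideanSpace ℝ (Fin d))),
      ContDiff ℝ 2 u → Continuous G → 0 ≤ K → 1 ≤ Q → 0 < δ → δ ≤ 1 → 1 ≤ α →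
      1024 * K ^ 2 * Q ^ 4 ≤ α ^ 3 → (∀ x, |lap u x| ≤ K * |u x| + G x) →
      MeasurableSet Θ → (∀ x ∈ Θ, δ ≤ ‖x‖) → (∀ x ∈ Θ, ‖x‖ ≤ Q) →
      ∫ x in Θ, u x ^ 2 ≤ C * Q ^ 4 *
        (Real.exp (α * (1 / 2 + 2 * Real.log (4 * Q / δ))) / δ ^ 4 *
          ((∫ x in Metric.ball 0 δ, u x ^ 2) + ∫ x in Metric.ball 0 (8 * Q), G x ^ 2) +
        Real.exp (-(α * Real.log 2)) *
          ((∫ x in Metric.ball 0 (8 * Q), u x ^ 2) + ∫ x in Metric.ball 0 (8 * Q), G x ^ 2)) := by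
  obtain ⟨B, hB, hcut⟩ := exists_isCutoff d
  refine ⟨1312000 * B ^ 3, by nlinarith [one_le_pow₀ hB (n := 3)], ?_⟩
  intro u G K Q δ α Θ hu hG hK hQ hδ hδ1 hα hαK hlap hΘ hΘδ hΘQ
  have hQ0 : 0 < Q := by linarith
  have hα0 : 0 < α := by linarith
  have hB0 : 0 < B := by linarith
  obtain ⟨η₁, h₁⟩ := hcut (2 * Q) (by positivity)
  obtain ⟨η₂, h₂⟩ := hcut (δ / 4) (by positivity)
  obtain ⟨ηi, hi⟩ := hcut (δ / 2) (by positivity)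
  obtain ⟨ηo, ho⟩ := hcut (4 * Q) (by positivity)
  have cacc_i := caccioppoli (by positivity) hi hu hG hK hlap
  have cacc_o := caccioppoli (by positivity) ho hu hG hK hlap
  rw [show 2 * (δ / 2) = δ by ring] at cacc_i
  rw [show 2 * (4 * Q) = 8 * Q by ring] at cacc_o
  have hPc : Continuous fun x => ∑ i, pd i u x ^ 2 :=
    continuous_finsetSum _ fun i _ => ((hu.of_le (by norm_num)).continuous_pd).pow 2
  have hu2 : Continuous fun x => u x ^ 2 := hu.continuous.pow 2
  have hG2 : Continuous fun x => G x ^ 2 := hG.pow 2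
  have mono : ∀ {f : EuclideanSpace ℝ (Fin d) → ℝ} {r s : ℝ}, Continuous f → (∀ x, 0 ≤ f x) →
      r ≤ s → ∫ x in Metric.ball 0 r, f x ≤ ∫ x in Metric.ball 0 s, f x := fun hf h0 hrs =>
    setIntegral_mono_set (hf.integrableOn_ball _ _) (Eventually.of_forall h0)
      (Metric.ball_subset_ball hrs).eventuallyLE
  have hmb : ∀ r : ℝ, MeasurableSet (Metric.ball (0 : EuclideanSpace ℝ (Fin d)) r) :=
    fun r => measurableSet_ball
  set w := carlemanWeight (d := d) α (1 / (32 * Q ^ 2)) with hw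
  have hv2 : ContDiff ℝ 2 fun y => (η₁ y - η₂ y) * u y := (h₁.contDiff.sub h₂.contDiff).mul hu
  have hv0 : ∀ x, ‖x‖ < δ / 4 → (η₁ x - η₂ x) * u x = 0 := fun x hx => by
    rw [h₁.eq_one x (by linarith), h₂.eq_one x hx.le]; simp
  have hv1 : ∀ x, 4 * Q < ‖x‖ → (η₁ x - η₂ x) * u x = 0 := fun x hx => by
    rw [h₁.eq_zero x (by linarith), h₂.eq_zero x (by linarith)]; simp
  have hvc : HasCompactSupport fun y => (η₁ y - η₂ y) * u y :=
    HasCompactSupport.intro (isCompact_closedBall 0 (4 * Q)) fun x hx => hv1 x (by simpa using hx)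
  have carl := carleman_estimate hv2 hvc (by positivity : 0 < δ / 4) hα0
    (by positivity : 0 < 1 / (32 * Q ^ 2)) hv0 fun x hx => hv1 x (by
      rw [mul_one_div, div_mul_eq_mul_div, one_lt_div (by positivity)] at hx
      by_contra h
      push Not at h
      nlinarith [norm_nonneg x])
  have hwvi : Integrable fun x => w x ^ 2 * ((η₁ x - η₂ x) * u x) ^ 2 := by
    have hc : Continuous fun x => w x * ((η₁ x - η₂ x) * u x) :=
      (contDiff_of_vanish_near_zero (n := 0) (by positivity : 0 < δ / 4)
        (fun x hx => by simp only [hv0 x hx, mul_zero])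
        fun x hx => (contDiffAt_carlemanWeight _ _ hx).mul
          (hv2.of_le (by norm_num)).contDiffAt).continuous
    simp_rw [← mul_pow]
    exact (hc.pow 2).integrable_of_hasCompactSupport (HasCompactSupport.intro hvc fun x hx => by
      have := image_eq_zero_of_notMem_tsupport hx
      simp only [Pi.pow_apply, this, mul_zero, ne_eq, OfNat.ofNat_ne_zero, not_false_eq_true,
        zero_pow])
  set M₁ := Real.exp (α * (1 / 2 - 2 * Real.log (δ / 4))) with hM₁
  set M₂ := Real.exp (α * (1 / 2 - 2 * Real.log (2 * Q))) with hM₂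
  have hM₁0 : 0 < M₁ := Real.exp_pos _
  have hM₂0 : 0 < M₂ := Real.exp_pos _
  have j1 := hwvi.const_mul (64 * Q ^ 2 * K ^ 2)
  have j2 := ((integrable_indicator_iff (hmb (4 * Q))).2
    (hG2.integrableOn_ball 0 (4 * Q))).const_mul (M₁ * (64 * Q ^ 2))
  have j3 := ((integrable_indicator_iff (hmb (δ / 2))).2
    (((hPc.integrableOn_ball 0 (δ / 2)).const_mul (δ ^ 2)).add
      (hu2.integrableOn_ball 0 (δ / 2)))).const_mul (M₁ * (16384 * B ^ 2 * Q ^ 2 / δ ^ 4))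
  have j4 := ((integrable_indicator_iff (hmb (4 * Q))).2
    ((hPc.integrableOn_ball 0 (4 * Q)).add
      (hu2.integrableOn_ball 0 (4 * Q)))).const_mul (M₂ * (256 * B ^ 2 * Q ^ 2))
  have hmono := integral_mono_of_nonneg (Eventually.of_forall fun x => by positivity)
    (((j1.add j2).add j3).add j4) (Eventually.of_forall fun x =>
      weighted_lap_cutoff_le hB hQ hδ hδ1 hα0.le h₁ h₂ hu hlap x)
  rw [integral_add' ((j1.add j2).add j3) j4, integral_add' (j1.add j2) j3, integral_add' j1 j2,
    integral_const_mul, integral_const_mul, integral_const_mul, integral_const_mul,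
    integral_indicator (hmb _), integral_indicator (hmb _), integral_indicator (hmb _),
    integral_add' ((hPc.integrableOn_ball 0 (δ / 2)).const_mul (δ ^ 2))
      (hu2.integrableOn_ball 0 (δ / 2)), integral_const_mul,
    integral_add' (hPc.integrableOn_ball 0 (4 * Q)) (hu2.integrableOn_ball 0 (4 * Q))] at hmono
  have hΘle : Real.exp (-(2 * α * Real.log Q)) * ∫ x in Θ, u x ^ 2 ≤
      ∫ x, w x ^ 2 * ((η₁ x - η₂ x) * u x) ^ 2 := by
    rw [← integral_const_mul, ← integral_indicator hΘ]
    refine integral_mono_of_nonneg (Eventually.of_forall fun x =>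
      indicator_nonneg (fun _ _ => by positivity) _) hwvi (Eventually.of_forall fun x => ?_)
    by_cases hx : x ∈ Θ
    · have h3 := hΘδ x hx
      have h4 := hΘQ x hx
      simp only [indicator_of_mem hx]
      rw [h₁.eq_one x (by linarith), h₂.eq_zero x (by linarith), sub_zero, one_mul]
      exact mul_le_mul_of_nonneg_right (le_carlemanWeight_sq hα0.le (by positivity)
        (by linarith) h4) (sq_nonneg _)
    · simp only [indicator_of_notMem hx]
      positivity
  have hGδ := mono hG2 (fun x => sq_nonneg _) (by linarith : δ ≤ 8 * Q)
  have hGQ := mono hG2 (fun x => sq_nonneg _) (by linarith : 4 * Q ≤ 8 * Q)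
  have hUδ := mono hu2 (fun x => sq_nonneg _) (by linarith : δ / 2 ≤ δ)
  have hUQ := mono hu2 (fun x => sq_nonneg _) (by linarith : 4 * Q ≤ 8 * Q)
  have nn : ∀ {f : EuclideanSpace ℝ (Fin d) → ℝ} {s : Set (EuclideanSpace ℝ (Fin d))},
      0 ≤ ∫ x in s, f x ^ 2 := integral_nonneg fun _ => sq_nonneg _
  have nU1 : 0 ≤ ∫ x in Metric.ball 0 δ, u x ^ 2 := nn
  have nU2 : 0 ≤ ∫ x in Metric.ball 0 (8 * Q), u x ^ 2 := nn
  have nG : 0 ≤ ∫ x in Metric.ball 0 (8 * Q), G x ^ 2 := nn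
  have hI0 : 0 ≤ ∫ x, w x ^ 2 * ((η₁ x - η₂ x) * u x) ^ 2 :=
    integral_nonneg fun x => by positivity
  have hI := three_region_absorb hB hQ hδ hδ1 hα hK hαK hM₁0 hM₂0 hI0 nU1 nU2 nG carl hmono
    cacc_i cacc_o hGδ hGQ hUδ hUQ
  have hT := mul_le_mul_of_nonneg_left (hΘle.trans hI) (Real.exp_pos (2 * α * Real.log Q)).le
  rw [← mul_assoc, ← Real.exp_add, add_neg_cancel, Real.exp_zero, one_mul] at hT
  have hE₁ : Real.exp (2 * α * Real.log Q) * M₁ =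
      Real.exp (α * (1 / 2 + 2 * Real.log (4 * Q / δ))) := by
    rw [hM₁, ← Real.exp_add, show 4 * Q / δ = Q / (δ / 4) by field_simp,
      Real.log_div hQ0.ne' (by positivity)]
    congr 1
    ring
  have hE₂ : Real.exp (2 * α * Real.log Q) * M₂ ≤ Real.exp (-(α * Real.log 2)) := by
    rw [hM₂, ← Real.exp_add, Real.log_mul two_ne_zero hQ0.ne', Real.exp_le_exp]
    nlinarith [Real.log_two_gt_d9]
  rw [← hE₁]
  refine hT.trans ?_
  have := mul_le_mul_of_nonneg_left (mul_le_mul_of_nonneg_right hE₂ (add_nonneg nU2 nG))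
    (by positivity : 0 ≤ 1312000 * B ^ 3 * Q ^ 4)
  refine le_trans (le_of_eq ?_) (le_trans (add_le_add_right this
    (1312000 * B ^ 3 * Q ^ 4 * (Real.exp (2 * α * Real.log Q) * M₁ / δ ^ 4 *
      ((∫ x in Metric.ball 0 δ, u x ^ 2) + ∫ x in Metric.ball 0 (8 * Q), G x ^ 2))))
    (le_of_eq ?_)) <;> ring

lemma pd_comp_add (f : EuclideanSpace ℝ (Fin d) → ℝ) (i : Fin d) (a x : EuclideanSpace ℝ (Fin d)) :
    pd i (fun y => f (y + a)) x = pd i f (x + a) := by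
  simp only [pd, fderiv_comp_add_right]

lemma lap_comp_add (f : EuclideanSpace ℝ (Fin d) → ℝ) (a x : EuclideanSpace ℝ (Fin d)) :
    lap (fun y => f (y + a)) x = lap f (x + a) := by
  simp only [lap_eq_sum_pd]
  refine Finset.sum_congr rfl fun i _ => ?_
  rw [← pd_comp_add (pd i f)]
  exact congrArg (fun g => pd i g x) (funext fun y => pd_comp_add f i a y)

lemma setIntegral_comp_add (f : EuclideanSpace ℝ (Fin d) → ℝ) (a : EuclideanSpace ℝ (Fin d))
    (S : Set (EuclideanSpace ℝ (Fin d))) :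
    ∫ y in (fun y => y + a) ⁻¹' S, f (y + a) = ∫ x in S, f x :=
  (measurePreserving_add_right volume a).setIntegral_preimage_emb
    (MeasurableEquiv.addRight a).measurableEmbedding f S

/-- Three-region inequality centred at an arbitrary point `x₀`. -/
theorem three_region_inequality_at (d : ℕ) : ∃ C : ℝ, 1 ≤ C ∧
    ∀ (u G : EuclideanSpace ℝ (Fin d) → ℝ) (x₀ : EuclideanSpace ℝ (Fin d)) (K Q δ α : ℝ)
      (Θ : Set (EuclideanSpace ℝ (Fin d))),
      ContDiff ℝ 2 u → Continuous G → 0 ≤ K → 1 ≤ Q → 0 < δ → δ ≤ 1 → 1 ≤ α →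
      1024 * K ^ 2 * Q ^ 4 ≤ α ^ 3 → (∀ x, |lap u x| ≤ K * |u x| + G x) →
      MeasurableSet Θ → (∀ x ∈ Θ, δ ≤ ‖x - x₀‖) → (∀ x ∈ Θ, ‖x - x₀‖ ≤ Q) →
      ∫ x in Θ, u x ^ 2 ≤ C * Q ^ 4 *
        (Real.exp (α * (1 / 2 + 2 * Real.log (4 * Q / δ))) / δ ^ 4 *
          ((∫ x in Metric.ball x₀ δ, u x ^ 2) + ∫ x in Metric.ball x₀ (8 * Q), G x ^ 2) +
        Real.exp (-(α * Real.log 2)) * ((∫ x in Metric.ball x₀ (8 * Q), u x ^ 2) +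
          ∫ x in Metric.ball x₀ (8 * Q), G x ^ 2)) := by
  obtain ⟨C, hC, h⟩ := three_region_inequality d
  refine ⟨C, hC, ?_⟩
  intro u G x₀ K Q δ α Θ hu hG hK hQ hδ hδ1 hα hαK hlap hΘ hΘδ hΘQ
  have := h (fun y => u (y + x₀)) (fun y => G (y + x₀)) K Q δ α ((fun y => y + x₀) ⁻¹' Θ)
    (hu.comp (by fun_prop)) (hG.comp (by fun_prop)) hK hQ hδ hδ1 hα hαK
    (fun x => by rw [lap_comp_add]; exact hlap _) (hΘ.preimage (by fun_prop))
    (fun x hx => by simpa using hΘδ _ hx) (fun x hx => by simpa using hΘQ _ hx)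
  have hb : ∀ r : ℝ, Metric.ball (0 : EuclideanSpace ℝ (Fin d)) r =
      (fun y => y + x₀) ⁻¹' Metric.ball x₀ r := fun r => by
    ext y; simp [dist_eq_norm]
  simp_rw [hb, setIntegral_comp_add (fun x => u x ^ 2), setIntegral_comp_add (fun x => G x ^ 2)]
    at this
  exact this

end ThreeRegion

/-! ### Dirichlet eigenfunctions of a box -/

section Modes

variable {d : ℕ}

lemma isOpen_openBox (xc : EuclideanSpace ℝ (Fin d)) (L : ℝ) : IsOpen (openBox xc L) := by
  have : openBox xc L = ⋂ i, {y | |y i - xc i| < L / 2} := by ext; simp [openBox]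
  rw [this]
  exact isOpen_iInter_of_finite fun i => isOpen_lt (by fun_prop) continuous_const

lemma measurableSet_openBox (xc : EuclideanSpace ℝ (Fin d)) (L : ℝ) :
    MeasurableSet (openBox xc L) := (isOpen_openBox xc L).measurableSet

lemma abs_sub_le_of_mem_closure_openBox {xc : EuclideanSpace ℝ (Fin d)} {L : ℝ}
    {x : EuclideanSpace ℝ (Fin d)} (hx : x ∈ closure (openBox xc L)) (i : Fin d) :
    |x i - xc i| ≤ L / 2 := by
  have hc : IsClosed {y : EuclideanSpace ℝ (Fin d) | |y i - xc i| ≤ L / 2} :=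
    isClosed_le (by fun_prop) continuous_const
  exact hc.closure_subset_iff.2 (fun y hy => (hy i).le) hx

lemma isBounded_openBox (xc : EuclideanSpace ℝ (Fin d)) (L : ℝ) :
    Bornology.IsBounded (openBox xc L) := by
  refine (Metric.isBounded_closedBall (x := xc) (r := √(∑ _i : Fin d, (L / 2) ^ 2))).subset
    fun x hx => ?_
  rw [Metric.mem_closedBall, EuclideanSpace.dist_eq]
  refine Real.sqrt_le_sqrt (Finset.sum_le_sum fun i _ => ?_)
  rw [Real.dist_eq]
  exact pow_le_pow_left₀ (abs_nonneg _) (hx i).le 2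

lemma isCompact_closure_openBox (xc : EuclideanSpace ℝ (Fin d)) (L : ℝ) :
    IsCompact (closure (openBox xc L)) := (isBounded_openBox xc L).isCompact_closure

lemma volume_openBox_lt_top (xc : EuclideanSpace ℝ (Fin d)) (L : ℝ) :
    volume (openBox xc L) < ⊤ := (isBounded_openBox xc L).measure_lt_top

lemma pd_prod (φ : Fin d → ℝ → ℝ) (j : Fin d) {φ' : ℝ → ℝ}
    (hφ : ∀ i, Differentiable ℝ (φ i)) (h : ∀ t, HasDerivAt (φ j) (φ' t) t) :
    pd j (fun x => ∏ i, φ i (x i)) = fun x => ∏ i, (Function.update φ j φ') i (x i) := by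
  funext x
  have hd : DifferentiableAt ℝ (fun x : EuclideanSpace ℝ (Fin d) => ∏ i, φ i (x i)) x := by
    refine (HasFDerivAt.finsetProd (u := Finset.univ)
      (g := fun i (x : EuclideanSpace ℝ (Fin d)) => φ i (x i)) fun i _ =>
      DifferentiableAt.hasFDerivAt ?_).differentiableAt
    exact (hφ i (x i)).comp x (f := fun x : EuclideanSpace ℝ (Fin d) => x i)
      ((contDiff_coord (n := 1) i).contDiffAt.differentiableAt (by norm_num))
  rw [pd, ← hd.lineDeriv_eq_fderiv, lineDeriv]
  have hsplit : ∀ (χ : Fin d → ℝ → ℝ) (y : EuclideanSpace ℝ (Fin d)), ∏ i, χ i (y i) =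
      χ j (y j) * ∏ i ∈ Finset.univ.erase j, χ i (y i) := fun χ y =>
    (Finset.mul_prod_erase _ _ (Finset.mem_univ j)).symm
  have h1 : (fun t : ℝ => ∏ i, φ i ((x + t • EuclideanSpace.single j (1 : ℝ)) i)) =
      fun t => φ j (x j + t) * ∏ i ∈ Finset.univ.erase j, φ i (x i) := by
    funext t
    rw [hsplit]
    congr 1
    · simp
    · refine Finset.prod_congr rfl fun i hi => ?_
      simp [Finset.ne_of_mem_erase hi]
  rw [h1, hsplit, Function.update_self]
  have h2 : HasDerivAt (fun t => φ j (x j + t)) (φ' (x j)) 0 := by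
    have := (h (x j + 0)).comp_const_add (x j) 0
    simpa using this
  rw [(h2.mul_const _).deriv]
  congr 1
  exact Finset.prod_congr rfl fun i hi => by rw [Function.update_of_ne (Finset.ne_of_mem_erase hi)]

/-- The Dirichlet eigenfunction `t ↦ sin((n+1)π(t - c + L/2)/L)` of the interval of length `L`
centred at `c`. -/
noncomputable def sineFactor (c L : ℝ) (n : ℕ) (t : ℝ) : ℝ :=
  Real.sin ((n + 1) * (Real.pi * (t - c + L / 2) / L))

/-- The Dirichlet eigenfunctions of the box `openBox xc L`. -/
noncomputable def sineMode (xc : EuclideanSpace ℝ (Fin d)) (L : ℝ) (k : Fin d → ℕ)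
    (x : EuclideanSpace ℝ (Fin d)) : ℝ :=
  ∏ i, sineFactor (xc i) L (k i) (x i)

/-- The Dirichlet eigenvalues of the box of side `L`. -/
noncomputable def sineEigenvalue (L : ℝ) (k : Fin d → ℕ) : ℝ :=
  ∑ i, ((k i + 1) * (Real.pi / L)) ^ 2

lemma contDiff_sineFactor (c L : ℝ) (n : ℕ) {m : WithTop ℕ∞} :
    ContDiff ℝ m (sineFactor c L n) :=
  Real.contDiff_sin.comp (by fun_prop)

lemma contDiff_sineMode (xc : EuclideanSpace ℝ (Fin d)) (L : ℝ) (k : Fin d → ℕ)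
    {m : WithTop ℕ∞} : ContDiff ℝ m (sineMode xc L k) :=
  contDiff_prod fun i _ => (contDiff_sineFactor _ _ _).comp (contDiff_coord i)

lemma lap_sineMode (xc : EuclideanSpace ℝ (Fin d)) (L : ℝ) (k : Fin d → ℕ)
    (x : EuclideanSpace ℝ (Fin d)) :
    lap (sineMode xc L k) x = -sineEigenvalue L k * sineMode xc L k x := by
  rw [lap_eq_sum_pd, sineEigenvalue, ← Finset.sum_neg_distrib, Finset.sum_mul]
  refine Finset.sum_congr rfl fun j _ => ?_
  set φ : Fin d → ℝ → ℝ := fun i => sineFactor (xc i) L (k i) with hφdef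
  set μ : ℝ := (k j + 1) * (Real.pi / L)
  have hφ : ∀ i, Differentiable ℝ (φ i) := fun i =>
    (contDiff_sineFactor (m := 1) _ _ _).differentiable (by norm_num)
  have hlin : ∀ t, HasDerivAt
      (fun t : ℝ => ((k j : ℝ) + 1) * (Real.pi * (t - xc j + L / 2) / L)) μ t := fun t => by
    have := (((((hasDerivAt_id t).sub_const (xc j)).add_const (L / 2)).const_mul
      Real.pi).div_const L).const_mul ((k j : ℝ) + 1)
    refine this.congr_deriv ?_
    simp [μ]
  set φ' : ℝ → ℝ := fun t =>
    Real.cos (((k j : ℝ) + 1) * (Real.pi * (t - xc j + L / 2) / L)) * μ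
  have h1 : ∀ t, HasDerivAt (φ j) (φ' t) t := fun t => (hlin t).sin
  have h2 : ∀ t, HasDerivAt φ' (-(μ ^ 2) * φ j t) t := fun t => by
    refine ((hlin t).cos.mul_const μ).congr_deriv ?_
    simp only [φ, sineFactor]
    ring
  have hφ2 : ∀ i, Differentiable ℝ (Function.update φ j φ' i) := fun i => by
    by_cases hij : i = j
    · subst hij
      rw [Function.update_self]
      exact fun t => (h2 t).differentiableAt
    · rw [Function.update_of_ne hij]
      exact hφ i
  have e1 : pd j (sineMode xc L k) = fun x => ∏ i, (Function.update φ j φ') i (x i) :=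
    pd_prod φ j hφ h1
  rw [e1, pd_prod (Function.update φ j φ') j (φ' := fun t => -(μ ^ 2) * φ j t) hφ2
    (by rw [Function.update_self]; exact h2), Function.update_idem]
  simp only [sineMode]
  rw [← Finset.mul_prod_erase _ _ (Finset.mem_univ j),
    ← Finset.mul_prod_erase _ (fun i => sineFactor (xc i) L (k i) (x i)) (Finset.mem_univ j),
    Function.update_self, mul_assoc]
  congr 2
  exact Finset.prod_congr rfl fun i hi => by rw [Function.update_of_ne (Finset.ne_of_mem_erase hi)]

lemma sineFactor_zero_pos {c L t : ℝ} (hL : 0 < L) (ht : |t - c| < L / 2) :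
    0 < sineFactor c L 0 t := by
  rw [abs_lt] at ht
  have h : 0 < t - c + L / 2 := by linarith
  refine Real.sin_pos_of_pos_of_lt_pi ?_ ?_
  · simp only [Nat.cast_zero, zero_add, one_mul]
    have := Real.pi_pos
    positivity
  · simp only [Nat.cast_zero, zero_add, one_mul]
    rw [div_lt_iff₀ hL]
    exact mul_lt_mul_of_pos_left (by linarith) Real.pi_pos

lemma sineFactor_eq_zero {c L t : ℝ} (hL : 0 < L) (n : ℕ) (ht : |t - c| = L / 2) :
    sineFactor c L n t = 0 := by
  rcases (abs_eq (by linarith)).1 ht with h | h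
  · rw [sineFactor, h, show Real.pi * (L / 2 + L / 2) / L = Real.pi by field_simp; ring]
    exact_mod_cast Real.sin_nat_mul_pi (n + 1)
  · rw [sineFactor, h]
    simp

lemma sineMode_zero_pos {xc : EuclideanSpace ℝ (Fin d)} {L : ℝ} (hL : 0 < L)
    {x : EuclideanSpace ℝ (Fin d)} (hx : x ∈ openBox xc L) : 0 < sineMode xc L 0 x :=
  Finset.prod_pos fun i _ => sineFactor_zero_pos hL (hx i)

lemma sineMode_eq_zero {xc : EuclideanSpace ℝ (Fin d)} {L : ℝ} (hL : 0 < L) (k : Fin d → ℕ)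
    {x : EuclideanSpace ℝ (Fin d)} (hx : x ∈ closure (openBox xc L)) (hx' : x ∉ openBox xc L) :
    sineMode xc L k x = 0 := by
  simp only [openBox, mem_ofPred_eq, not_forall] at hx'
  obtain ⟨i, hi⟩ := hx'
  exact Finset.prod_eq_zero (Finset.mem_univ i) (sineFactor_eq_zero hL _
    (le_antisymm (abs_sub_le_of_mem_closure_openBox hx i) (not_lt.1 hi)))

lemma exists_sineMode_eq_mul (xc : EuclideanSpace ℝ (Fin d)) (L : ℝ) (k : Fin d → ℕ) :
    ∃ p : EuclideanSpace ℝ (Fin d) → ℝ, ContDiff ℝ 2 p ∧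
      ∀ x, sineMode xc L k x = sineMode xc L 0 x * p x := by
  refine ⟨fun x => ∏ i, (Polynomial.Chebyshev.U ℝ (k i)).eval
    (Real.cos (Real.pi * (x i - xc i + L / 2) / L)), ?_, fun x => ?_⟩
  · refine contDiff_prod fun i _ => ?_
    have h1 : ContDiff ℝ 2 fun t : ℝ => (Polynomial.Chebyshev.U ℝ (k i)).eval t :=
      (Polynomial.Chebyshev.U ℝ (k i)).contDiff_aeval 2
    refine h1.comp (Real.contDiff_cos.comp ?_)
    have := contDiff_coord (d := d) i (n := 2)
    fun_prop
  · simp only [sineMode]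
    rw [← Finset.prod_mul_distrib]
    refine Finset.prod_congr rfl fun i _ => ?_
    have := Polynomial.Chebyshev.U_real_cos (Real.pi * (x i - xc i + L / 2) / L) (k i)
    simp only [sineFactor, Pi.zero_apply, Nat.cast_zero, zero_add, one_mul]
    rw [mul_comm (Real.sin (_ / L)), this]
    push_cast
    rfl

end Modes

/-! ### Green's identity for functions vanishing on the boundary -/

section Truncation

/-- A smooth approximation of the positive part, vanishing below `τ`. -/
lemma exists_smooth_truncation {τ : ℝ} (hτ : 0 < τ) :
    ∃ H s s' : ℝ → ℝ, ContDiff ℝ 2 H ∧ (∀ y, HasDerivAt H (s y) y) ∧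
      (∀ y, HasDerivAt s (s' y) y) ∧ Continuous s' ∧ (∀ y, 0 ≤ s y) ∧ (∀ y, s y ≤ 1) ∧
      (∀ y, 0 ≤ s' y) ∧ (∀ y, 2 * τ ≤ y → s y = 1) ∧ (∀ y, 2 * τ < y → s' y = 0) ∧
      (∀ y, y ≤ τ → H y = 0) ∧ (∀ y, 0 ≤ y → 0 ≤ H y) ∧ (∀ y, 0 ≤ y → H y ≤ y) ∧
      ∀ y, 0 ≤ y → y - 2 * τ ≤ H y := by
  set s : ℝ → ℝ := fun y => Real.smoothTransition (y / τ - 1) with hs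
  have hsC : ContDiff ℝ 2 s := Real.smoothTransition.contDiff.comp (by fun_prop)
  have hsc : Continuous s := hsC.continuous
  have hmono : Monotone s := fun a b hab => Real.smoothTransition.monotone (by gcongr)
  have hs0 : ∀ y, 0 ≤ s y := fun y => Real.smoothTransition.nonneg _
  have hs1 : ∀ y, s y ≤ 1 := fun y => Real.smoothTransition.le_one _
  have hsone : ∀ y, 2 * τ ≤ y → s y = 1 := fun y hy =>
    Real.smoothTransition.one_of_one_le (by
      have : 2 ≤ y / τ := (le_div_iff₀ hτ).2 hy
      linarith)
  have hszero : ∀ y, y ≤ τ → s y = 0 := fun y hy =>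
    Real.smoothTransition.zero_of_nonpos (by
      have : y / τ ≤ 1 := (div_le_one hτ).2 hy
      linarith)
  have hH : ∀ y, HasDerivAt (fun y => ∫ t in (0 : ℝ)..y, s t) (s y) y := fun y =>
    intervalIntegral.integral_hasDerivAt_right (hsc.intervalIntegrable _ _)
      (hsc.stronglyMeasurableAtFilter _ _) hsc.continuousAt
  have hderiv : deriv (fun y => ∫ t in (0 : ℝ)..y, s t) = s := funext fun y => (hH y).deriv
  have hi : ∀ a b, IntervalIntegrable s volume a b := fun a b => hsc.intervalIntegrable _ _
  have hpos : ∀ y, 0 ≤ y → 0 ≤ ∫ t in (0 : ℝ)..y, s t := fun y hy =>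
    intervalIntegral.integral_nonneg hy fun t _ => hs0 t
  refine ⟨fun y => ∫ t in (0 : ℝ)..y, s t, s, deriv s, ?_, hH,
    fun y => (hsC.differentiable (by norm_num) y).hasDerivAt, hsC.continuous_deriv (by norm_num),
    hs0, hs1, fun y => hmono.deriv_nonneg, hsone, fun y hy => ?_, fun y hy => ?_, hpos,
    fun y hy => ?_, fun y hy => ?_⟩
  · rw [show (2 : WithTop ℕ∞) = 1 + 1 by norm_num, contDiff_succ_iff_deriv]
    exact ⟨fun y => (hH y).differentiableAt, by simp, by
      rw [hderiv]
      exact hsC.of_le (by norm_num)⟩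
  · have : s =ᶠ[𝓝 y] fun _ => 1 := by
      filter_upwards [lt_mem_nhds hy] with z hz using hsone z hz.le
    rw [this.deriv_eq, deriv_const]
  · have : ∫ t in (0 : ℝ)..y, s t = ∫ t in (0 : ℝ)..y, (0 : ℝ) := by
      refine intervalIntegral.integral_congr fun t ht => hszero t ?_
      rw [uIcc] at ht
      exact ht.2.trans (max_le hτ.le hy)
    simpa using this
  · have := intervalIntegral.integral_mono_on hy (hi 0 y)
      (continuous_const.intervalIntegrable (μ := volume) 0 y) fun t _ => hs1 t
    simpa using this
  · rcases le_total y (2 * τ) with h | h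
    · linarith [hpos y hy]
    · have h1 := intervalIntegral.integral_add_adjacent_intervals (hi 0 (2 * τ)) (hi (2 * τ) y)
      have h2 : ∫ t in (2 * τ)..y, s t = ∫ t in (2 * τ)..y, (1 : ℝ) := by
        refine intervalIntegral.integral_congr fun t ht => hsone t ?_
        rw [uIcc_of_le h] at ht
        exact ht.1
      rw [intervalIntegral.integral_const] at h2
      have h3 := hpos (2 * τ) (by positivity)
      simp only [smul_eq_mul, mul_one] at h2
      linarith

end Truncation

section Green

variable {d : ℕ}

/-- A continuous function vanishing on the boundary is uniformly small where `w` is small. -/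
lemma exists_abs_lt_of_lt {O : Set (EuclideanSpace ℝ (Fin d))} (hO : IsOpen O)
    (hOc : IsCompact (closure O)) {w ψ : EuclideanSpace ℝ (Fin d) → ℝ} (hw : Continuous w)
    (hwpos : ∀ x ∈ O, 0 < w x) (hψ : ContinuousOn ψ (closure O))
    (hψ0 : ∀ x ∈ frontier O, ψ x = 0) {ε : ℝ} (hε : 0 < ε) :
    ∃ τ > 0, ∀ x ∈ O, w x ≤ τ → |ψ x| < ε := by
  set A : Set (EuclideanSpace ℝ (Fin d)) := closure O ∩ {x | ε ≤ |ψ x|}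
  have hA : IsCompact A := by
    refine hOc.of_isClosed_subset ?_ inter_subset_left
    exact hψ.abs.preimage_isClosed_of_isClosed isClosed_closure isClosed_Ici
  have hAO : A ⊆ O := fun x hx => by
    by_contra h
    have : x ∈ frontier O := by rw [hO.frontier_eq]; exact ⟨hx.1, h⟩
    have h2 : ε ≤ |ψ x| := hx.2
    rw [hψ0 x this, abs_zero] at h2
    linarith
  rcases A.eq_empty_or_nonempty with h | h
  · refine ⟨1, one_pos, fun x hx _ => ?_⟩
    by_contra hc
    exact (h ▸ (⟨subset_closure hx, not_lt.1 hc⟩ : x ∈ A) : x ∈ (∅ : Set _))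
  · obtain ⟨z, hz, hmin⟩ := hA.exists_isMinOn h hw.continuousOn
    refine ⟨w z / 2, half_pos (hwpos z (hAO hz)), fun x hx hwx => ?_⟩
    by_contra hc
    have := hmin (⟨subset_closure hx, not_lt.1 hc⟩ : x ∈ A)
    have h3 := hwpos z (hAO hz)
    simp only [mem_ofPred_eq] at this
    linarith

lemma integral_lap_mul_eq {O : Set (EuclideanSpace ℝ (Fin d))} (hO : IsOpen O)
    (hOc : IsCompact (closure O)) {w p ψ : EuclideanSpace ℝ (Fin d) → ℝ}
    (hw : ContDiff ℝ 2 w) (hp : ContDiff ℝ 2 p) (hwpos : ∀ x ∈ O, 0 < w x)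
    (hw0 : ∀ x ∈ closure O, x ∉ O → w x = 0) (hψ : ContinuousOn ψ (closure O))
    (hψ2 : ContDiffOn ℝ 2 ψ O) (hψ0 : ∀ x ∈ frontier O, ψ x = 0)
    (hlap : IntegrableOn (lap ψ) O) :
    ∫ x in O, lap ψ x * (w x * p x) = ∫ x in O, ψ x * lap (fun y => w y * p y) x := by
  have hOm : MeasurableSet O := hO.measurableSet
  have hOv : volume O ≠ ⊤ := (measure_mono subset_closure).trans_lt hOc.measure_lt_top |>.ne
  set τ : ℕ → ℝ := fun n => 1 / ((n : ℝ) + 1) with hτdef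
  have hτ : ∀ n, 0 < τ n := fun n => by positivity
  have hτ0 : Tendsto τ atTop (𝓝 0) := tendsto_one_div_add_atTop_nhds_zero_nat
  choose H s s' hH hHs hss' hs'c hs0 hs1 hs'0 hsone hs'z hHz hHp hHy hHl using
    fun n => exists_smooth_truncation (hτ n)
  have hsc : ∀ n, Continuous (s n) := fun n =>
    continuous_iff_continuousAt.2 fun y => (hss' n y).continuousAt
  have hwc : Continuous w := hw.continuous
  have hpc : Continuous p := hp.continuous
  have hΔw := hw.continuous_lap
  have hΔp := hp.continuous_lap
  have hpdw : ∀ i, Continuous (pd i w) := fun i => (hw.of_le (by norm_num)).continuous_pd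
  have hpdp : ∀ i, Continuous (pd i p) := fun i => (hp.of_le (by norm_num)).continuous_pd
  set D : EuclideanSpace ℝ (Fin d) → ℝ := fun x => ∑ i : Fin d, pd i w x * pd i p x with hD
  have hDc : Continuous D := continuous_finsetSum _ fun i _ => (hpdw i).mul (hpdp i)
  set N : EuclideanSpace ℝ (Fin d) → ℝ := fun x => ∑ i : Fin d, pd i w x ^ 2 with hN
  have hNc : Continuous N := continuous_finsetSum _ fun i _ => (hpdw i).pow 2
  have hN0 : ∀ x, 0 ≤ N x := fun x => Finset.sum_nonneg fun i _ => sq_nonneg _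
  have hcint : ∀ {f : EuclideanSpace ℝ (Fin d) → ℝ}, Continuous f → IntegrableOn f O := fun hf =>
    (hf.continuousOn.integrableOn_compact hOc).mono_set subset_closure
  have hψint : IntegrableOn ψ O := (hψ.integrableOn_compact hOc).mono_set subset_closure
  have hψm : ∀ {f : EuclideanSpace ℝ (Fin d) → ℝ}, Continuous f →
      IntegrableOn (fun x => ψ x * f x) O := fun hf =>
    ((hψ.mul hf.continuousOn).integrableOn_compact hOc).mono_set subset_closure
  have hlapw : ∀ n x, lap (fun y => H n (w y)) x = s' n (w x) * N x + s n (w x) * lap w x :=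
    fun n x => lap_comp (Eventually.of_forall (hHs n)) (hss' n (w x)) hw.contDiffAt
  have hHw : ∀ n, ContDiff ℝ 2 fun y => H n (w y) := fun n => (hH n).comp hw
  have hpdHw : ∀ n i x, pd i (fun y => H n (w y)) x = s n (w x) * pd i w x := fun n i x =>
    pd_comp (hHs n (w x)) (hw.contDiffAt.differentiableAt_of_two)
  set R : ℕ → EuclideanSpace ℝ (Fin d) → ℝ := fun n x =>
    p x * (s n (w x) * lap w x) + 2 * (s n (w x) * D x) + H n (w x) * lap p x with hR
  have hlapg : ∀ n x, lap (fun y => H n (w y) * p y) x = p x * (s' n (w x) * N x) + R n x := by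
    intro n x
    rw [lap_mul (hHw n).contDiffAt hp.contDiffAt, hlapw]
    simp only [hpdHw, hR, hD, mul_assoc, ← Finset.mul_sum]
    ring
  set A : ℕ → Set (EuclideanSpace ℝ (Fin d)) := fun n => closure O ∩ {x | τ n ≤ w x}
  have hA : ∀ n, IsCompact (A n) := fun n => hOc.inter_right (isClosed_le continuous_const hwc)
  have hAO : ∀ n, A n ⊆ O := fun n x hx => by
    by_contra h
    have h2 : τ n ≤ w x := hx.2
    rw [hw0 x hx.1 h] at h2
    linarith [hτ n]
  have green : ∀ (n : ℕ) (f q : EuclideanSpace ℝ (Fin d) → ℝ), ContDiffOn ℝ 2 f O →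
      ContDiff ℝ 2 q → ∫ x in O, f x * lap (fun y => H n (w y) * q y) x =
        ∫ x in O, lap f x * (H n (w x) * q x) := by
    intro n f q hf hq
    set g : EuclideanSpace ℝ (Fin d) → ℝ := O.indicator fun y => H n (w y) * q y with hg
    have hgO : ∀ x ∈ O, g =ᶠ[𝓝 x] fun y => H n (w y) * q y := fun x hx => by
      filter_upwards [hO.mem_nhds hx] with y hy using indicator_of_mem hy _
    have h0 : ∀ x ∉ A n, g x = 0 := fun x hx => by
      by_cases hxO : x ∈ O
      · rw [hg, indicator_of_mem hxO, hHz n (w x), zero_mul]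
        by_contra hc
        exact hx ⟨subset_closure hxO, (not_le.1 hc).le⟩
      · exact indicator_of_notMem hxO _
    have key := integral_mul_lap_comm hO (hA n) (hAO n) hf (g := g)
      (fun x hx => (((hHw n).mul hq).contDiffAt.congr_of_eventuallyEq
        (hgO x hx)).contDiffWithinAt) h0
    rw [setIntegral_congr_fun hOm (g := fun x => f x * lap (fun y => H n (w y) * q y) x)
      fun x hx => by simp only [(hgO x hx).lap_eq],
      setIntegral_congr_fun hOm (f := fun x => lap f x * g x)
        (g := fun x => lap f x * (H n (w x) * q x))
      fun x hx => by simp only [(hgO x hx).self_of_nhds]] at key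
    exact key
  have hM : ∀ n, ∫ x in O, s' n (w x) * N x ≤ ∫ x in O, |lap w x| := by
    intro n
    have h1 := green n (fun _ => 1) (fun _ => 1) contDiffOn_const contDiff_const
    have h2 : ∀ x : EuclideanSpace ℝ (Fin d), lap (fun _ : EuclideanSpace ℝ (Fin d) => (1 : ℝ)) x
      = 0 := fun x => by
      simp [lap_eq_sum_pd, show ∀ i : Fin d, pd i (fun _ : EuclideanSpace ℝ (Fin d) => (1 : ℝ)) =
        fun _ => 0 from fun i => funext fun _ => pd_const 1, pd_const]
    simp only [h2, zero_mul, integral_zero, mul_one, one_mul, hlapw] at h1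
    have i1 : IntegrableOn (fun x => s' n (w x) * N x) O :=
      hcint (((hs'c n).comp hwc).mul hNc)
    have i2 : IntegrableOn (fun x => s n (w x) * lap w x) O :=
      hcint (((hsc n).comp hwc).mul hΔw)
    rw [integral_add i1 i2] at h1
    have h3 : -∫ x in O, s n (w x) * lap w x ≤ ∫ x in O, |lap w x| := by
      rw [← integral_neg]
      refine integral_mono i2.neg (hcint hΔw.abs) fun x => ?_
      have := hs0 n (w x)
      have := hs1 n (w x)
      have h4 := neg_abs_le (lap w x)
      have h5 := abs_nonneg (lap w x)
      change -(s n (w x) * lap w x) ≤ |lap w x|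
      nlinarith
    linarith
  obtain ⟨P, hP⟩ : ∃ P, ∀ x ∈ closure O, |p x| ≤ P := by
    obtain ⟨P, hP⟩ := hOc.exists_bound_of_continuousOn hpc.continuousOn
    exact ⟨P, hP⟩
  have herr : Tendsto (fun n => ∫ x in O, ψ x * (p x * (s' n (w x) * N x))) atTop (𝓝 0) := by
    set M := ∫ x in O, |lap w x| with hMdef
    have hM0 : 0 ≤ M := integral_nonneg fun x => abs_nonneg _
    rw [Metric.tendsto_atTop]
    intro ε hε
    set P' := max P 0
    have hP'0 : 0 ≤ P' := le_max_right _ _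
    obtain ⟨t, ht, hsmall⟩ := exists_abs_lt_of_lt hO hOc hwc hwpos hψ hψ0
      (ε := ε / (P' * M + 1)) (by positivity)
    obtain ⟨n₀, hn₀⟩ := ((tendsto_order.1 hτ0).2 (t / 2) (by positivity)).exists_forall_of_atTop
    refine ⟨n₀, fun n hn => ?_⟩
    have hτn := hn₀ n hn
    rw [dist_zero_right]
    have i1 : IntegrableOn (fun x => s' n (w x) * N x) O :=
      hcint (((hs'c n).comp hwc).mul hNc)
    have hb : ∀ x ∈ O, ‖ψ x * (p x * (s' n (w x) * N x))‖ ≤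
        ε / (P' * M + 1) * P' * (s' n (w x) * N x) := by
      intro x hx
      rw [norm_mul, norm_mul, Real.norm_eq_abs, Real.norm_eq_abs, Real.norm_eq_abs,
        abs_of_nonneg (mul_nonneg (hs'0 n _) (hN0 x)), ← mul_assoc]
      by_cases hwx : 2 * τ n < w x
      · rw [hs'z n _ hwx]; simp
      · have h1 := hsmall x hx (by linarith)
        have h2 : |p x| ≤ P' := (hP x (subset_closure hx)).trans (le_max_left _ _)
        have := mul_nonneg (hs'0 n (w x)) (hN0 x)
        gcongr
    calc ‖∫ x in O, ψ x * (p x * (s' n (w x) * N x))‖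
        ≤ ∫ x in O, ε / (P' * M + 1) * P' * (s' n (w x) * N x) :=
          norm_integral_le_of_norm_le (i1.const_mul _)
            ((ae_restrict_iff' hOm).2 (Eventually.of_forall hb))
      _ = ε / (P' * M + 1) * P' * ∫ x in O, s' n (w x) * N x := integral_const_mul _ _
      _ ≤ ε / (P' * M + 1) * P' * M := by gcongr; exact hM n
      _ = ε * (P' * M / (P' * M + 1)) := by ring
      _ < ε * 1 := by
          gcongr
          rw [div_lt_one (by positivity)]
          linarith
      _ = ε := mul_one _
  have hHlim : ∀ x ∈ O, Tendsto (fun n => H n (w x)) atTop (𝓝 (w x)) := fun x hx => by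
    refine tendsto_of_tendsto_of_tendsto_of_le_of_le (g := fun n => w x - 2 * τ n) ?_
      tendsto_const_nhds (fun n => hHl n _ (hwpos x hx).le) fun n => hHy n _ (hwpos x hx).le
    simpa using tendsto_const_nhds.sub (hτ0.const_mul 2)
  have hslim : ∀ x ∈ O, Tendsto (fun n => s n (w x)) atTop (𝓝 1) := fun x hx => by
    refine tendsto_const_nhds.congr' ?_
    filter_upwards [(tendsto_order.1 hτ0).2 (w x / 2) (half_pos (hwpos x hx))] with n hn
    exact (hsone n _ (by linarith)).symm
  have hRc : ∀ n, Continuous (R n) := fun n => by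
    have := (hsc n).comp hwc
    have := (hHw n).continuous
    simp only [hR]
    fun_prop
  have hRlim : Tendsto (fun n => ∫ x in O, ψ x * R n x) atTop
      (𝓝 (∫ x in O, ψ x * lap (fun y => w y * p y) x)) := by
    refine tendsto_integral_of_dominated_convergence
      (fun x => ‖ψ x * (|p x| * |lap w x| + 2 * |D x| + |w x| * |lap p x|)‖)
      (fun n => (hψm (hRc n)).aestronglyMeasurable)
      (hψm (f := fun x => |p x| * |lap w x| + 2 * |D x| + |w x| * |lap p x|) (by fun_prop)).norm
      (fun n => (ae_restrict_iff' hOm).2 (Eventually.of_forall fun x hx => ?_))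
      ((ae_restrict_iff' hOm).2 (Eventually.of_forall fun x hx => ?_))
    · rw [norm_mul, norm_mul]
      gcongr
      rw [Real.norm_eq_abs, Real.norm_eq_abs]
      refine le_trans ?_ (le_abs_self _)
      have hsa : |s n (w x)| ≤ 1 := by rw [abs_of_nonneg (hs0 n _)]; exact hs1 n _
      have hHa : |H n (w x)| ≤ |w x| := by
        rw [abs_of_nonneg (hHp n _ (hwpos x hx).le)]
        exact (hHy n _ (hwpos x hx).le).trans (le_abs_self _)
      refine (abs_add_le _ _).trans (add_le_add ((abs_add_le _ _).trans (add_le_add ?_ ?_)) ?_)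
      · rw [abs_mul, abs_mul]
        exact mul_le_mul_of_nonneg_left (mul_le_of_le_one_left (abs_nonneg _) hsa) (abs_nonneg _)
      · rw [abs_mul, abs_mul, abs_two]
        exact mul_le_mul_of_nonneg_left (mul_le_of_le_one_left (abs_nonneg _) hsa) (by norm_num)
      · rw [abs_mul]
        exact mul_le_mul_of_nonneg_right hHa (abs_nonneg _)
    · have h1 : lap (fun y => w y * p y) x =
          p x * (1 * lap w x) + 2 * (1 * D x) + w x * lap p x := by
        rw [lap_mul hw.contDiffAt hp.contDiffAt]
        simp only [hD]
        ring
      rw [h1]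
      exact ((((hslim x hx).mul_const _).const_mul _).add
        (((hslim x hx).mul_const _).const_mul _) |>.add ((hHlim x hx).mul_const _)).const_mul _
  have hLlim : Tendsto (fun n => ∫ x in O, lap ψ x * (H n (w x) * p x)) atTop
      (𝓝 (∫ x in O, lap ψ x * (w x * p x))) := by
    obtain ⟨W, hW⟩ := hOc.exists_bound_of_continuousOn hwc.continuousOn
    refine tendsto_integral_of_dominated_convergence
      (fun x => ‖lap ψ x‖ * (W * P))
      (fun n => hlap.aestronglyMeasurable.mul
        ((hHw n).continuous.mul hpc).aestronglyMeasurable)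
      (hlap.norm.mul_const _)
      (fun n => (ae_restrict_iff' hOm).2 (Eventually.of_forall fun x hx => ?_))
      ((ae_restrict_iff' hOm).2 (Eventually.of_forall fun x hx => ?_))
    · rw [norm_mul, norm_mul]
      have hHa : ‖H n (w x)‖ ≤ W := by
        rw [Real.norm_eq_abs, abs_of_nonneg (hHp n _ (hwpos x hx).le)]
        exact ((hHy n _ (hwpos x hx).le).trans (le_abs_self _)).trans (hW x (subset_closure hx))
      have hpa : ‖p x‖ ≤ P := hP x (subset_closure hx)
      have := (norm_nonneg _).trans hHa
      gcongr
    · exact ((hHlim x hx).mul_const _).const_mul _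
  have hsum : ∀ n, ∫ x in O, lap ψ x * (H n (w x) * p x) =
      (∫ x in O, ψ x * (p x * (s' n (w x) * N x))) + ∫ x in O, ψ x * R n x := fun n => by
    rw [← green n ψ p hψ2 hp, ← integral_add
      (hψm (f := fun x => p x * (s' n (w x) * N x))
        (hpc.mul (((hs'c n).comp hwc).mul hNc))) (hψm (hRc n))]
    refine integral_congr_ae (Eventually.of_forall fun x => ?_)
    simp only [hlapg]
    ring
  simp only [hsum] at hLlim
  simpa using tendsto_nhds_unique hLlim (herr.add hRlim)

end Green

/-! ### Completeness of the Dirichlet eigenfunctions -/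

section Orthogonality

variable {d : ℕ}

lemma integral_sineFactor_mul {L : ℝ} (hL : 0 < L) (c : ℝ) (n m : ℕ) :
    ∫ t in (c - L / 2)..(c + L / 2), sineFactor c L n t * sineFactor c L m t =
      if n = m then L / 2 else 0 := by
  have hπ := Real.pi_pos
  have hi : IntervalIntegrable (fun t => sineFactor c L n t * sineFactor c L m t) volume
      (c - L / 2) (c + L / 2) :=
    ((contDiff_sineFactor (m := 0) c L n).continuous.mul
      (contDiff_sineFactor (m := 0) c L m).continuous).intervalIntegrable _ _
  set θ : ℝ → ℝ := fun t => Real.pi * (t - c + L / 2) / L with hθ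
  have hθ' : ∀ t, HasDerivAt θ (Real.pi / L) t := fun t => by
    have := ((((hasDerivAt_id t).sub_const c).add_const (L / 2)).const_mul Real.pi).div_const L
    simpa using this
  have hsin : ∀ (a t : ℝ), HasDerivAt (fun t => Real.sin (a * θ t))
      (Real.cos (a * θ t) * (a * (Real.pi / L))) t := fun a t => ((hθ' t).const_mul a).sin
  have hθ0 : θ (c - L / 2) = 0 := by simp only [hθ]; ring_nf
  have hθ1 : θ (c + L / 2) = Real.pi := by simp only [hθ]; field_simp; ring
  have hprod : ∀ t, sineFactor c L n t * sineFactor c L m t =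
      (Real.cos (((n : ℝ) - m) * θ t) - Real.cos (((n : ℝ) + m + 2) * θ t)) / 2 := fun t => by
    rw [show ((n : ℝ) - m) * θ t = (n + 1) * θ t - (m + 1) * θ t by ring,
      show ((n : ℝ) + m + 2) * θ t = (n + 1) * θ t + (m + 1) * θ t by ring,
      Real.cos_sub, Real.cos_add, sineFactor, sineFactor]
    ring
  have hs2 : Real.sin (((n : ℝ) + m + 2) * Real.pi) = 0 := by
    exact_mod_cast Real.sin_nat_mul_pi (n + m + 2)
  have hnm : (0 : ℝ) < n + m + 2 := by positivity
  by_cases h : n = m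
  · rw [if_pos h]
    rw [intervalIntegral.integral_eq_sub_of_hasDerivAt (f := fun t => t / 2 -
      L / Real.pi * Real.sin (((n : ℝ) + m + 2) * θ t) / (2 * (n + m + 2))) (fun t _ => ?_) hi]
    · simp only [hθ0, hθ1, hs2, mul_zero, Real.sin_zero]
      ring
    · rw [hprod, h, sub_self, zero_mul, Real.cos_zero]
      subst h
      refine (((hasDerivAt_id t).div_const 2).sub
        (((hsin _ t).const_mul (L / Real.pi)).div_const _)).congr_deriv ?_
      field_simp
  · rw [if_neg h]
    have h' : (n : ℝ) - m ≠ 0 := by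
      rw [sub_ne_zero]
      exact_mod_cast h
    have hs1 : Real.sin (((n : ℝ) - m) * Real.pi) = 0 := by
      exact_mod_cast Real.sin_int_mul_pi ((n : ℤ) - m)
    rw [intervalIntegral.integral_eq_sub_of_hasDerivAt (f := fun t =>
      L / Real.pi * Real.sin (((n : ℝ) - m) * θ t) / (2 * (n - m)) -
      L / Real.pi * Real.sin (((n : ℝ) + m + 2) * θ t) / (2 * (n + m + 2))) (fun t _ => ?_) hi]
    · simp only [hθ0, hθ1, hs1, hs2, mul_zero, Real.sin_zero]
      ring
    · rw [hprod]
      refine ((((hsin _ t).const_mul (L / Real.pi)).div_const _).sub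
        (((hsin _ t).const_mul (L / Real.pi)).div_const _)).congr_deriv ?_
      field_simp

lemma integral_openBox_prod {L : ℝ} (hL : 0 < L) (xc : EuclideanSpace ℝ (Fin d))
    (φ : Fin d → ℝ → ℝ) :
    ∫ x in openBox xc L, ∏ i, φ i (x i) =
      ∏ i, ∫ t in (xc i - L / 2)..(xc i + L / 2), φ i t := by
  set I : Fin d → Set ℝ := fun i => Ioc (xc i - L / 2) (xc i + L / 2)
  set J : Fin d → Set ℝ := fun i => Ioo (xc i - L / 2) (xc i + L / 2)
  have hmem : ∀ (x : EuclideanSpace ℝ (Fin d)), x ∈ openBox xc L ↔ ∀ i, x i ∈ J i := fun x => by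
    simp only [openBox, mem_ofPred_eq, J, mem_Ioo, abs_lt]
    exact forall_congr' fun i => ⟨fun h => ⟨by linarith, by linarith⟩,
      fun h => ⟨by linarith, by linarith⟩⟩
  have h1 : (fun x => (openBox xc L).indicator (fun x => ∏ i, φ i (x i)) x) =
      fun x : EuclideanSpace ℝ (Fin d) => ∏ i, (J i).indicator (φ i) (x.ofLp i) := by
    funext x
    by_cases hx : x ∈ openBox xc L
    · rw [indicator_of_mem hx]
      exact Finset.prod_congr rfl fun i _ => (indicator_of_mem ((hmem x).1 hx i) _).symm
    · rw [indicator_of_notMem hx]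
      rw [hmem, not_forall] at hx
      obtain ⟨i, hi⟩ := hx
      exact (Finset.prod_eq_zero (Finset.mem_univ i) (indicator_of_notMem hi _)).symm
  rw [← integral_indicator (measurableSet_openBox xc L), h1]
  have h2 := (EuclideanSpace.volume_preserving_symm_measurableEquiv_toLp (Fin d)).integral_comp
    (MeasurableEquiv.measurableEmbedding _) (fun y : Fin d → ℝ => ∏ i, (J i).indicator (φ i) (y i))
  refine Eq.trans h2 ?_
  rw [integral_fintype_prod_volume_eq_prod (fun i => (J i).indicator (φ i))]
  refine Finset.prod_congr rfl fun i _ => ?_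
  rw [integral_indicator measurableSet_Ioo, intervalIntegral.integral_of_le (by linarith),
    integral_Ioc_eq_integral_Ioo]

lemma integral_sineMode_mul {L : ℝ} (hL : 0 < L) (xc : EuclideanSpace ℝ (Fin d))
    (k l : Fin d → ℕ) :
    ∫ x in openBox xc L, sineMode xc L k x * sineMode xc L l x =
      if k = l then (L / 2) ^ d else 0 := by
  simp only [sineMode, ← Finset.prod_mul_distrib]
  rw [integral_openBox_prod hL xc
    fun i t => sineFactor (xc i) L (k i) t * sineFactor (xc i) L (l i) t]
  simp only [integral_sineFactor_mul hL]
  split_ifs with h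
  · simp [h, div_pow]
  · obtain ⟨i, hi⟩ := Function.ne_iff.1 h
    exact Finset.prod_eq_zero (Finset.mem_univ i) (if_neg hi)

end Orthogonality

section Totality

variable {d : ℕ}

/-- The coordinate function `x ↦ cos(π(x_i - c_i + L/2)/L)` on a box. -/
noncomputable def boxCos (xc : EuclideanSpace ℝ (Fin d)) (L : ℝ) (i : Fin d)
    (x : EuclideanSpace ℝ (Fin d)) : ℝ :=
  Real.cos (Real.pi * (x i - xc i + L / 2) / L)

lemma continuous_boxCos (xc : EuclideanSpace ℝ (Fin d)) (L : ℝ) (i : Fin d) :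
    Continuous (boxCos xc L i) := by
  unfold boxCos
  fun_prop

lemma boxCos_mul_sineMode_mem_span (xc : EuclideanSpace ℝ (Fin d)) (L : ℝ) (i : Fin d)
    (k : Fin d → ℕ) :
    (fun x => boxCos xc L i x * sineMode xc L k x) ∈
      Submodule.span ℝ (range (sineMode xc L)) := by
  have hsplit : ∀ (l : Fin d → ℕ) (x : EuclideanSpace ℝ (Fin d)), sineMode xc L l x =
      sineFactor (xc i) L (l i) (x i) *
        ∏ j ∈ Finset.univ.erase i, sineFactor (xc j) L (l j) (x j) := fun l x =>
    (Finset.mul_prod_erase _ _ (Finset.mem_univ i)).symm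
  have hupd : ∀ (n : ℕ) (x : EuclideanSpace ℝ (Fin d)),
      sineMode xc L (Function.update k i n) x = sineFactor (xc i) L n (x i) *
        ∏ j ∈ Finset.univ.erase i, sineFactor (xc j) L (k j) (x j) := fun n x => by
    rw [hsplit, Function.update_self]
    congr 1
    exact Finset.prod_congr rfl fun j hj => by
      rw [Function.update_of_ne (Finset.ne_of_mem_erase hj)]
  have hmem : ∀ n, sineMode xc L (Function.update k i n) ∈
    Submodule.span ℝ (range (sineMode xc L)) := fun n => Submodule.subset_span ⟨_, rfl⟩
  rcases hk : k i with _ | n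
  · have : (fun x => boxCos xc L i x * sineMode xc L k x) =
        (1 / 2 : ℝ) • sineMode xc L (Function.update k i 1) := by
      funext x
      rw [Pi.smul_apply, hupd, hsplit, hk]
      simp only [boxCos, sineFactor, smul_eq_mul]
      push_cast
      rw [show ((1 : ℝ) + 1) * (Real.pi * (x i - xc i + L / 2) / L) =
        2 * (Real.pi * (x i - xc i + L / 2) / L) by ring, Real.sin_two_mul, zero_add, one_mul]
      ring
    rw [this]
    exact Submodule.smul_mem _ _ (hmem 1)
  · have : (fun x => boxCos xc L i x * sineMode xc L k x) =
        (1 / 2 : ℝ) • (sineMode xc L (Function.update k i (n + 2)) +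
          sineMode xc L (Function.update k i n)) := by
      funext x
      rw [Pi.smul_apply, Pi.add_apply, hupd, hupd, hsplit, hk]
      simp only [boxCos, sineFactor, smul_eq_mul]
      push_cast
      set θ := Real.pi * (x i - xc i + L / 2) / L
      rw [show ((n : ℝ) + 2 + 1) * θ = (n + 1 + 1) * θ + θ by ring,
        show ((n : ℝ) + 1) * θ = (n + 1 + 1) * θ - θ by ring, Real.sin_add, Real.sin_sub]
      ring
    rw [this]
    exact Submodule.smul_mem _ _ (Submodule.add_mem _ (hmem _) (hmem _))

lemma boxCos_mul_mem_span (xc : EuclideanSpace ℝ (Fin d)) (L : ℝ) (i : Fin d)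
    {u : EuclideanSpace ℝ (Fin d) → ℝ} (hu : u ∈ Submodule.span ℝ (range (sineMode xc L))) :
    (fun x => boxCos xc L i x * u x) ∈ Submodule.span ℝ (range (sineMode xc L)) := by
  induction hu using Submodule.span_induction with
  | mem u hu =>
    obtain ⟨k, rfl⟩ := hu
    exact boxCos_mul_sineMode_mem_span xc L i k
  | zero =>
    simp only [Pi.zero_apply, mul_zero]
    exact Submodule.zero_mem _
  | add u v _ _ hu hv =>
    convert Submodule.add_mem _ hu hv using 1
    funext x
    simp [mul_add]
  | smul a u _ hu =>
    convert Submodule.smul_mem _ a hu using 1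
    funext x
    simp [mul_left_comm]

/-- Multipliers of the span of the eigenfunctions. -/
def sineMultiplier (xc : EuclideanSpace ℝ (Fin d)) (L : ℝ) :
    Subalgebra ℝ C(closure (openBox xc L), ℝ) where
  carrier := {F | ∀ u ∈ Submodule.span ℝ (range (sineMode xc L)),
    ∃ v ∈ Submodule.span ℝ (range (sineMode xc L)),
      ∀ x : closure (openBox xc L), F x * u x = v x}
  mul_mem' {F G} hF hG u hu := by
    obtain ⟨v, hv, h1⟩ := hG u hu
    obtain ⟨v', hv', h2⟩ := hF v hv
    exact ⟨v', hv', fun x => by rw [ContinuousMap.mul_apply, mul_assoc, h1, h2]⟩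
  add_mem' {F G} hF hG u hu := by
    obtain ⟨v, hv, h1⟩ := hF u hu
    obtain ⟨v', hv', h2⟩ := hG u hu
    exact ⟨v + v', Submodule.add_mem _ hv hv', fun x => by
      rw [ContinuousMap.add_apply, add_mul, h1, h2, Pi.add_apply]⟩
  algebraMap_mem' r u hu := ⟨r • u, Submodule.smul_mem _ _ hu, fun x => by simp⟩

lemma sineMultiplier_separatesPoints {L : ℝ} (hL : 0 < L) (xc : EuclideanSpace ℝ (Fin d)) :
    (sineMultiplier xc L).SeparatesPoints := by
  intro x y hxy
  have hne : x.1 ≠ y.1 := fun h => hxy (Subtype.ext h)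
  obtain ⟨i, hi⟩ : ∃ i, x.1 i ≠ y.1 i := by
    by_contra h
    push Not at h
    exact hne (PiLp.ext h)
  refine ⟨fun z => boxCos xc L i z, ⟨⟨fun z => boxCos xc L i z,
    (continuous_boxCos xc L i).comp continuous_subtype_val⟩, fun u hu =>
      ⟨_, boxCos_mul_mem_span xc L i hu, fun _ => rfl⟩, rfl⟩, fun h => hi ?_⟩
  have hrange : ∀ z : closure (openBox xc L),
      Real.pi * (z.1 i - xc i + L / 2) / L ∈ Icc 0 Real.pi := fun z => by
    have h1 := abs_le.1 (abs_sub_le_of_mem_closure_openBox z.2 i)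
    have hπ := Real.pi_pos
    constructor
    · have : 0 ≤ z.1 i - xc i + L / 2 := by linarith [h1.1]
      positivity
    · rw [div_le_iff₀ hL]
      exact mul_le_mul_of_nonneg_left (by linarith [h1.2]) hπ.le
  have h2 := Real.injOn_cos (hrange x) (hrange y) h
  have hπ := Real.pi_pos
  field_simp at h2
  linarith

lemma ae_eq_zero_of_forall_integral_sineMode {L : ℝ} (hL : 0 < L)
    (xc : EuclideanSpace ℝ (Fin d)) {g : EuclideanSpace ℝ (Fin d) → ℝ}
    (hg : IntegrableOn g (openBox xc L))
    (h0 : ∀ k, ∫ x in openBox xc L, sineMode xc L k x * g x = 0) :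
    g =ᵐ[volume.restrict (openBox xc L)] 0 := by
  have hO := measurableSet_openBox xc L
  have : CompactSpace (closure (openBox xc L)) :=
    isCompact_iff_compactSpace.1 (isCompact_closure_openBox xc L)
  have hmul : ∀ {f : EuclideanSpace ℝ (Fin d) → ℝ}, Continuous f →
      IntegrableOn (fun x => f x * g x) (openBox xc L) := fun {f} hf => by
    obtain ⟨C, hC⟩ := (isCompact_closure_openBox xc L).exists_bound_of_continuousOn
      hf.continuousOn
    exact hg.bdd_mul hf.aestronglyMeasurable
      ((ae_restrict_iff' hO).2 (Eventually.of_forall fun x hx => hC x (subset_closure hx)))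
  have hspan : ∀ u ∈ Submodule.span ℝ (range (sineMode xc L)),
      Continuous u ∧ ∫ x in openBox xc L, u x * g x = 0 := by
    intro u hu
    induction hu using Submodule.span_induction with
    | mem u hu =>
      obtain ⟨k, rfl⟩ := hu
      exact ⟨(contDiff_sineMode (m := 0) xc L k).continuous, h0 k⟩
    | zero => exact ⟨continuous_const, by simp⟩
    | add u v _ _ hu hv =>
      refine ⟨hu.1.add hv.1, ?_⟩
      simp only [Pi.add_apply, add_mul]
      rw [integral_add (hmul hu.1) (hmul hv.1), hu.2, hv.2, add_zero]
    | smul a u _ hu =>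
      refine ⟨hu.1.const_smul a, ?_⟩
      simp only [Pi.smul_apply, smul_eq_mul, mul_assoc]
      rw [integral_const_mul, hu.2, mul_zero]
  have hwc : Continuous (sineMode xc L 0) := (contDiff_sineMode (m := 0) xc L 0).continuous
  have hwg := hmul hwc
  have key : ∀ F : EuclideanSpace ℝ (Fin d) → ℝ, Continuous F →
      ∫ x in openBox xc L, F x * (sineMode xc L 0 x * g x) = 0 := by
    intro F hF
    set M := ∫ x in openBox xc L, ‖sineMode xc L 0 x * g x‖
    have hM : 0 ≤ M := integral_nonneg fun x => norm_nonneg _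
    have hFi : IntegrableOn (fun x => F x * (sineMode xc L 0 x * g x)) (openBox xc L) := by
      simpa only [Pi.mul_apply, mul_assoc] using hmul (hF.mul hwc)
    refine norm_le_zero_iff.1 (le_of_forall_pos_le_add fun ε hε => ?_)
    rw [zero_add]
    obtain ⟨G, hG⟩ := ContinuousMap.exists_mem_subalgebra_near_continuous_of_separatesPoints
      (sineMultiplier xc L) (sineMultiplier_separatesPoints hL xc)
      (fun x => F x) (hF.comp continuous_subtype_val) (ε / (M + 1)) (by positivity)
    obtain ⟨v, hv, hGv⟩ := G.2 _ (Submodule.subset_span (mem_range_self (0 : Fin d → ℕ)))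
    have h1 := (hspan v hv).2
    have hvi := hmul (hspan v hv).1
    calc ‖∫ x in openBox xc L, F x * (sineMode xc L 0 x * g x)‖
        = ‖∫ x in openBox xc L, (F x * (sineMode xc L 0 x * g x) - v x * g x)‖ := by
          rw [integral_sub hFi hvi, h1, sub_zero]
      _ ≤ ∫ x in openBox xc L, ε / (M + 1) * ‖sineMode xc L 0 x * g x‖ := by
          refine norm_integral_le_of_norm_le (hwg.norm.const_mul _)
            ((ae_restrict_iff' hO).2 (Eventually.of_forall fun x hx => ?_))
          have h2 := hGv ⟨x, subset_closure hx⟩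
          have h3 := hG ⟨x, subset_closure hx⟩
          rw [norm_sub_rev] at h3
          simp only at h2
          rw [← h2, show F x * (sineMode xc L 0 x * g x) -
            G.1 ⟨x, subset_closure hx⟩ * sineMode xc L 0 x * g x =
            (F x - G.1 ⟨x, subset_closure hx⟩) * (sineMode xc L 0 x * g x) by ring, norm_mul]
          gcongr
      _ = ε * (M / (M + 1)) := by rw [integral_const_mul]; ring
      _ ≤ ε * 1 := by
          gcongr
          rw [div_le_one (by positivity)]
          linarith
      _ = ε := mul_one _
  have hae := ae_eq_zero_of_integral_contDiff_smul_eq_zero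
    (μ := volume) (f := (openBox xc L).indicator fun x => sineMode xc L 0 x * g x)
    ((integrable_indicator_iff hO).2 hwg).locallyIntegrable fun F hF _ => by
      rw [← key F hF.continuous, ← integral_indicator hO]
      refine integral_congr_ae (Eventually.of_forall fun x => ?_)
      by_cases hx : x ∈ openBox xc L <;> simp [hx]
  refine (ae_restrict_iff' hO).2 ?_
  filter_upwards [hae] with x hx hxO
  rw [indicator_of_mem hxO] at hx
  exact (mul_eq_zero.1 hx).resolve_left (sineMode_zero_pos hL hxO).ne'

end Totality

section Approximation

variable {d : ℕ}

lemma norm_toLp_sq {α : Type*} {m : MeasurableSpace α} {μ : Measure α} {f : α → ℝ}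
    (hf : MemLp f 2 μ) : ‖hf.toLp f‖ ^ 2 = ∫ x, f x ^ 2 ∂μ := by
  rw [← real_inner_self_eq_norm_sq, L2.inner_def]
  refine integral_congr_ae ?_
  filter_upwards [hf.coeFn_toLp] with x hx
  rw [hx, real_inner_self_eq_norm_sq, Real.norm_eq_abs, sq_abs]

lemma inner_toLp {α : Type*} {m : MeasurableSpace α} {μ : Measure α} {f g : α → ℝ}
    (hf : MemLp f 2 μ) (hg : MemLp g 2 μ) :
    inner ℝ (hf.toLp f) (hg.toLp g) = ∫ x, f x * g x ∂μ := by
  rw [L2.inner_def]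
  refine integral_congr_ae ?_
  filter_upwards [hf.coeFn_toLp, hg.coeFn_toLp] with x hx hy
  rw [hx, hy, real_inner_eq_re_inner, RCLike.inner_apply]
  simp [mul_comm]

lemma memLp_sum_smul {α ι : Type*} {m : MeasurableSpace α} {μ : Measure α} {e : ι → α → ℝ}
    (he : ∀ k, MemLp (e k) 2 μ) (F : Finset ι) (a : ι → ℝ) :
    MemLp (fun x => ∑ k ∈ F, a k * e k x) 2 μ :=
  memLp_finsetSum F fun k _ => (he k).const_mul (a k)

lemma toLp_sum_smul {α ι : Type*} {m : MeasurableSpace α} {μ : Measure α} {e : ι → α → ℝ}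
    (he : ∀ k, MemLp (e k) 2 μ) (F : Finset ι) (a : ι → ℝ) :
    (memLp_sum_smul he F a).toLp _ = ∑ k ∈ F, a k • (he k).toLp (e k) := by
  classical
  induction F using Finset.induction_on with
  | empty => simp only [Finset.sum_empty]; exact MemLp.toLp_zero _
  | insert k F hk ih =>
    rw [Finset.sum_insert hk, ← ih, ← MemLp.toLp_const_smul, ← MemLp.toLp_add]
    refine MemLp.toLp_congr _ _ (Eventually.of_forall fun x => ?_)
    simp [Finset.sum_insert hk]

/-- Partial sums of the expansion in a complete orthogonal system of `L²`. -/
lemma tendsto_integral_sq_partialSum {α ι : Type*} [DecidableEq ι] {m : MeasurableSpace α}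
    {μ : Measure α}
    {e : ι → α → ℝ} (he : ∀ k, MemLp (e k) 2 μ) {κ : ℝ} (hκ : 0 < κ)
    (hort : ∀ k l, ∫ x, e k x * e l x ∂μ = if k = l then κ else 0)
    (htot : ∀ g : α → ℝ, MemLp g 2 μ → (∀ k, ∫ x, e k x * g x ∂μ = 0) → g =ᵐ[μ] 0)
    {f : α → ℝ} (hf : MemLp f 2 μ) :
    Tendsto (fun F : Finset ι =>
      ∫ x, ((∑ k ∈ F, (κ⁻¹ * ∫ y, e k y * f y ∂μ) * e k x) - f x) ^ 2 ∂μ) atTop (𝓝 0) := by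
  set v : ι → Lp ℝ 2 μ := fun k => (√κ)⁻¹ • (he k).toLp (e k) with hv
  have hκs : (√κ)⁻¹ * (√κ)⁻¹ = κ⁻¹ := by
    rw [← mul_inv, Real.mul_self_sqrt hκ.le]
  have hon : Orthonormal ℝ v := by
    rw [orthonormal_iff_ite]
    intro i j
    simp only [hv]
    rw [real_inner_smul_left, real_inner_smul_right, inner_toLp, hort, ← mul_assoc, hκs]
    split_ifs
    · exact inv_mul_cancel₀ hκ.ne'
    · exact mul_zero _
  have hbot : (Submodule.span ℝ (range v))ᗮ = ⊥ := by
    rw [Submodule.eq_bot_iff]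
    intro g hg
    rw [Submodule.mem_orthogonal] at hg
    have hgm := Lp.memLp g
    have h1 : ∀ k, ∫ x, e k x * g x ∂μ = 0 := fun k => by
      have := hg (v k) (Submodule.subset_span ⟨k, rfl⟩)
      simp only [hv] at this
      rw [real_inner_smul_left, ← Lp.toLp_coeFn g hgm, inner_toLp] at this
      exact (mul_eq_zero.1 this).resolve_left (by positivity)
    have h2 := htot g hgm h1
    exact (Lp.eq_zero_iff_ae_eq_zero).2 h2
  set b := HilbertBasis.mkOfOrthogonalEqBot hon hbot with hb
  have hbv : ∀ k, b k = v k := fun k => by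
    rw [hb, HilbertBasis.coe_mkOfOrthogonalEqBot]
  have hs := b.hasSum_repr (hf.toLp f)
  have hterm : ∀ k, b.repr (hf.toLp f) k • b k =
      (κ⁻¹ * ∫ y, e k y * f y ∂μ) • (he k).toLp (e k) := fun k => by
    rw [HilbertBasis.repr_apply_apply, hbv]
    simp only [hv]
    rw [real_inner_smul_left, inner_toLp, smul_smul, ← hκs]
    congr 1
    ring
  simp only [hterm] at hs
  have ht : Tendsto (fun F : Finset ι => ‖∑ k ∈ F, (κ⁻¹ * ∫ y, e k y * f y ∂μ) •
      (he k).toLp (e k) - hf.toLp f‖ ^ 2) atTop (𝓝 0) := by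
    have := (tendsto_iff_norm_sub_tendsto_zero.1 hs).pow 2
    simpa using this
  refine ht.congr fun F => ?_
  rw [← toLp_sum_smul he, ← MemLp.toLp_sub, norm_toLp_sq]
  rfl

lemma lap_sum_sineMode (xc : EuclideanSpace ℝ (Fin d)) (L : ℝ) (F : Finset (Fin d → ℕ))
    (a : (Fin d → ℕ) → ℝ) (x : EuclideanSpace ℝ (Fin d)) :
    lap (fun x => ∑ k ∈ F, a k * sineMode xc L k x) x =
      ∑ k ∈ F, -sineEigenvalue L k * a k * sineMode xc L k x := by
  rw [lap_sum fun k => contDiff_const.mul (contDiff_sineMode xc L k)]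
  refine Finset.sum_congr rfl fun k _ => ?_
  rw [lap_const_mul _ (contDiff_sineMode xc L k).contDiffAt, lap_sineMode]
  ring

/-- A function in the domain of the Dirichlet Laplacian of a box is approximated, together with
its Laplacian, by linear combinations of eigenfunctions. -/
lemma exists_sineMode_approx {L : ℝ} (hL : 0 < L) (xc : EuclideanSpace ℝ (Fin d))
    {ψ : EuclideanSpace ℝ (Fin d) → ℝ} (hψ : ContinuousOn ψ (closure (openBox xc L)))
    (hψ2 : ContDiffOn ℝ 2 ψ (openBox xc L)) (hψ0 : ∀ x ∈ frontier (openBox xc L), ψ x = 0)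
    (hlap : MemLp (lap ψ) 2 (volume.restrict (openBox xc L))) {ε : ℝ} (hε : 0 < ε) :
    ∃ (F : Finset (Fin d → ℕ)) (a : (Fin d → ℕ) → ℝ),
      ∫ x in openBox xc L, ((∑ k ∈ F, a k * sineMode xc L k x) - ψ x) ^ 2 < ε ∧
      ∫ x in openBox xc L,
        (lap (fun x => ∑ k ∈ F, a k * sineMode xc L k x) x - lap ψ x) ^ 2 < ε := by
  have hO := measurableSet_openBox xc L
  have hKc := isCompact_closure_openBox xc L
  have hfin : IsFiniteMeasure (volume.restrict (openBox xc L)) :=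
    ⟨by simpa using volume_openBox_lt_top xc L⟩
  have hmem : ∀ {f : EuclideanSpace ℝ (Fin d) → ℝ}, ContinuousOn f (closure (openBox xc L)) →
      MemLp f 2 (volume.restrict (openBox xc L)) := fun hf => by
    obtain ⟨C, hC⟩ := hKc.exists_bound_of_continuousOn hf
    exact MemLp.of_bound ((hf.mono subset_closure).aestronglyMeasurable hO) C
      ((ae_restrict_iff' hO).2 (Eventually.of_forall fun x hx => hC x (subset_closure hx)))
  have he : ∀ k, MemLp (sineMode xc L k) 2 (volume.restrict (openBox xc L)) := fun k =>
    hmem (contDiff_sineMode (m := 0) xc L k).continuous.continuousOn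
  have htot : ∀ g : EuclideanSpace ℝ (Fin d) → ℝ, MemLp g 2 (volume.restrict (openBox xc L)) →
      (∀ k, ∫ x in openBox xc L, sineMode xc L k x * g x = 0) →
      g =ᵐ[volume.restrict (openBox xc L)] 0 := fun g hg h =>
    ae_eq_zero_of_forall_integral_sineMode hL xc (hg.integrable (by norm_num)) h
  have hκ : 0 < (L / 2) ^ d := by positivity
  have h1 := tendsto_integral_sq_partialSum he hκ (integral_sineMode_mul hL xc) htot (hmem hψ)
  have h2 := tendsto_integral_sq_partialSum he hκ (integral_sineMode_mul hL xc) htot hlap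
  have hcoef : ∀ k, ∫ x in openBox xc L, sineMode xc L k x * lap ψ x =
      -sineEigenvalue L k * ∫ x in openBox xc L, sineMode xc L k x * ψ x := fun k => by
    obtain ⟨p, hp, hkp⟩ := exists_sineMode_eq_mul xc L k
    have hfun : (fun y => sineMode xc L 0 y * p y) = sineMode xc L k :=
      funext fun y => (hkp y).symm
    have := integral_lap_mul_eq (isOpen_openBox xc L) hKc (contDiff_sineMode xc L 0) hp
      (fun x hx => sineMode_zero_pos hL hx) (fun x hx hx' => sineMode_eq_zero hL 0 hx hx')
      hψ hψ2 hψ0 (hlap.integrable (by norm_num))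
    simp only [← hkp] at this
    rw [← integral_const_mul]
    simp only [mul_comm (sineMode xc L k _) (lap ψ _)]
    rw [this]
    refine integral_congr_ae (Eventually.of_forall fun x => ?_)
    simp only [lap_sineMode]
    ring
  have h2' : Tendsto (fun F : Finset (Fin d → ℕ) => ∫ x in openBox xc L,
      (lap (fun x => ∑ k ∈ F, (((L / 2) ^ d)⁻¹ * ∫ y in openBox xc L, sineMode xc L k y * ψ y) *
        sineMode xc L k x) x - lap ψ x) ^ 2) atTop (𝓝 0) := by
    refine h2.congr fun F => integral_congr_ae (Eventually.of_forall fun x => ?_)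
    simp only [lap_sum_sineMode, hcoef]
    congr 2
    exact Finset.sum_congr rfl fun k _ => by ring
  obtain ⟨F, hF1, hF2⟩ :=
    (((tendsto_order.1 h1).2 ε hε).and ((tendsto_order.1 h2').2 ε hε)).exists
  exact ⟨F, _, hF1, hF2⟩

end Approximation

/-! ### Reflections of the box -/

section Reflection

variable {d : ℕ}

/-- The sign `(-1)^n`. -/
def reflectionSign (n : ℤ) : ℝ := if Even n then 1 else -1

lemma reflectionSign_sq (n : ℤ) : reflectionSign n ^ 2 = 1 := by
  unfold reflectionSign
  split_ifs <;> norm_num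

/-- The coordinatewise reflection with signs `(-1)^(m i)`. -/
noncomputable def reflectionIsometry (m : Fin d → ℤ) :
    EuclideanSpace ℝ (Fin d) ≃ₗᵢ[ℝ] EuclideanSpace ℝ (Fin d) :=
  LinearIsometryEquiv.piLpCongrRight 2 fun i =>
    if Even (m i) then LinearIsometryEquiv.refl ℝ ℝ else LinearIsometryEquiv.neg ℝ

lemma reflectionIsometry_apply (m : Fin d → ℤ) (x : EuclideanSpace ℝ (Fin d)) (i : Fin d) :
    reflectionIsometry m x i = reflectionSign (m i) * x i := by
  rw [reflectionIsometry, LinearIsometryEquiv.piLpCongrRight_apply]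
  by_cases h : Even (m i) <;> simp [h, reflectionSign]

/-- The composition of reflections in the faces of the box which moves it by `m`. -/
noncomputable def boxReflection (xc : EuclideanSpace ℝ (Fin d)) (L : ℝ) (m : Fin d → ℤ)
    (x : EuclideanSpace ℝ (Fin d)) : EuclideanSpace ℝ (Fin d) :=
  reflectionIsometry m (x - xc) + (xc + WithLp.toLp 2 fun i => (m i : ℝ) * L)

lemma boxReflection_apply (xc : EuclideanSpace ℝ (Fin d)) (L : ℝ) (m : Fin d → ℤ)
    (x : EuclideanSpace ℝ (Fin d)) (i : Fin d) :
    boxReflection xc L m x i = reflectionSign (m i) * (x i - xc i) + (xc i + m i * L) := by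
  simp [boxReflection, reflectionIsometry_apply, mul_sub]

lemma measurePreserving_boxReflection (xc : EuclideanSpace ℝ (Fin d)) (L : ℝ) (m : Fin d → ℤ) :
    MeasurePreserving (boxReflection xc L m) :=
  (measurePreserving_add_right volume _).comp
    ((reflectionIsometry m).measurePreserving.comp (measurePreserving_sub_right volume xc))

lemma measurableEmbedding_boxReflection (xc : EuclideanSpace ℝ (Fin d)) (L : ℝ)
    (m : Fin d → ℤ) : MeasurableEmbedding (boxReflection xc L m) :=
  (MeasurableEquiv.addRight _).measurableEmbedding.comp
    ((reflectionIsometry m).toHomeomorph.measurableEmbedding.comp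
      (MeasurableEquiv.subRight xc).measurableEmbedding)

lemma sineFactor_reflection {L : ℝ} (hL : 0 < L) (c : ℝ) (n : ℕ) (m : ℤ) (t : ℝ) :
    sineFactor c L n (reflectionSign m * (t - c) + (c + m * L)) =
      reflectionSign m * sineFactor c L n t := by
  unfold reflectionSign sineFactor
  split_ifs with h
  · obtain ⟨r, rfl⟩ := h
    rw [one_mul, one_mul,
      ← Real.sin_add_int_mul_two_pi ((n + 1) * (Real.pi * (t - c + L / 2) / L)) ((n + 1) * r)]
    congr 1
    push_cast
    field_simp
    ring
  · obtain ⟨r, rfl⟩ := Int.not_even_iff_odd.1 h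
    rw [neg_one_mul, neg_one_mul, ← Real.sin_neg,
      ← Real.sin_add_int_mul_two_pi (-((n + 1) * _)) ((n + 1) * (r + 1))]
    congr 1
    push_cast
    field_simp
    ring

lemma sineMode_boxReflection {L : ℝ} (hL : 0 < L) (xc : EuclideanSpace ℝ (Fin d))
    (k : Fin d → ℕ) (m : Fin d → ℤ) (x : EuclideanSpace ℝ (Fin d)) :
    sineMode xc L k (boxReflection xc L m x) =
      (∏ i, reflectionSign (m i)) * sineMode xc L k x := by
  simp only [sineMode, boxReflection_apply, sineFactor_reflection hL, Finset.prod_mul_distrib]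

lemma abs_sum_sineMode_boxReflection {L : ℝ} (hL : 0 < L) (xc : EuclideanSpace ℝ (Fin d))
    (F : Finset (Fin d → ℕ)) (a : (Fin d → ℕ) → ℝ) (m : Fin d → ℤ)
    (x : EuclideanSpace ℝ (Fin d)) :
    |∑ k ∈ F, a k * sineMode xc L k (boxReflection xc L m x)| =
      |∑ k ∈ F, a k * sineMode xc L k x| := by
  have h : |∏ i, reflectionSign (m i)| = 1 := by
    rw [← pow_eq_one_iff_of_nonneg (abs_nonneg _) two_ne_zero, sq_abs, ← Finset.prod_pow]
    exact Finset.prod_eq_one fun i _ => reflectionSign_sq _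
  simp only [sineMode_boxReflection hL]
  rw [← one_mul |∑ k ∈ F, a k * sineMode xc L k x|, ← h, ← abs_mul, Finset.mul_sum]
  congr 1
  exact Finset.sum_congr rfl fun k _ => by ring

lemma convex_openBox (xc : EuclideanSpace ℝ (Fin d)) (L : ℝ) : Convex ℝ (openBox xc L) := by
  have : openBox xc L = ⋂ i, (fun y : EuclideanSpace ℝ (Fin d) => y i) ⁻¹'
      Metric.ball (xc i) (L / 2) := by
    ext
    simp [openBox, Real.dist_eq]
  rw [this]
  exact convex_iInter fun i => (convex_ball _ _).linear_preimage (EuclideanSpace.projₗ i)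

lemma mem_closure_openBox {xc : EuclideanSpace ℝ (Fin d)} {L : ℝ} (hL : 0 < L)
    {x : EuclideanSpace ℝ (Fin d)} (hx : ∀ i, |x i - xc i| ≤ L / 2) :
    x ∈ closure (openBox xc L) := by
  have h : Tendsto (fun s : ℝ => xc + s • (x - xc)) (𝓝[<] 1) (𝓝 x) := by
    have : Tendsto (fun s : ℝ => xc + s • (x - xc)) (𝓝 1) (𝓝 (xc + (1 : ℝ) • (x - xc))) :=
      Continuous.tendsto (by fun_prop) 1
    simpa using this.mono_left nhdsWithin_le_nhds
  refine mem_closure_of_tendsto h ?_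
  filter_upwards [self_mem_nhdsWithin, mem_nhdsWithin_of_mem_nhds (lt_mem_nhds zero_lt_one)]
    with s hs hs0 i
  have hs1 : s < 1 := hs
  rw [show (xc + s • (x - xc)) i - xc i = s * (x i - xc i) by simp, abs_mul, abs_of_pos hs0]
  calc s * |x i - xc i| ≤ s * (L / 2) := by gcongr; exact hx i
    _ < 1 * (L / 2) := by gcongr
    _ = L / 2 := one_mul _

lemma exists_boxReflection_mem {L : ℝ} (hL : 0 < L) (xc x : EuclideanSpace ℝ (Fin d)) {n : ℕ}
    (hx : ∀ i, |x i - xc i| ≤ n * L) :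
    ∃ m ∈ Fintype.piFinset fun _ : Fin d => Finset.Icc (-((n : ℤ) + 1)) (n + 1),
      boxReflection xc L m x ∈ closure (openBox xc L) := by
  set r : Fin d → ℤ := fun i => round ((x i - xc i) / L)
  have hr : ∀ i, |(x i - xc i) - r i * L| ≤ L / 2 := fun i => by
    have h := abs_sub_round ((x i - xc i) / L)
    rw [show (x i - xc i) - r i * L = ((x i - xc i) / L - r i) * L by field_simp, abs_mul,
      abs_of_pos hL]
    calc _ ≤ 1 / 2 * L := by gcongr
      _ = L / 2 := by ring
  have hrn : ∀ i, |r i| ≤ n + 1 := fun i => by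
    have h1 : |(r i : ℝ)| * L ≤ (n + 1) * L := by
      rw [← abs_of_pos hL, ← abs_mul, abs_of_pos hL]
      have h2 := abs_sub_abs_le_abs_sub ((r i : ℝ) * L) (x i - xc i)
      rw [abs_sub_comm ((r i : ℝ) * L)] at h2
      linarith [hr i, hx i]
    have h3 := le_of_mul_le_mul_right h1 hL
    exact_mod_cast h3
  refine ⟨fun i => if Even (r i) then -r i else r i, ?_, mem_closure_openBox hL fun i => ?_⟩
  · rw [Fintype.mem_piFinset]
    intro i
    rw [Finset.mem_Icc, ← abs_le]
    split_ifs
    · rw [abs_neg]; exact hrn i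
    · exact hrn i
  · rw [boxReflection_apply]
    by_cases h : Even (r i)
    · simp only [h, if_true, reflectionSign, even_neg]
      push_cast
      convert hr i using 2
      ring
    · simp only [h, if_false, reflectionSign]
      rw [← abs_neg]
      convert hr i using 2
      ring

/-- The integral of a reflection-invariant function over a large cube is controlled by its
integral over the box. -/
lemma setIntegral_le_of_invariant {L : ℝ} (hL : 0 < L) (xc : EuclideanSpace ℝ (Fin d)) {n : ℕ}
    {B : Set (EuclideanSpace ℝ (Fin d))} (hB : MeasurableSet B)
    (hBn : ∀ x ∈ B, ∀ i, |x i - xc i| ≤ n * L)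
    {f : EuclideanSpace ℝ (Fin d) → ℝ} (hf : Continuous f) (hf0 : ∀ x, 0 ≤ f x)
    (hinv : ∀ m x, f (boxReflection xc L m x) = f x) :
    ∫ x in B, f x ≤ (2 * n + 3) ^ d * ∫ x in openBox xc L, f x := by
  set S := closure (openBox xc L)
  set M := Fintype.piFinset fun _ : Fin d => Finset.Icc (-((n : ℤ) + 1)) (n + 1) with hM
  have hcard : (M.card : ℝ) = (2 * n + 3) ^ d := by
    rw [hM, Fintype.card_piFinset]
    simp only [Int.card_Icc, Finset.prod_const, Finset.card_univ, Fintype.card_fin]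
    rw [show ((n : ℤ) + 1 + 1 - -((n : ℤ) + 1)).toNat = 2 * n + 3 by omega]
    push_cast
    ring
  have hS : MeasurableSet S := isClosed_closure.measurableSet
  have hfS : IntegrableOn f S :=
    hf.continuousOn.integrableOn_compact (isCompact_closure_openBox xc L)
  have hpre : ∀ m, MeasurableSet (boxReflection xc L m ⁻¹' S) := fun m =>
    (measurableEmbedding_boxReflection xc L m).measurable hS
  have hcomp : ∀ m, f ∘ boxReflection xc L m = f := fun m => funext fun x => hinv m x
  have hi : ∀ m, IntegrableOn f (boxReflection xc L m ⁻¹' S) := fun m => by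
    have := ((measurePreserving_boxReflection xc L m).integrableOn_comp_preimage
      (measurableEmbedding_boxReflection xc L m) (f := f) (s := S)).2 hfS
    rwa [hcomp] at this
  have hint : ∀ m, ∫ x in boxReflection xc L m ⁻¹' S, f x = ∫ x in openBox xc L, f x :=
    fun m => by
    have h1 := (measurePreserving_boxReflection xc L m).setIntegral_preimage_emb
      (measurableEmbedding_boxReflection xc L m) f S
    simp only [hinv] at h1
    rw [h1]
    refine setIntegral_congr_set ?_
    refine (ae_eq_of_subset_of_measure_ge subset_closure ?_ (measurableSet_openBox xc L).nullMeasurableSet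
      (isCompact_closure_openBox xc L).measure_lt_top.ne).symm
    have h2 : S ⊆ openBox xc L ∪ frontier (openBox xc L) := by
      rw [← closure_eq_self_union_frontier]
    refine (measure_mono h2).trans ((measure_union_le _ _).trans ?_)
    rw [(convex_openBox xc L).addHaar_frontier volume, add_zero]
  rw [← integral_indicator hB]
  calc ∫ x, B.indicator f x
      ≤ ∫ x, ∑ m ∈ M, (boxReflection xc L m ⁻¹' S).indicator f x := by
        refine integral_mono_of_nonneg (Eventually.of_forall fun x =>
          indicator_nonneg (fun x _ => hf0 x) x)
          (integrable_finsetSum _ fun m _ => (integrable_indicator_iff (hpre m)).2 (hi m))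
          (Eventually.of_forall fun x => ?_)
        have hnn : ∀ m ∈ M, 0 ≤ (boxReflection xc L m ⁻¹' S).indicator f x := fun m _ =>
          indicator_nonneg (fun x _ => hf0 x) x
        by_cases hx : x ∈ B
        · obtain ⟨m, hm, hmS⟩ := exists_boxReflection_mem hL xc x (hBn x hx)
          refine le_trans ?_ (Finset.single_le_sum hnn hm)
          rw [indicator_of_mem hx, indicator_of_mem (by exact hmS)]
        · rw [indicator_of_notMem hx]
          exact Finset.sum_nonneg hnn
    _ = ∑ m ∈ M, ∫ x in openBox xc L, f x := by
        rw [integral_finsetSum _ fun m _ => (integrable_indicator_iff (hpre m)).2 (hi m)]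
        exact Finset.sum_congr rfl fun m _ => by rw [integral_indicator (hpre m), hint]
    _ = (2 * n + 3) ^ d * ∫ x in openBox xc L, f x := by
        rw [Finset.sum_const, nsmul_eq_mul, hcard]

end Reflection

/-! ### Three-region inequality in a box -/

section Box

variable {d : ℕ}

lemma memLp_of_continuousOn_closure_openBox {xc : EuclideanSpace ℝ (Fin d)} {L : ℝ}
    {f : EuclideanSpace ℝ (Fin d) → ℝ} (hf : ContinuousOn f (closure (openBox xc L))) :
    MemLp f 2 (volume.restrict (openBox xc L)) := by
  have hO := measurableSet_openBox xc L
  have hfin : IsFiniteMeasure (volume.restrict (openBox xc L)) :=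
    ⟨by simpa using volume_openBox_lt_top xc L⟩
  obtain ⟨C, hC⟩ := (isCompact_closure_openBox xc L).exists_bound_of_continuousOn hf
  exact MemLp.of_bound ((hf.mono subset_closure).aestronglyMeasurable hO) C
    ((ae_restrict_iff' hO).2 (Eventually.of_forall fun x hx => hC x (subset_closure hx)))

lemma aestronglyMeasurable_lap {xc : EuclideanSpace ℝ (Fin d)} {L : ℝ}
    {ψ : EuclideanSpace ℝ (Fin d) → ℝ} (hψ2 : ContDiffOn ℝ 2 ψ (openBox xc L)) :
    AEStronglyMeasurable (lap ψ) (volume.restrict (openBox xc L)) :=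
  ContinuousOn.aestronglyMeasurable (fun _ hx => ((hψ2.contDiffAt
    ((isOpen_openBox xc L).mem_nhds hx)).continuousAt_lap).continuousWithinAt)
    (measurableSet_openBox xc L)

lemma memLp_lap {xc : EuclideanSpace ℝ (Fin d)} {L : ℝ} {V ψ : EuclideanSpace ℝ (Fin d) → ℝ}
    {K : ℝ} (hV : Measurable V) (hVK : ∀ x ∈ openBox xc L, |V x| ≤ K)
    (hψ : ContinuousOn ψ (closure (openBox xc L))) (hψ2 : ContDiffOn ℝ 2 ψ (openBox xc L))
    (hζ : IntegrableOn (fun x => (-(lap ψ x) + V x * ψ x) ^ 2) (openBox xc L)) :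
    MemLp (lap ψ) 2 (volume.restrict (openBox xc L)) := by
  have hO := measurableSet_openBox xc L
  have h1 := memLp_of_continuousOn_closure_openBox hψ
  have hVψm : AEStronglyMeasurable (fun x => V x * ψ x) (volume.restrict (openBox xc L)) :=
    hV.aestronglyMeasurable.mul h1.1
  have hVψ : MemLp (fun x => V x * ψ x) 2 (volume.restrict (openBox xc L)) := by
    refine (h1.const_mul K).of_le hVψm ((ae_restrict_iff' hO).2 (Eventually.of_forall
      fun x hx => ?_))
    rw [norm_mul, norm_mul]
    gcongr
    exact (hVK x hx).trans (le_abs_self K)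
  have hζ' : MemLp (fun x => -(lap ψ x) + V x * ψ x) 2 (volume.restrict (openBox xc L)) :=
    (memLp_two_iff_integrable_sq ((aestronglyMeasurable_lap hψ2).neg.add hVψm)).2 hζ
  refine (hVψ.sub hζ').ae_eq (Eventually.of_forall fun x => ?_)
  simp

set_option maxHeartbeats 1000000 in
lemma box_three_region_inequality (d : ℕ) : ∃ C : ℝ, 1 ≤ C ∧
    ∀ (xc : EuclideanSpace ℝ (Fin d)) (L : ℝ), 0 < L →
    ∀ (V : EuclideanSpace ℝ (Fin d) → ℝ) (K : ℝ), Measurable V →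
      (∀ x ∈ openBox xc L, |V x| ≤ K) →
    ∀ ψ : EuclideanSpace ℝ (Fin d) → ℝ, ContinuousOn ψ (closure (openBox xc L)) →
      ContDiffOn ℝ 2 ψ (openBox xc L) → (∀ x ∈ frontier (openBox xc L), ψ x = 0) →
      IntegrableOn (fun x => (-(lap ψ x) + V x * ψ x) ^ 2) (openBox xc L) →
    ∀ (Θ : Set (EuclideanSpace ℝ (Fin d))) (x₀ : EuclideanSpace ℝ (Fin d)) (Q δ α : ℝ),
      Θ ⊆ openBox xc L → MeasurableSet Θ → x₀ ∈ openBox xc L → 1 ≤ Q → Q ≤ d * L → 0 < δ →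
      δ ≤ 1 → Metric.ball x₀ δ ⊆ openBox xc L → 1 ≤ α → 1024 * K ^ 2 * Q ^ 4 ≤ α ^ 3 →
      (∀ x ∈ Θ, δ ≤ ‖x - x₀‖) → (∀ x ∈ Θ, ‖x - x₀‖ ≤ Q) →
      ∫ x in Θ, ψ x ^ 2 ≤ C * Q ^ 4 *
        (Real.exp (α * (1 / 2 + 2 * Real.log (4 * Q / δ))) / δ ^ 4 *
          ((∫ x in Metric.ball x₀ δ, ψ x ^ 2) +
            ∫ x in openBox xc L, (-(lap ψ x) + V x * ψ x) ^ 2) +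
        Real.exp (-(α * Real.log 2)) * ((∫ x in openBox xc L, ψ x ^ 2) +
            ∫ x in openBox xc L, (-(lap ψ x) + V x * ψ x) ^ 2)) := by
  obtain ⟨C, hC1, hC⟩ := three_region_inequality_at d
  set N : ℝ := (2 * ((8 * d + 1 : ℕ) : ℝ) + 3) ^ d with hN
  have hN1 : 1 ≤ N := one_le_pow₀ (by
    have : (0 : ℝ) ≤ ((8 * d + 1 : ℕ) : ℝ) := Nat.cast_nonneg _
    linarith)
  refine ⟨6 * C * N, by nlinarith, ?_⟩
  intro xc L hL V K hV hVK ψ hψ hψ2 hψ0 hζ Θ x₀ Q δ α hΘO hΘ hx₀ hQ hQL hδ hδ1 hball hα hαK hδΘ hQΘ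
  have hK : 0 ≤ K := (abs_nonneg _).trans (hVK x₀ hx₀)
  have hO := measurableSet_openBox xc L
  have hlap := memLp_lap hV hVK hψ hψ2 hζ
  have hψL := memLp_of_continuousOn_closure_openBox hψ
  have hψi : IntegrableOn (fun x => ψ x ^ 2) (openBox xc L) := hψL.integrable_sq
  set E := Real.exp (α * (1 / 2 + 2 * Real.log (4 * Q / δ))) / δ ^ 4
  set E' := Real.exp (-(α * Real.log 2))
  have hE : 0 < E := by positivity
  have hE' : 0 < E' := Real.exp_pos _
  set I := ∫ x in Metric.ball x₀ δ, ψ x ^ 2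
  set P := ∫ x in openBox xc L, ψ x ^ 2
  set Z := ∫ x in openBox xc L, (-(lap ψ x) + V x * ψ x) ^ 2
  have hI : 0 ≤ I := integral_nonneg fun x => sq_nonneg _
  have hP : 0 ≤ P := integral_nonneg fun x => sq_nonneg _
  have hZ : 0 ≤ Z := integral_nonneg fun x => sq_nonneg _
  have hQ0 : 0 < Q := by linarith
  set R := 2 + 2 * (C * Q ^ 4 * (E * (2 + N * (3 * (K ^ 2 + 1))) +
    E' * (N * 2 + N * (3 * (K ^ 2 + 1))))) with hR
  have hR0 : 0 < R := by positivity
  refine le_of_forall_pos_le_add fun η hη => ?_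
  obtain ⟨F, a, hu1, hu2⟩ := exists_sineMode_approx hL xc hψ hψ2 hψ0 hlap
    (ε := η / R) (by positivity)
  set ε := η / R with hε
  have hε0 : 0 < ε := by positivity
  have hεR : R * ε = η := by rw [hε]; field_simp
  set u : EuclideanSpace ℝ (Fin d) → ℝ := fun x => ∑ k ∈ F, a k * sineMode xc L k x with hu
  have huC : ContDiff ℝ 2 u :=
    ContDiff.sum fun k _ => contDiff_const.mul (contDiff_sineMode xc L k)
  have hlu : ∀ x, lap u x = ∑ k ∈ F, -sineEigenvalue L k * a k * sineMode xc L k x :=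
    lap_sum_sineMode xc L F a
  have hlc := huC.continuous_lap
  have huc := huC.continuous
  set G : EuclideanSpace ℝ (Fin d) → ℝ := fun x => max (|lap u x| - K * |u x|) 0 with hG
  have hGc : Continuous G := by
    simp only [hG]
    fun_prop
  have huinv : ∀ m x, |u (boxReflection xc L m x)| = |u x| := fun m x =>
    abs_sum_sineMode_boxReflection hL xc F a m x
  have hlinv : ∀ m x, |lap u (boxReflection xc L m x)| = |lap u x| := fun m x => by
    rw [hlu, hlu]
    exact abs_sum_sineMode_boxReflection hL xc F (fun k => -sineEigenvalue L k * a k) m x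
  have key := hC u G x₀ K Q δ α Θ huC hGc hK hQ hδ hδ1 hα hαK
    (fun x => by
      have := le_max_left (|lap u x| - K * |u x|) 0
      simp only [hG]
      linarith) hΘ hδΘ hQΘ
  have hBn : ∀ x ∈ Metric.ball x₀ (8 * Q), ∀ i, |x i - xc i| ≤ (8 * d + 1 : ℕ) * L := by
    intro x hx i
    rw [Metric.mem_ball, dist_eq_norm] at hx
    have h1 : |x i - x₀ i| ≤ ‖x - x₀‖ := by
      simpa using PiLp.norm_apply_le (x - x₀) i
    have h2 := hx₀ i
    have h3 := abs_add_le (x i - x₀ i) (x₀ i - xc i)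
    rw [sub_add_sub_cancel] at h3
    push_cast
    linarith
  have hGB := setIntegral_le_of_invariant hL xc (n := 8 * d + 1) (f := fun x => G x ^ 2)
    measurableSet_ball hBn (hGc.pow 2) (fun x => sq_nonneg _) fun m x => by
      simp only [hG, huinv, hlinv]
  have huB := setIntegral_le_of_invariant hL xc (n := 8 * d + 1) (f := fun x => u x ^ 2)
    measurableSet_ball hBn (huc.pow 2) (fun x => sq_nonneg _) fun m x => by
      rw [← sq_abs, huinv, sq_abs]
  have huL := memLp_of_continuousOn_closure_openBox (xc := xc) (L := L) huc.continuousOn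
  have hlL := memLp_of_continuousOn_closure_openBox (xc := xc) (L := L) hlc.continuousOn
  have hdi : IntegrableOn (fun x => (u x - ψ x) ^ 2) (openBox xc L) :=
    (huL.sub hψL).integrable_sq
  have hldi : IntegrableOn (fun x => (lap u x - lap ψ x) ^ 2) (openBox xc L) :=
    (hlL.sub hlap).integrable_sq
  have hui : IntegrableOn (fun x => u x ^ 2) (openBox xc L) := huL.integrable_sq
  have hcmp : ∀ (A : Set (EuclideanSpace ℝ (Fin d))), A ⊆ openBox xc L →
      ∀ f g : EuclideanSpace ℝ (Fin d) → ℝ,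
      IntegrableOn (fun x => g x ^ 2) (openBox xc L) →
      IntegrableOn (fun x => (f x - g x) ^ 2) (openBox xc L) →
      ∫ x in openBox xc L, (f x - g x) ^ 2 ≤ ε →
      ∫ x in A, f x ^ 2 ≤ 2 * (∫ x in A, g x ^ 2) + 2 * ε := by
    intro A hA f g hg hfg hle
    have h1 : ∫ x in A, (f x - g x) ^ 2 ≤ ε :=
      (setIntegral_mono_set hfg (Eventually.of_forall fun x => sq_nonneg _)
        hA.eventuallyLE).trans hle
    have hg' := hg.mono_set hA
    have hfg' := hfg.mono_set hA
    calc ∫ x in A, f x ^ 2 ≤ ∫ x in A, (2 * g x ^ 2 + 2 * (f x - g x) ^ 2) := by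
          refine integral_mono_of_nonneg (Eventually.of_forall fun x => sq_nonneg _)
            ((hg'.const_mul 2).add (hfg'.const_mul 2)) (Eventually.of_forall fun x => ?_)
          simp only
          nlinarith [sq_nonneg (f x - 2 * g x)]
      _ = 2 * (∫ x in A, g x ^ 2) + 2 * ∫ x in A, (f x - g x) ^ 2 := by
          rw [integral_add (hg'.const_mul 2) (hfg'.const_mul 2), integral_const_mul,
            integral_const_mul]
      _ ≤ _ := by linarith
  have hsymm : ∀ x, (ψ x - u x) ^ 2 = (u x - ψ x) ^ 2 := fun x => by ring
  have b1 : ∫ x in Θ, ψ x ^ 2 ≤ 2 * (∫ x in Θ, u x ^ 2) + 2 * ε :=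
    hcmp Θ hΘO ψ u hui (by simpa only [hsymm] using hdi) (by simpa only [hsymm] using hu1.le)
  have b2 : ∫ x in Metric.ball x₀ δ, u x ^ 2 ≤ 2 * I + 2 * ε := hcmp _ hball u ψ hψi hdi hu1.le
  have b3 : ∫ x in openBox xc L, u x ^ 2 ≤ 2 * P + 2 * ε :=
    hcmp _ subset_rfl u ψ hψi hdi hu1.le
  have hab : Integrable (fun x => 3 * (lap u x - lap ψ x) ^ 2 +
      3 * (-(lap ψ x) + V x * ψ x) ^ 2) (volume.restrict (openBox xc L)) :=
    (hldi.const_mul 3).add (hζ.const_mul 3)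
  have b4 : ∫ x in openBox xc L, G x ^ 2 ≤ 3 * Z + 3 * (K ^ 2 + 1) * ε := by
    calc ∫ x in openBox xc L, G x ^ 2
        ≤ ∫ x in openBox xc L, (3 * (lap u x - lap ψ x) ^ 2 +
            3 * (-(lap ψ x) + V x * ψ x) ^ 2 + 3 * K ^ 2 * (u x - ψ x) ^ 2) := by
          refine integral_mono_of_nonneg (Eventually.of_forall fun x => sq_nonneg _)
            (hab.add (hdi.const_mul (3 * K ^ 2)))
            ((ae_restrict_iff' hO).2 (Eventually.of_forall fun x hx => ?_))
          have h0 : |V x * u x| ≤ K * |u x| := by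
            rw [abs_mul]
            exact mul_le_mul_of_nonneg_right (hVK x hx) (abs_nonneg _)
          have h1 : G x ≤ |lap u x - V x * u x| := by
            refine max_le ?_ (abs_nonneg _)
            have := abs_sub_abs_le_abs_sub (lap u x) (V x * u x)
            linarith
          have h2 : G x ^ 2 ≤ (lap u x - V x * u x) ^ 2 := by
            rw [← sq_abs (lap u x - V x * u x)]
            exact pow_le_pow_left₀ (le_max_right _ _) h1 2
          have h3 : (V x) ^ 2 ≤ K ^ 2 := sq_le_sq' (abs_le.1 (hVK x hx)).1 (abs_le.1 (hVK x hx)).2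
          have h4 : (V x * (u x - ψ x)) ^ 2 ≤ K ^ 2 * (u x - ψ x) ^ 2 := by
            rw [mul_pow]
            gcongr
          simp only
          set p := lap u x - lap ψ x
          set q := -(lap ψ x) + V x * ψ x
          set r := V x * (u x - ψ x)
          have h5 : lap u x - V x * u x = p - q - r := by simp only [p, q, r]; ring
          rw [h5] at h2
          nlinarith [sq_nonneg (p + q), sq_nonneg (p + r), sq_nonneg (q - r)]
      _ = 3 * (∫ x in openBox xc L, (lap u x - lap ψ x) ^ 2) + 3 * Z +
            3 * K ^ 2 * ∫ x in openBox xc L, (u x - ψ x) ^ 2 := by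
          rw [integral_add hab (hdi.const_mul (3 * K ^ 2)),
            integral_add (hldi.const_mul 3) (hζ.const_mul 3), integral_const_mul,
            integral_const_mul, integral_const_mul]
      _ ≤ _ := by
          have := mul_le_mul_of_nonneg_left hu1.le (by positivity : 0 ≤ 3 * K ^ 2)
          linarith
  set J := ∫ x in Metric.ball x₀ (8 * Q), G x ^ 2
  set U := ∫ x in Metric.ball x₀ (8 * Q), u x ^ 2
  have hJ : J ≤ N * (3 * Z + 3 * (K ^ 2 + 1) * ε) := hGB.trans (by gcongr)
  have hU : U ≤ N * (2 * P + 2 * ε) := huB.trans (by gcongr)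
  have hNI : I ≤ N * I := le_mul_of_one_le_left hI hN1
  calc ∫ x in Θ, ψ x ^ 2 ≤ 2 * (∫ x in Θ, u x ^ 2) + 2 * ε := b1
    _ ≤ 2 * (C * Q ^ 4 * (E * ((∫ x in Metric.ball x₀ δ, u x ^ 2) + J) + E' * (U + J))) +
          2 * ε := by
        gcongr
    _ ≤ 2 * (C * Q ^ 4 * (E * ((2 * I + 2 * ε) + N * (3 * Z + 3 * (K ^ 2 + 1) * ε)) +
          E' * (N * (2 * P + 2 * ε) + N * (3 * Z + 3 * (K ^ 2 + 1) * ε)))) + 2 * ε := by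
        gcongr
    _ = 2 * (C * Q ^ 4 * (E * (2 * I + N * (3 * Z)) + E' * (N * (2 * P) + N * (3 * Z)))) +
          R * ε := by
        rw [hR]
        ring
    _ ≤ 2 * (C * Q ^ 4 * (E * (3 * (N * I) + N * (3 * Z)) + E' * (N * (3 * P) + N * (3 * Z)))) +
          R * ε := by
        gcongr
        · linarith
        · norm_num
    _ = 6 * C * N * Q ^ 4 * (E * (I + Z) + E' * (P + Z)) + η := by
        rw [hεR]
        ring

end Box

section Optimization

lemma rpow_le_exponent {K Q l S : ℝ} (hK : 0 ≤ K) (hQ : 1 ≤ Q) (hl : 0 ≤ l)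
    (hS : S = (1 + K ^ ((2 : ℝ) / 3)) * (Q ^ ((4 : ℝ) / 3) + l)) :
    1 ≤ S ∧ Real.log Q ≤ S - l ∧ K ^ 2 * Q ^ 4 ≤ S ^ 3 := by
  have hQ0 : 0 ≤ Q := by linarith
  set k := K ^ ((2 : ℝ) / 3) with hk
  set q := Q ^ ((4 : ℝ) / 3) with hq
  have hk0 : 0 ≤ k := Real.rpow_nonneg hK _
  have hq1 : Q ≤ q := by
    simpa using Real.rpow_le_rpow_of_exponent_le hQ (by norm_num : (1 : ℝ) ≤ 4 / 3)
  have hk3 : k ^ 3 = K ^ 2 := by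
    rw [hk, ← Real.rpow_natCast, ← Real.rpow_mul hK]
    norm_num
  have hq3 : q ^ 3 = Q ^ 4 := by
    rw [hq, ← Real.rpow_natCast, ← Real.rpow_mul hQ0]
    norm_num
  have hkql : 0 ≤ k * (q + l) := by
    have : 0 ≤ q := by linarith
    positivity
  have hSe : S = q + l + k * (q + l) := by rw [hS]; ring
  refine ⟨by linarith, ?_, ?_⟩
  · have := Real.log_le_sub_one_of_pos (by linarith : 0 < Q)
    linarith
  · rw [← hk3, ← hq3, ← mul_pow]
    refine pow_le_pow_left₀ (by nlinarith) ?_ 3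
    nlinarith

set_option maxHeartbeats 1000000 in
/-- Optimizing the free parameter `α` of a three-region inequality. -/
lemma exists_exponent_of_three_region_inequality {C : ℝ} (hC : 1 ≤ C) : ∃ m > (0 : ℝ),
    ∀ K Q δ T P I Z : ℝ, 0 ≤ K → 1 ≤ Q → 0 < δ → δ ≤ 1 / 24 → 0 < T → T ≤ P → 0 ≤ I → 0 ≤ Z →
      (∀ α : ℝ, 1 ≤ α → 1024 * K ^ 2 * Q ^ 4 ≤ α ^ 3 →
        T ≤ C * Q ^ 4 * (Real.exp (α * (1 / 2 + 2 * Real.log (4 * Q / δ))) / δ ^ 4 * (I + Z) +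
          Real.exp (-(α * Real.log 2)) * (P + Z))) →
      (δ / Q) ^ (m * (1 + K ^ ((2 : ℝ) / 3)) * (Q ^ ((4 : ℝ) / 3) +
        Real.log (Real.sqrt P / Real.sqrt T))) * T ≤ I + δ ^ 2 * Z := by
  set c := 2 * (4 + Real.log (2 * C)) + 11 with hc
  have hlC : 0 ≤ Real.log (2 * C) := Real.log_nonneg (by linarith)
  have hlC4 : 0 ≤ Real.log (4 * C) := Real.log_nonneg (by linarith)
  have hc11 : 11 ≤ c := by linarith
  have hl2 : (1 : ℝ) / 2 < Real.log 2 := by linarith [Real.log_two_gt_d9]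
  have hl4 : Real.log 4 < 7 / 5 := by
    rw [show (4 : ℝ) = 2 ^ 2 by norm_num, Real.log_pow]
    push_cast
    linarith [Real.log_two_lt_d9]
  refine ⟨5 * c + 6 + Real.log (4 * C), by linarith, ?_⟩
  intro K Q δ T P I Z hK hQ hδ hδ24 hT hTP hI hZ h
  have hQ0 : 0 < Q := by linarith
  have hP : 0 < P := hT.trans_le hTP
  set l := Real.log (Real.sqrt P / Real.sqrt T) with hl
  have hll : 2 * l = Real.log P - Real.log T := by
    rw [hl, Real.log_div (Real.sqrt_pos.2 hP).ne' (Real.sqrt_pos.2 hT).ne', Real.log_sqrt hP.le,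
      Real.log_sqrt hT.le]
    ring
  have hl0 : 0 ≤ l := by
    have := Real.log_le_log hT hTP
    linarith
  obtain ⟨S, hS⟩ : ∃ S, S = (1 + K ^ ((2 : ℝ) / 3)) * (Q ^ ((4 : ℝ) / 3) + l) := ⟨_, rfl⟩
  obtain ⟨hS1, hSQ, hS3⟩ := rpow_le_exponent hK hQ hl0 hS
  have hlQ : 0 ≤ Real.log Q := Real.log_nonneg hQ
  set y := Real.log (Q / δ) with hy
  have hy2 : 2 ≤ y := by
    rw [hy, Real.le_log_iff_exp_le (by positivity), le_div_iff₀ hδ]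
    have h1 : Real.exp 2 ≤ 24 := by
      rw [show (2 : ℝ) = 1 + 1 by norm_num, Real.exp_add]
      nlinarith [Real.exp_one_lt_d9, Real.exp_pos 1]
    calc Real.exp 2 * δ ≤ 24 * (1 / 24) := by gcongr
      _ ≤ Q := by linarith
  have hyd : Real.log δ = Real.log Q - y := by
    rw [hy, Real.log_div hQ0.ne' hδ.ne']
    ring
  have hkey := h (c * S) (by nlinarith) (by
    rw [mul_pow]
    have h1 : (11 : ℝ) ^ 3 ≤ c ^ 3 := pow_le_pow_left₀ (by norm_num) hc11 3
    have h2 : 0 ≤ K ^ 2 * Q ^ 4 := by positivity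
    nlinarith)
  set E := Real.exp (c * S * (1 / 2 + 2 * Real.log (4 * Q / δ))) with hE
  have hlog4 : Real.log (4 * Q / δ) = Real.log 4 + y := by
    rw [mul_div_assoc, Real.log_mul (by norm_num) (by positivity)]
  have hcS : 0 ≤ c * S := by nlinarith
  have htail : C * Q ^ 4 * (Real.exp (-(c * S * Real.log 2)) * P) ≤ T / 2 := by
    have h1 : Real.log (2 * C) + 4 * Real.log Q + 2 * l ≤ c * S * Real.log 2 := by
      have h2 : c * S * (1 / 2) ≤ c * S * Real.log 2 := mul_le_mul_of_nonneg_left hl2.le hcS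
      have h3 : Real.log (2 * C) ≤ Real.log (2 * C) * S := le_mul_of_one_le_right hlC hS1
      have h4 : c * S * (1 / 2) = 4 * S + Real.log (2 * C) * S + 11 / 2 * S := by rw [hc]; ring
      linarith
    have h5 : C * Q ^ 4 * (Real.exp (-(c * S * Real.log 2)) * P) =
        Real.exp (Real.log (2 * C) + 4 * Real.log Q + 2 * l - c * S * Real.log 2) * (T / 2) := by
      rw [hll, sub_eq_add_neg _ (c * S * Real.log 2), Real.exp_add, Real.exp_add, Real.exp_add,
        Real.exp_sub, Real.exp_log hP, Real.exp_log hT, Real.exp_log (by linarith),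
        mul_comm 4 (Real.log Q), Real.exp_mul, Real.exp_log hQ0]
      norm_cast
      field_simp
    rw [h5]
    exact mul_le_of_le_one_left (by linarith) (Real.exp_le_one_iff.2 (by linarith))
  have hE1 : Real.exp (-(c * S * Real.log 2)) ≤ E / δ ^ 4 := by
    have h1 : Real.exp (-(c * S * Real.log 2)) ≤ 1 :=
      Real.exp_le_one_iff.2 (by nlinarith)
    have h2 : 1 ≤ E := Real.one_le_exp (by
      have : 0 ≤ Real.log 4 := Real.log_nonneg (by norm_num)
      rw [hlog4]
      positivity)
    have h3 : δ ^ 4 ≤ 1 := pow_le_one₀ hδ.le (by linarith)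
    rw [le_div_iff₀ (by positivity)]
    nlinarith [pow_pos hδ 4, Real.exp_pos (-(c * S * Real.log 2))]
  have hT4 : T ≤ 4 * C * Q ^ 4 * (E / δ ^ 4) * (I + Z) := by
    have hCQ : 0 ≤ C * Q ^ 4 := by positivity
    have h1 := mul_le_mul_of_nonneg_left (mul_le_mul_of_nonneg_right hE1 hZ) hCQ
    have h2 : 0 ≤ C * Q ^ 4 * (E / δ ^ 4 * I) := by positivity
    calc T ≤ 2 * (C * Q ^ 4 * (E / δ ^ 4 * (I + Z) + Real.exp (-(c * S * Real.log 2)) * (P + Z)) -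
          C * Q ^ 4 * (Real.exp (-(c * S * Real.log 2)) * P)) := by linarith
      _ = 2 * (C * Q ^ 4 * (E / δ ^ 4 * I) + C * Q ^ 4 * (E / δ ^ 4 * Z) +
          C * Q ^ 4 * (Real.exp (-(c * S * Real.log 2)) * Z)) := by ring
      _ ≤ 2 * (2 * (C * Q ^ 4 * (E / δ ^ 4 * I)) + C * Q ^ 4 * (E / δ ^ 4 * Z) +
          C * Q ^ 4 * (E / δ ^ 4 * Z)) := by linarith
      _ = _ := by ring
  have hIZ : I + Z ≤ (I + δ ^ 2 * Z) / δ ^ 2 := by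
    rw [le_div_iff₀ (by positivity)]
    have : δ ^ 2 ≤ 1 := pow_le_one₀ hδ.le (by linarith)
    nlinarith
  have hW : 0 ≤ I + δ ^ 2 * Z := by positivity
  have hcoef : 4 * C * Q ^ 4 * (E / δ ^ 4) / δ ^ 2 ≤
      Real.exp (y * ((5 * c + 6 + Real.log (4 * C)) * S)) := by
    have h1 : 4 * C * Q ^ 4 * (E / δ ^ 4) / δ ^ 2 = Real.exp (Real.log (4 * C) +
        4 * Real.log Q + c * S * (1 / 2 + 2 * Real.log (4 * Q / δ)) - 6 * Real.log δ) := by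
      rw [Real.exp_sub, Real.exp_add, Real.exp_add, ← hE, Real.exp_log (by linarith),
        mul_comm 4 (Real.log Q), Real.exp_mul, Real.exp_log hQ0, mul_comm 6 (Real.log δ), Real.exp_mul, Real.exp_log hδ]
      norm_cast
      field_simp
    rw [h1, Real.exp_le_exp, hlog4, hyd]
    have hyS : 1 ≤ y * S := one_le_mul_of_one_le_of_one_le (by linarith) hS1
    have h2 : Real.log (4 * C) ≤ Real.log (4 * C) * (y * S) := le_mul_of_one_le_right hlC4 hyS
    have h3 : c * S * (1 / 2 + 2 * (Real.log 4 + y)) ≤ c * S * (5 * y) :=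
      mul_le_mul_of_nonneg_left (by linarith) hcS
    have h4 : y ≤ y * S := le_mul_of_one_le_right (by linarith) hS1
    have h6 : y * ((5 * c + 6 + Real.log (4 * C)) * S) =
        c * S * (5 * y) + 6 * (y * S) + Real.log (4 * C) * (y * S) := by ring
    linarith
  have hpow : (δ / Q) ^ ((5 * c + 6 + Real.log (4 * C)) * S) =
      Real.exp (-(y * ((5 * c + 6 + Real.log (4 * C)) * S))) := by
    rw [Real.rpow_def_of_pos (by positivity), Real.log_div hδ.ne' hQ0.ne', hyd]
    congr 1
    ring
  rw [mul_assoc (5 * c + 6 + Real.log (4 * C)), ← hS, hpow, Real.exp_neg, inv_mul_le_iff₀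
    (Real.exp_pos _)]
  calc T ≤ 4 * C * Q ^ 4 * (E / δ ^ 4) * ((I + δ ^ 2 * Z) / δ ^ 2) := hT4.trans (by gcongr)
    _ = 4 * C * Q ^ 4 * (E / δ ^ 4) / δ ^ 2 * (I + δ ^ 2 * Z) := by ring
    _ ≤ _ := mul_le_mul_of_nonneg_right hcoef hW

end Optimization

lemma norm_sub_le_of_mem_openBox {d : ℕ} {xc x y : EuclideanSpace ℝ (Fin d)} {L : ℝ}
    (hx : x ∈ openBox xc L) (hy : y ∈ openBox xc L) : ‖x - y‖ ≤ d * L := by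
  have h : ∀ i, ‖(x - y) i‖ ≤ L := fun i => by
    have h1 := hx i
    have h2 := hy i
    rw [abs_lt] at h1 h2
    rw [PiLp.sub_apply, Real.norm_eq_abs, abs_le]
    constructor <;> linarith
  calc ‖x - y‖ = ‖∑ i, EuclideanSpace.single i ((x - y) i)‖ := by
        congr 1
        ext j
        simp [Finset.sum_apply, Pi.single_apply]
    _ ≤ ∑ i, ‖EuclideanSpace.single i ((x - y) i)‖ := norm_sum_le _ _
    _ ≤ ∑ _i : Fin d, L := Finset.sum_le_sum fun i _ => by
        rw [PiLp.norm_single]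
        exact h i
    _ = d * L := by simp

/-- Quantitative unique continuation principle in a box with Dirichlet
boundary condition: there is `m > 0` depending only on `d` such that for the open box
`Λ = Λ_L(x_c)`, `V` with `‖V‖_∞ ≤ K` on `Λ`, `ψ` continuous on `closure Λ`, C² on `Λ`,
vanishing on `∂Λ`, with `ψ` and `ζ := -Δψ + Vψ` square-integrable on `Λ`, every bounded
measurable `Θ ⊆ Λ` with `‖ψ_Θ‖₂ > 0`, every `x₀ ∈ Λ ∖ closure Θ` with
`Q := sup_{y∈Θ}|y-x₀| ≥ 1`, and every `0 < δ ≤ min{dist(x₀,Θ), 1/24}` with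
`B(x₀,δ) ⊆ Λ`:
`(δ/Q)^{m(1+K^{2/3})(Q^{4/3} + log(‖ψ‖_{L²(Λ)}/‖ψ_Θ‖₂))} ‖ψ_Θ‖₂² ≤ ‖ψ_{B(x₀,δ)}‖₂² + δ²‖ζ‖_{L²(Λ)}²`. -/
theorem quantitative_unique_continuation_box (d : ℕ) (hd : 1 ≤ d) :
    ∃ m > (0 : ℝ),
      ∀ (xc : EuclideanSpace ℝ (Fin d)) (L : ℝ), 0 < L →
      ∀ (V : EuclideanSpace ℝ (Fin d) → ℝ) (K : ℝ), Measurable V →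
        (∀ x ∈ openBox xc L, |V x| ≤ K) →
      ∀ ψ : EuclideanSpace ℝ (Fin d) → ℝ,
        ContinuousOn ψ (closure (openBox xc L)) →
        ContDiffOn ℝ 2 ψ (openBox xc L) →
        (∀ x ∈ frontier (openBox xc L), ψ x = 0) →
        IntegrableOn (fun x => ψ x ^ 2) (openBox xc L) →
        IntegrableOn (fun x => (-(lap ψ x) + V x * ψ x) ^ 2) (openBox xc L) →
      ∀ Θ : Set (EuclideanSpace ℝ (Fin d)), Θ ⊆ openBox xc L → Bornology.IsBounded Θ →
        MeasurableSet Θ → 0 < ∫ x in Θ, ψ x ^ 2 →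
      ∀ x₀ ∈ openBox xc L \ closure Θ,
        ∀ Q : ℝ, Q = sSup ((fun y => ‖y - x₀‖) '' Θ) → 1 ≤ Q →
      ∀ δ : ℝ, 0 < δ → δ ≤ min (Metric.infDist x₀ Θ) (1 / 24) →
        Metric.ball x₀ δ ⊆ openBox xc L →
        (δ / Q) ^ (m * (1 + K ^ ((2 : ℝ) / 3)) * (Q ^ ((4 : ℝ) / 3) +
            Real.log (Real.sqrt (∫ x in openBox xc L, ψ x ^ 2) /
              Real.sqrt (∫ x in Θ, ψ x ^ 2)))) *
            ∫ x in Θ, ψ x ^ 2 ≤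
          (∫ x in Metric.ball x₀ δ ∩ openBox xc L, ψ x ^ 2) +
            δ ^ 2 * ∫ x in openBox xc L, (-(lap ψ x) + V x * ψ x) ^ 2 := by
  obtain ⟨C, hC1, hC⟩ := box_three_region_inequality d
  obtain ⟨m, hm, hmC⟩ := exists_exponent_of_three_region_inequality hC1
  refine ⟨m, hm, ?_⟩
  intro xc L hL V K hV hVK ψ hψ hψ2 hψ0 hψi hζ Θ hΘO hΘb hΘ hT x₀ hx₀ Q hQ hQ1 δ hδ hδle hball
  obtain ⟨r, hr⟩ := hΘb.subset_closedBall x₀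
  have hbdd : BddAbove ((fun y => ‖y - x₀‖) '' Θ) := by
    refine ⟨r, ?_⟩
    rintro _ ⟨y, hy, rfl⟩
    simpa [dist_eq_norm] using hr hy
  have hne : Θ.Nonempty := by
    rw [nonempty_iff_ne_empty]
    rintro rfl
    simp at hT
  have hQL : Q ≤ d * L := by
    rw [hQ]
    refine csSup_le (hne.image _) ?_
    rintro _ ⟨y, hy, rfl⟩
    exact norm_sub_le_of_mem_openBox (hΘO hy) hx₀.1
  rw [inter_eq_left.2 hball]
  refine hmC K Q δ _ _ _ _ ((abs_nonneg _).trans (hVK x₀ hx₀.1)) hQ1 hδ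
    (hδle.trans (min_le_right _ _)) hT
    (setIntegral_mono_set hψi (Eventually.of_forall fun x => sq_nonneg _) hΘO.eventuallyLE)
    (integral_nonneg fun x => sq_nonneg _) (integral_nonneg fun x => sq_nonneg _) fun α hα hαK => ?_
  refine hC xc L hL V K hV hVK ψ hψ hψ2 hψ0 hζ Θ x₀ Q δ α hΘO hΘ hx₀.1 hQ1 hQL hδ
    (hδle.trans ((min_le_right _ _).trans (by norm_num))) hball hα hαK (fun x hx => ?_)
    fun x hx => hQ ▸ le_csSup hbdd (mem_image_of_mem _ hx)
  rw [← dist_eq_norm, dist_comm]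
  exact (hδle.trans (min_le_left _ _)).trans (Metric.infDist_le_dist_of_mem hx)
end

section
/- Define φ : [0,∞) → ℝ by φ(s) = s · exp(−∫₀^s (1−e^{−t})/t dt), where the integrand (1−e^{−t})/t is continuously extended by the value 1 at t = 0. Then: (i) φ is continuous on [0,∞), infinitely differentiable on (0,∞), and strictly increasing on [0,∞); (ii) φ(1)^{−1} ∈ (2,3); (iii) φ(1)·s ≤ φ(s) ≤ s for all s ∈ [0,1]. Consequently, for every ρ > 0 the function w_ρ(x) := φ(|x|/ρ) on ℝ^d satisfies |x|/(C₁ρ) ≤ w_ρ(x) ≤ |x|/ρ for all x ∈ B(0,ρ), where C₁ = φ(1)^{−1}. -/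
open Set

/-- The weight function `φ(s) = s · exp(-∫₀^s (1-e^{-t})/t dt)`, the integrand being
continuously extended by the value `1` at `t = 0`. -/
noncomputable def phiWeight (s : ℝ) : ℝ :=
  s * Real.exp (-∫ t in (0 : ℝ)..s, if t = 0 then 1 else (1 - Real.exp (-t)) / t)

/-- The continuous extension of `(1 - e^{-t}) / t` to the real line. -/
noncomputable def einIntegrand (t : ℝ) : ℝ :=
  if t = 0 then 1 else (1 - Real.exp (-t)) / t

/-- The entire exponential integral `∫₀^s (1 - e^{-t}) / t dt`. -/
noncomputable def einIntegral (s : ℝ) : ℝ :=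
  ∫ t in (0 : ℝ)..s, einIntegrand t

theorem phiWeight_eq (s : ℝ) : phiWeight s = s * Real.exp (-einIntegral s) := rfl

theorem mul_einIntegrand (t : ℝ) : t * einIntegrand t = 1 - Real.exp (-t) := by
  unfold einIntegrand
  split_ifs with h
  · simp [h]
  · field_simp

theorem continuous_einIntegrand : Continuous einIntegrand := by
  have hd (t : ℝ) : HasDerivAt (fun t : ℝ => -Real.exp (-t)) (Real.exp (-t)) t := by
    exact (hasDerivAt_neg t).exp.neg.congr_deriv (by ring)
  have h : einIntegrand = dslope (fun t : ℝ => -Real.exp (-t)) 0 := by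
    funext t
    unfold einIntegrand
    split_ifs with ht
    · simp [ht, (hd 0).deriv]
    · rw [dslope_of_ne _ ht, slope_def_field]
      simp only [neg_zero, Real.exp_zero, sub_zero]
      ring
  rw [h, continuous_iff_continuousAt]
  intro t
  by_cases ht : t = 0
  · rw [ht, continuousAt_dslope_same]
    exact (hd 0).differentiableAt
  · exact (continuousAt_dslope_of_ne ht).2 (hd t).continuousAt

theorem intervalIntegrable_einIntegrand (a b : ℝ) :
    IntervalIntegrable einIntegrand MeasureTheory.volume a b :=
  continuous_einIntegrand.intervalIntegrable a b

theorem einIntegrand_nonneg {t : ℝ} (ht : 0 ≤ t) : 0 ≤ einIntegrand t := by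
  unfold einIntegrand
  split_ifs
  · exact zero_le_one
  · exact div_nonneg (by simpa using ht) ht

theorem einIntegrand_le_one {t : ℝ} (ht : 0 ≤ t) : einIntegrand t ≤ 1 := by
  unfold einIntegrand
  split_ifs
  · exact le_rfl
  · exact div_le_one_of_le₀ (by linarith [Real.add_one_le_exp (-t)]) ht

theorem exp_neg_le_quadratic {t : ℝ} (ht : 0 ≤ t) :
    Real.exp (-t) ≤ 1 - t + t ^ 2 / 2 := by
  rw [Real.exp_neg]
  refine inv_le_of_inv_le₀ (by nlinarith [sq_nonneg (t - 1)]) ?_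
  refine le_trans ?_ (Real.quadratic_le_exp_of_nonneg ht)
  rw [inv_le_iff_one_le_mul₀ (by nlinarith [sq_nonneg (t - 1)])]
  nlinarith [sq_nonneg (t ^ 2)]

theorem one_sub_half_le_einIntegrand {t : ℝ} (ht : 0 ≤ t) :
    1 - t / 2 ≤ einIntegrand t := by
  unfold einIntegrand
  split_ifs with h
  · linarith
  · rw [le_div_iff₀ (lt_of_le_of_ne ht (Ne.symm h))]
    nlinarith [exp_neg_le_quadratic ht]

theorem hasDerivAt_einIntegral (s : ℝ) :
    HasDerivAt einIntegral (einIntegrand s) s :=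
  continuous_einIntegrand.integral_hasStrictDerivAt 0 s |>.hasDerivAt

theorem monotoneOn_einIntegral : MonotoneOn einIntegral (Ici 0) := by
  refine monotoneOn_of_deriv_nonneg (convex_Ici 0)
    (fun s _ => (hasDerivAt_einIntegral s).continuousAt.continuousWithinAt)
    (fun s _ => (hasDerivAt_einIntegral s).differentiableAt.differentiableWithinAt) ?_
  intro s hs
  rw [interior_Ici] at hs
  rw [(hasDerivAt_einIntegral s).deriv]
  exact einIntegrand_nonneg (le_of_lt hs)

theorem einIntegral_zero : einIntegral 0 = 0 := by simp [einIntegral]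

theorem einIntegral_one_le : einIntegral 1 ≤ 1 := by
  have h := intervalIntegral.integral_mono_on zero_le_one
    (intervalIntegrable_einIntegrand 0 1) (intervalIntegrable_const (c := (1 : ℝ)))
    (fun t ht => einIntegrand_le_one ht.1)
  simpa [einIntegral] using h

theorem le_einIntegral_one : 3 / 4 ≤ einIntegral 1 := by
  have h := intervalIntegral.integral_mono_on zero_le_one
    (Continuous.intervalIntegrable (by fun_prop) 0 1)
    (intervalIntegrable_einIntegrand 0 1)
    (fun t ht => one_sub_half_le_einIntegrand ht.1)
  have hc : ∫ t in (0 : ℝ)..1, (1 - t / 2) = 3 / 4 := by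
    rw [intervalIntegral.integral_sub intervalIntegrable_const
      (Continuous.intervalIntegrable (by fun_prop) 0 1)]
    simp only [intervalIntegral.integral_const, intervalIntegral.integral_div, integral_id]
    norm_num
  rw [hc] at h
  exact h

theorem contDiffOn_einIntegral : ContDiffOn ℝ (⊤ : ℕ∞) einIntegral (Ioi 0) := by
  rw [contDiffOn_infty_iff_deriv_of_isOpen isOpen_Ioi]
  refine ⟨fun s _ => (hasDerivAt_einIntegral s).differentiableAt.differentiableWithinAt, ?_⟩
  have h : ContDiffOn ℝ (⊤ : ℕ∞) (fun t : ℝ => (1 - Real.exp (-t)) / t) (Ioi 0) :=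
    ContDiffOn.div (ContDiff.contDiffOn (by fun_prop)) contDiffOn_id
      fun t ht => ne_of_gt ht
  refine h.congr fun t ht => ?_
  rw [(hasDerivAt_einIntegral t).deriv, einIntegrand, if_neg (ne_of_gt ht)]

theorem hasDerivAt_phiWeight (s : ℝ) :
    HasDerivAt phiWeight (Real.exp (-s) * Real.exp (-einIntegral s)) s := by
  have h := (hasDerivAt_id s).mul (hasDerivAt_einIntegral s).neg.exp
  refine h.congr_deriv ?_
  simp only [id_eq]
  linear_combination (-Real.exp (-einIntegral s)) * mul_einIntegrand s

theorem strictMono_phiWeight : StrictMono phiWeight :=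
  strictMono_of_deriv_pos fun s => by
    rw [(hasDerivAt_phiWeight s).deriv]
    positivity

theorem phiWeight_one : phiWeight 1 = Real.exp (-einIntegral 1) := by
  rw [phiWeight_eq, one_mul]

theorem inv_phiWeight_one_mem : (phiWeight 1)⁻¹ ∈ Ioo (2 : ℝ) 3 := by
  rw [phiWeight_one, Real.exp_neg, inv_inv]
  constructor
  · have h := Real.quadratic_le_exp_of_nonneg (show (0 : ℝ) ≤ 3 / 4 by norm_num)
    linarith [Real.exp_le_exp.2 le_einIntegral_one]
  · linarith [Real.exp_le_exp.2 einIntegral_one_le, Real.exp_one_lt_three]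

theorem phiWeight_bounds {s : ℝ} (hs : s ∈ Icc (0 : ℝ) 1) :
    phiWeight 1 * s ≤ phiWeight s ∧ phiWeight s ≤ s := by
  have h0 : 0 ≤ einIntegral s :=
    einIntegral_zero ▸ monotoneOn_einIntegral (mem_Ici.2 le_rfl) hs.1 hs.1
  have h1 : einIntegral s ≤ einIntegral 1 :=
    monotoneOn_einIntegral hs.1 (mem_Ici.2 zero_le_one) hs.2
  rw [phiWeight_one, phiWeight_eq, mul_comm]
  exact ⟨mul_le_mul_of_nonneg_left (Real.exp_le_exp.2 (neg_le_neg h1)) hs.1,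
    mul_le_of_le_one_right hs.1 (Real.exp_le_one_iff.2 (neg_nonpos.2 h0))⟩

/-- Properties of the Carleman weight: `φ` is continuous on `[0,∞)`,
`C^∞` on `(0,∞)`, strictly increasing on `[0,∞)`; `φ(1)⁻¹ ∈ (2,3)`;
`φ(1)·s ≤ φ(s) ≤ s` for `s ∈ [0,1]`; and consequently for every `ρ > 0` the function
`w_ρ(x) = φ(|x|/ρ)` satisfies `|x|/(C₁ρ) ≤ w_ρ(x) ≤ |x|/ρ` on `B(0,ρ)`, with
`C₁ = φ(1)⁻¹`. -/
theorem phiWeight_properties (d : ℕ) :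
    ContinuousOn phiWeight (Ici 0) ∧
    ContDiffOn ℝ (⊤ : ℕ∞) phiWeight (Ioi 0) ∧
    StrictMonoOn phiWeight (Ici 0) ∧
    (phiWeight 1)⁻¹ ∈ Ioo (2 : ℝ) 3 ∧
    (∀ s ∈ Icc (0 : ℝ) 1, phiWeight 1 * s ≤ phiWeight s ∧ phiWeight s ≤ s) ∧
    (∀ ρ : ℝ, 0 < ρ → ∀ x ∈ Metric.ball (0 : EuclideanSpace ℝ (Fin d)) ρ,
      ‖x‖ / ((phiWeight 1)⁻¹ * ρ) ≤ phiWeight (‖x‖ / ρ) ∧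
        phiWeight (‖x‖ / ρ) ≤ ‖x‖ / ρ) := by
  refine ⟨fun s _ => (hasDerivAt_phiWeight s).continuousAt.continuousWithinAt,
    contDiffOn_id.mul contDiffOn_einIntegral.neg.exp, strictMono_phiWeight.strictMonoOn _,
    inv_phiWeight_one_mem, fun s hs => phiWeight_bounds hs, fun ρ hρ x hx => ?_⟩
  rw [mem_ball_zero_iff] at hx
  have h := phiWeight_bounds (s := ‖x‖ / ρ) ⟨by positivity, (div_le_one hρ).2 hx.le⟩
  refine ⟨le_of_eq_of_le ?_ h.1, h.2⟩
  rw [div_mul_eq_div_div, div_inv_eq_mul]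
  ring
end
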